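/- Let D ⊂ ℂ² be a bounded domain with smooth real-analytic boundary: there is a real-analytic function ρ defined on an open neighborhood W of the boundary ∂D such that D ∩ W = {z ∈ W : ρ(z) < 0}, ∂D = {z ∈ W : ρ(z) = 0}, and the gradient of ρ is nonvanishing on ∂D. Then there exists a positive integer m, depending only on D, such that every automorphism f of D whose fixed point set is discrete in D has a finite fixed point set of cardinality at most m. -/

import Mathlib

open Set Metric Filter Topology

noncomputable section

/-- `ℂ^n` with the Euclidean norm. -/
abbrev CSpace (n : ℕ) := EuclideanSpace ℂ (Fin n)

/-- `f` is an automorphism of the set `D`: a holomorphic bijection of `D` onto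
itself with a holomorphic inverse. -/
def AutOn {n : ℕ} (D : Set (CSpace n)) (f : CSpace n → CSpace n) : Prop :=
  DifferentiableOn ℂ f D ∧ Set.BijOn f D D ∧
  ∃ g : CSpace n → CSpace n, DifferentiableOn ℂ g D ∧ Set.BijOn g D D ∧
    (∀ z ∈ D, g (f z) = z) ∧ (∀ z ∈ D, f (g z) = z)

/-- The fixed point set of `f` in `D`. -/
def FixOn {n : ℕ} (D : Set (CSpace n)) (f : CSpace n → CSpace n) : Set (CSpace n) :=
  {z ∈ D | f z = z}

/-- Every point of `S` is isolated in `S`. -/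
def DiscreteIn {n : ℕ} (S : Set (CSpace n)) : Prop :=
  ∀ z ∈ S, ∃ ε > 0, ∀ w ∈ S, w ≠ z → ε ≤ dist w z

/-- `f` extends holomorphically beyond the boundary of `D`. -/
def ExtendsHolo {n : ℕ} (D : Set (CSpace n)) (f : CSpace n → CSpace n) : Prop :=
  ∃ U : Set (CSpace n), IsOpen U ∧ closure D ⊆ U ∧
    ∃ F : CSpace n → CSpace n, DifferentiableOn ℂ F U ∧ Set.EqOn F f D

/-- `H` is a compact subgroup of the automorphism group of `D`. -/
def IsCompactAutGroup {n : ℕ} (D : Set (CSpace n))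
    (H : Set (CSpace n → CSpace n)) : Prop :=
  (∀ f ∈ H, AutOn D f) ∧
  (∃ e ∈ H, ∀ z ∈ D, e z = z) ∧
  (∀ f ∈ H, ∀ g ∈ H, ∃ h ∈ H, ∀ z ∈ D, h z = f (g z)) ∧
  (∀ f ∈ H, ∃ g ∈ H, (∀ z ∈ D, g (f z) = z) ∧ (∀ z ∈ D, f (g z) = z)) ∧
  (∀ u : ℕ → (CSpace n → CSpace n), (∀ k, u k ∈ H) →
    ∃ φ : ℕ → ℕ, StrictMono φ ∧ ∃ f ∈ H, ∀ K : Set (CSpace n), K ⊆ D → IsCompact K →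
      TendstoUniformlyOn (fun k => u (φ k)) f Filter.atTop K)

/-- `D` has smooth real-analytic boundary, witnessed by the real-analytic defining
function `ρ` on the open neighborhood `W` of the boundary of `D`. -/
def RealAnalyticDefiningFn {n : ℕ} (D W : Set (CSpace n)) (ρ : CSpace n → ℝ) : Prop :=
  IsOpen W ∧ frontier D ⊆ W ∧ AnalyticOnNhd ℝ ρ W ∧
    D ∩ W = {z ∈ W | ρ z < 0} ∧ frontier D = {z ∈ W | ρ z = 0} ∧
    ∀ z ∈ frontier D, fderiv ℝ ρ z ≠ 0

set_option linter.unusedSectionVars false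

section

/-! ### Augmented chains spanned by finite lists of points -/

/-- Finite formal combinations of lists of points; a list of length `n` is a simplex of
dimension `n - 1`. -/
abbrev ListChain (F X : Type*) [CommRing F] := List X →₀ F

namespace ListChain

variable {F : Type*} [CommRing F] {X Y Z : Type*}

/-- The chain of a single list. -/
def simplex (F : Type*) [CommRing F] {X : Type*} (σ : List X) : ListChain F X :=
  Finsupp.single σ 1

/-- Linear extension of a map defined on lists. -/
def extend {M : Type*} [AddCommGroup M] [Module F M] (t : List X → M) : ListChain F X →ₗ[F] M :=
  Finsupp.linearCombination F t

@[simp] lemma extend_simplex {M : Type*} [AddCommGroup M] [Module F M] (t : List X → M)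
    (σ : List X) : extend t (simplex F σ) = t σ := by
  simp [extend, simplex]

lemma hom_ext {M : Type*} [AddCommGroup M] [Module F M] {S T : ListChain F X →ₗ[F] M}
    (h : ∀ σ, S (simplex F σ) = T (simplex F σ)) : S = T :=
  Finsupp.lhom_ext' fun σ => LinearMap.ext_ring (h σ)

/-- The chains supported on a set of lists. -/
abbrev on (F : Type*) [CommRing F] {X : Type*} (S : Set (List X)) :
    Submodule F (ListChain F X) :=
  Finsupp.supported F F S

lemma simplex_mem {S : Set (List X)} {σ : List X} (h : σ ∈ S) : simplex F σ ∈ on F S :=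
  Finsupp.single_mem_supported F 1 h

lemma map_mem_of_simplex {M : Type*} [AddCommGroup M] [Module F M] {S : Set (List X)}
    {V : Submodule F M} (T : ListChain F X →ₗ[F] M)
    (h : ∀ σ ∈ S, T (simplex F σ) ∈ V) {c : ListChain F X} (hc : c ∈ on F S) : T c ∈ V := by
  have : on F S ≤ V.comap T := by
    rw [on, Finsupp.supported_eq_span_single, Submodule.span_le]
    rintro _ ⟨σ, hσ, rfl⟩
    exact h σ hσ
  exact this hc

lemma eq_of_simplex {M : Type*} [AddCommGroup M] [Module F M] {S : Set (List X)}
    (T U : ListChain F X →ₗ[F] M)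
    (h : ∀ σ ∈ S, T (simplex F σ) = U (simplex F σ)) {c : ListChain F X} (hc : c ∈ on F S) :
    T c = U c := by
  have := map_mem_of_simplex (V := ⊥) (T - U) (S := S) (c := c)
    (fun σ hσ => by simp [h σ hσ]) hc
  simpa [sub_eq_zero] using this

lemma on_mono {S T : Set (List X)} (h : S ⊆ T) : on F S ≤ on F T :=
  Finsupp.supported_mono h

/-- Adjoining a vertex. -/
def cone (x : X) : ListChain F X →ₗ[F] ListChain F X := extend fun σ => simplex F (x :: σ)

@[simp] lemma cone_simplex (x : X) (σ : List X) :
    cone x (simplex F σ) = simplex F (x :: σ) := by simp [cone]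

/-- The boundary of a list. -/
def listBd (F : Type*) [CommRing F] {X : Type*} : List X → ListChain F X
  | [] => 0
  | x :: σ => simplex F σ - cone x (listBd F σ)

/-- The augmented boundary operator. -/
def bd : ListChain F X →ₗ[F] ListChain F X := extend (listBd F)

@[simp] lemma bd_nil : bd (simplex F ([] : List X)) = 0 := by simp [bd, listBd]

lemma bd_cons (x : X) (σ : List X) :
    bd (simplex F (x :: σ)) = simplex F σ - cone x (bd (simplex F σ)) := by
  simp [bd, listBd]

lemma bd_cone (x : X) (c : ListChain F X) : bd (cone x c) = c - cone x (bd c) := by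
  have : bd ∘ₗ cone x = LinearMap.id - cone x ∘ₗ (bd : ListChain F X →ₗ[F] ListChain F X) :=
    hom_ext fun σ => by simp [bd_cons]
  exact LinearMap.congr_fun this c

@[simp] lemma bd_bd (c : ListChain F X) : bd (bd c) = 0 := by
  have : bd ∘ₗ bd = (0 : ListChain F X →ₗ[F] ListChain F X) := by
    refine hom_ext fun σ => ?_
    induction σ with
    | nil => simp
    | cons x σ ih =>
      simp only [LinearMap.comp_apply, LinearMap.zero_apply] at ih ⊢
      rw [bd_cons, map_sub, bd_cone, ih]
      simp
  exact LinearMap.congr_fun this c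

/-- Push-forward of chains along a map of points. -/
def push (φ : X → Y) : ListChain F X →ₗ[F] ListChain F Y := extend fun σ => simplex F (σ.map φ)

@[simp] lemma push_simplex (φ : X → Y) (σ : List X) :
    push φ (simplex F σ) = simplex F (σ.map φ) := by simp [push]

lemma push_cone (φ : X → Y) (x : X) (c : ListChain F X) :
    push φ (cone x c) = cone (φ x) (push φ c) := by
  have : push φ ∘ₗ cone x = cone (F := F) (φ x) ∘ₗ push φ := hom_ext fun σ => by simp
  exact LinearMap.congr_fun this c

lemma push_bd (φ : X → Y) (c : ListChain F X) : push φ (bd c) = bd (push φ c) := by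
  have : push φ ∘ₗ bd = bd ∘ₗ push (F := F) φ := by
    refine hom_ext fun σ => ?_
    induction σ with
    | nil => simp
    | cons x σ ih =>
      simp only [LinearMap.comp_apply] at ih ⊢
      simp [bd_cons, push_cone, ih]
  exact LinearMap.congr_fun this c

lemma push_push (φ : X → Y) (ψ : Y → Z) (c : ListChain F X) :
    push ψ (push φ c) = push (ψ ∘ φ) c := by
  have : push ψ ∘ₗ push φ = push (F := F) (ψ ∘ φ) := hom_ext fun σ => by simp
  exact LinearMap.congr_fun this c

lemma push_id (c : ListChain F X) : push id c = c := by
  have : push id = (LinearMap.id : ListChain F X →ₗ[F] _) := hom_ext fun σ => by simp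
  exact LinearMap.congr_fun this c

/-- The prism between two vertex maps. -/
def listPrism (F : Type*) [CommRing F] (φ ψ : X → Y) : List X → ListChain F Y
  | [] => 0
  | x :: σ => simplex F (φ x :: ψ x :: σ.map ψ) - cone (φ x) (listPrism F φ ψ σ)

/-- The prism operator, a chain homotopy between two push-forwards. -/
def prism (φ ψ : X → Y) : ListChain F X →ₗ[F] ListChain F Y := extend (listPrism F φ ψ)

@[simp] lemma prism_nil (φ ψ : X → Y) : prism φ ψ (simplex F []) = 0 := by
  simp [prism, listPrism]

lemma prism_cons (φ ψ : X → Y) (x : X) (σ : List X) :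
    prism φ ψ (simplex F (x :: σ)) =
      simplex F (φ x :: ψ x :: σ.map ψ) - cone (φ x) (prism φ ψ (simplex F σ)) := by
  simp [prism, listPrism]

lemma prism_cone (φ ψ : X → Y) (x : X) (c : ListChain F X) :
    prism φ ψ (cone x c) = cone (φ x) (cone (ψ x) (push ψ c)) - cone (φ x) (prism φ ψ c) := by
  have : prism φ ψ ∘ₗ cone x = cone (F := F) (φ x) ∘ₗ cone (ψ x) ∘ₗ push ψ
      - cone (φ x) ∘ₗ prism φ ψ := hom_ext fun σ => by simp [prism_cons]
  exact LinearMap.congr_fun this c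

lemma bd_prism (φ ψ : X → Y) (c : ListChain F X) :
    bd (prism φ ψ c) = push ψ c - push φ c - prism φ ψ (bd c) := by
  have : bd ∘ₗ prism φ ψ = push (F := F) ψ - push φ - prism φ ψ ∘ₗ bd := by
    refine hom_ext fun σ => ?_
    induction σ with
    | nil => simp
    | cons x σ ih =>
      simp only [LinearMap.comp_apply, LinearMap.sub_apply] at ih ⊢
      rw [bd_cons, map_sub (prism (F := F) φ ψ), prism_cone, prism_cons, map_sub, bd_cone, ih]
      have h1 : simplex F (φ x :: ψ x :: σ.map ψ) =
          cone (φ x) (cone (ψ x) (push ψ (simplex F σ))) := by simp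
      have h2 : bd (cone (φ x) (cone (ψ x) (push ψ (simplex F σ)))) =
          cone (ψ x) (push ψ (simplex F σ)) - cone (φ x) (push ψ (simplex F σ))
           + cone (φ x) (cone (ψ x) (push ψ (bd (simplex F σ)))) := by
        rw [bd_cone, bd_cone, map_sub, push_bd]; abel
      rw [h1, h2]
      simp only [map_sub, push_simplex, cone_simplex, List.map_cons]
      abel
  exact LinearMap.congr_fun this c

/-! #### Supports -/

lemma cone_mem {S T : Set (List X)} {x : X} (h : ∀ σ ∈ S, x :: σ ∈ T) {c : ListChain F X}
    (hc : c ∈ on F S) : cone x c ∈ on F T :=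
  map_mem_of_simplex _ (fun σ hσ => by rw [cone_simplex]; exact simplex_mem (h σ hσ)) hc

lemma push_mem {φ : X → Y} {S : Set (List X)} {T : Set (List Y)} (h : ∀ σ ∈ S, σ.map φ ∈ T)
    {c : ListChain F X} (hc : c ∈ on F S) : push φ c ∈ on F T :=
  map_mem_of_simplex _ (fun σ hσ => by rw [push_simplex]; exact simplex_mem (h σ hσ)) hc

lemma bd_simplex_mem (σ : List X) :
    bd (simplex F σ) ∈ on F {τ : List X | τ.Sublist σ ∧ τ.length + 1 = σ.length} := by
  induction σ with
  | nil => simp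
  | cons x σ ih =>
    rw [bd_cons]
    refine Submodule.sub_mem _ (simplex_mem ⟨List.sublist_cons_self x σ, by simp⟩)
      (cone_mem ?_ ih)
    rintro τ ⟨h1, h2⟩
    exact ⟨h1.cons_cons x, by simp [h2]⟩

lemma bd_mem {S T : Set (List X)}
    (h : ∀ σ ∈ S, ∀ τ : List X, τ.Sublist σ → τ.length + 1 = σ.length → τ ∈ T)
    {c : ListChain F X} (hc : c ∈ on F S) : bd c ∈ on F T :=
  map_mem_of_simplex _ (fun σ hσ => on_mono (fun τ hτ => h σ hσ τ hτ.1 hτ.2)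
    (bd_simplex_mem σ)) hc

lemma prism_simplex_mem (φ ψ : X → Y) (σ : List X) :
    prism φ ψ (simplex F σ) ∈ on F {τ : List Y | τ.length = σ.length + 1 ∧
      ∀ y ∈ τ, ∃ x ∈ σ, y = φ x ∨ y = ψ x} := by
  induction σ with
  | nil => simp
  | cons x σ ih =>
    rw [prism_cons]
    refine Submodule.sub_mem _ (simplex_mem ⟨by simp, ?_⟩) (cone_mem ?_ ih)
    · intro y hy
      simp only [List.mem_cons, List.mem_map] at hy
      rcases hy with rfl | rfl | ⟨z, hz, rfl⟩
      · exact ⟨x, by simp, Or.inl rfl⟩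
      · exact ⟨x, by simp, Or.inr rfl⟩
      · exact ⟨z, by simp [hz], Or.inr rfl⟩
    · rintro τ ⟨h1, h2⟩
      refine ⟨by simp [h1], ?_⟩
      intro y hy
      rcases List.mem_cons.1 hy with rfl | hy
      · exact ⟨x, by simp, Or.inl rfl⟩
      · obtain ⟨z, hz, h⟩ := h2 y hy
        exact ⟨z, by simp [hz], h⟩

lemma prism_mem {φ ψ : X → Y} {S : Set (List X)} {T : Set (List Y)}
    (h : ∀ σ ∈ S, ∀ τ : List Y, τ.length = σ.length + 1 →
      (∀ y ∈ τ, ∃ x ∈ σ, y = φ x ∨ y = ψ x) → τ ∈ T)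
    {c : ListChain F X} (hc : c ∈ on F S) : prism φ ψ c ∈ on F T :=
  map_mem_of_simplex _ (fun σ hσ => on_mono (fun τ hτ => h σ hσ τ hτ.1 hτ.2)
    (prism_simplex_mem φ ψ σ)) hc

end ListChain

end

section

namespace ListChain

variable {F : Type*} [CommRing F] {X : Type*}

/-! ### Eliminating free orbits from a zigzag -/

/-- The norm operator of a permutation of order dividing `p`. -/
def normOp (p : ℕ) (g : Equiv.Perm X) : ListChain F X →ₗ[F] ListChain F X :=
  ∑ j ∈ Finset.range p, push (g ^ j : Equiv.Perm X)

/-- The operator `g - 1`. -/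
def diffOp (g : Equiv.Perm X) : ListChain F X →ₗ[F] ListChain F X :=
  push g - LinearMap.id

/-- The alternating operators `g - 1`, `1 + g + ... + g ^ (p - 1)`. -/
def altOp (p : ℕ) (g : Equiv.Perm X) (i : ℕ) : ListChain F X →ₗ[F] ListChain F X :=
  if Even i then diffOp g else normOp p g

lemma push_pow_succ (g : Equiv.Perm X) (j : ℕ) (c : ListChain F X) :
    push g (push (g ^ j : Equiv.Perm X) c) = push (g ^ (j + 1) : Equiv.Perm X) c := by
  rw [push_push, pow_succ']; rfl

lemma push_pow_add (g : Equiv.Perm X) (i j : ℕ) (c : ListChain F X) :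
    push (g ^ i : Equiv.Perm X) (push (g ^ j : Equiv.Perm X) c)
      = push (g ^ (i + j) : Equiv.Perm X) c := by
  rw [push_push, pow_add]; rfl

lemma diffOp_normOp {p : ℕ} {g : Equiv.Perm X} (hg : g ^ p = 1) (c : ListChain F X) :
    diffOp g (normOp p g c) = 0 := by
  simp only [diffOp, normOp, LinearMap.sub_apply, LinearMap.id_apply, LinearMap.sum_apply, map_sum,
    push_pow_succ]
  rw [Finset.sum_range_sub (fun j => push (g ^ j : Equiv.Perm X) c), hg]
  simp

lemma normOp_diffOp {p : ℕ} {g : Equiv.Perm X} (hg : g ^ p = 1) (c : ListChain F X) :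
    normOp p g (diffOp g c) = 0 := by
  have : ∀ j, push (g ^ j : Equiv.Perm X) (push g c) = push (g ^ (j + 1) : Equiv.Perm X) c := by
    intro j
    have := push_pow_add g j 1 c
    rwa [pow_one] at this
  simp only [diffOp, normOp, LinearMap.sub_apply, LinearMap.id_apply, LinearMap.sum_apply, map_sub,
    this]
  rw [← Finset.sum_sub_distrib,
    Finset.sum_range_sub (fun j => push (g ^ j : Equiv.Perm X) c), hg]
  simp

lemma altOp_altOp {p : ℕ} {g : Equiv.Perm X} (hg : g ^ p = 1) (i : ℕ) (c : ListChain F X) :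
    altOp p g (i + 1) (altOp p g i c) = 0 := by
  by_cases h : Even i
  · simp [altOp, h, Nat.even_add_one, normOp_diffOp hg]
  · simp [altOp, h, Nat.even_add_one, diffOp_normOp hg]

lemma bd_altOp (p : ℕ) (g : Equiv.Perm X) (i : ℕ) (c : ListChain F X) :
    bd (altOp p g i c) = altOp p g i (bd c) := by
  by_cases h : Even i <;>
  simp [altOp, h, diffOp, normOp, push_bd]

lemma altOp_mem {p : ℕ} {g : Equiv.Perm X} {S : Set (List X)}
    (h : ∀ σ ∈ S, σ.map g ∈ S) (i : ℕ) {c : ListChain F X} (hc : c ∈ on F S) :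
    altOp p g i c ∈ on F S := by
  have hj : ∀ j : ℕ, push (g ^ j : Equiv.Perm X) c ∈ on F S := by
    intro j
    induction j with
    | zero => simpa [push_id] using hc
    | succ j ih => rw [← push_pow_succ]; exact push_mem h ih
  by_cases hi : Even i
  · simp only [altOp, hi, if_true, diffOp, LinearMap.sub_apply, LinearMap.id_apply]
    exact Submodule.sub_mem _ (push_mem h hc) hc
  · simp only [altOp, hi, if_false, normOp, LinearMap.sum_apply]
    exact Submodule.sum_mem _ fun j _ => hj j

/-- The label of a list: the label of some vertex of the given colour. -/
def listLabel (Q : X → Prop) (lab : X → ℕ) (σ : List X) : ℕ :=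
  open Classical in if h : ∃ x ∈ σ, Q x then lab h.choose else 0

/-- The first contraction: `g ^ l σ ↦ σ + ... + g ^ (l - 1) σ`. -/
def contractDiff (p : ℕ) (g : Equiv.Perm X) (Q : X → Prop) (lab : X → ℕ) :
    ListChain F X →ₗ[F] ListChain F X :=
  open Classical in extend fun σ => if ∃ x ∈ σ, Q x then
    ∑ j ∈ Finset.range (listLabel Q lab σ),
      push (g ^ j : Equiv.Perm X) (push (g ^ (p - listLabel Q lab σ) : Equiv.Perm X) (simplex F σ))
    else 0

/-- The second contraction: `g ^ l σ ↦ σ` if `l = p - 1` and `0` otherwise. -/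
def contractNorm (p : ℕ) (g : Equiv.Perm X) (Q : X → Prop) (lab : X → ℕ) :
    ListChain F X →ₗ[F] ListChain F X :=
  open Classical in extend fun σ => if (∃ x ∈ σ, Q x) ∧ listLabel Q lab σ + 1 = p then
    push g (simplex F σ) else 0

/-- The contraction used in degree `i`. -/
def contraction (p : ℕ) (g : Equiv.Perm X) (Q : X → Prop) (lab : X → ℕ) (i : ℕ) :
    ListChain F X →ₗ[F] ListChain F X :=
  if Even i then contractNorm p g Q lab else contractDiff p g Q lab

/-- Projection onto the lists having a vertex of the given colour. -/
def colourPart (Q : X → Prop) : ListChain F X →ₗ[F] ListChain F X :=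
  open Classical in extend fun σ => if ∃ x ∈ σ, Q x then simplex F σ else 0

/-- Data for a colour class on which a permutation of order `p` acts freely, with labels that
are constant on the admissible lists. -/
structure ColourClass (p : ℕ) (g : Equiv.Perm X) (A : Set (List X)) (Q : X → Prop)
    (lab : X → ℕ) : Prop where
  pow_eq_one : g ^ p = 1
  invariant : ∀ x, Q (g x) ↔ Q x
  lab_lt : ∀ x, Q x → lab x < p
  lab_map : ∀ x, Q x → lab (g x) = if lab x + 1 = p then 0 else lab x + 1
  adm_map : ∀ σ ∈ A, σ.map g ∈ A
  adm_sub : ∀ σ ∈ A, ∀ τ : List X, τ.Sublist σ → τ ∈ A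
  lab_const : ∀ σ ∈ A, ∀ x ∈ σ, ∀ y ∈ σ, Q x → Q y → lab x = lab y

namespace ColourClass

variable {p : ℕ} {g : Equiv.Perm X} {A : Set (List X)} {Q : X → Prop} {lab : X → ℕ}

lemma map_exists (h : ColourClass p g A Q lab) (σ : List X) :
    (∃ x ∈ σ.map g, Q x) ↔ ∃ x ∈ σ, Q x := by
  simp [h.invariant]

lemma label_eq (h : ColourClass p g A Q lab) {σ : List X} (hσ : σ ∈ A) {x : X} (hx : x ∈ σ)
    (hQ : Q x) : listLabel Q lab σ = lab x := by
  have hex : ∃ x ∈ σ, Q x := ⟨x, hx, hQ⟩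
  rw [listLabel, dif_pos hex]
  exact h.lab_const σ hσ _ hex.choose_spec.1 _ hx hex.choose_spec.2 hQ

lemma label_lt (h : ColourClass p g A Q lab) {σ : List X} (hσ : σ ∈ A) (hex : ∃ x ∈ σ, Q x) :
    listLabel Q lab σ < p := by
  obtain ⟨x, hx, hQ⟩ := hex
  rw [h.label_eq hσ hx hQ]
  exact h.lab_lt x hQ

lemma label_map (h : ColourClass p g A Q lab) {σ : List X} (hσ : σ ∈ A) (hex : ∃ x ∈ σ, Q x) :
    listLabel Q lab (σ.map g) =
      if listLabel Q lab σ + 1 = p then 0 else listLabel Q lab σ + 1 := by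
  obtain ⟨x, hx, hQ⟩ := hex
  rw [h.label_eq hσ hx hQ, h.label_eq (h.adm_map σ hσ) (List.mem_map_of_mem hx)
    ((h.invariant x).2 hQ), h.lab_map x hQ]

lemma map_pow_adm (h : ColourClass p g A Q lab) {σ : List X} (hσ : σ ∈ A) (j : ℕ) :
    σ.map (g ^ j : Equiv.Perm X) ∈ A := by
  induction j with
  | zero => simpa using hσ
  | succ j ih =>
    have := h.adm_map _ ih
    rwa [List.map_map, ← Equiv.Perm.coe_mul, ← pow_succ'] at this

lemma map_pow_exists (h : ColourClass p g A Q lab) (σ : List X) (j : ℕ) :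
    (∃ x ∈ σ.map (g ^ j : Equiv.Perm X), Q x) ↔ ∃ x ∈ σ, Q x := by
  induction j with
  | zero => simp
  | succ j ih =>
    have := h.map_exists (σ.map (g ^ j : Equiv.Perm X))
    rw [List.map_map, ← Equiv.Perm.coe_mul, ← pow_succ'] at this
    exact this.trans ih

/-- Moving a list within its orbit to label zero. -/
lemma exists_label_zero (h : ColourClass p g A Q lab) {σ : List X} (hσ : σ ∈ A)
    (hex : ∃ x ∈ σ, Q x) :
    ∃ l < p, ∃ σ₀ ∈ A, (∃ x ∈ σ₀, Q x) ∧ listLabel Q lab σ₀ = 0 ∧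
      σ = σ₀.map (g ^ l : Equiv.Perm X) := by
  have key : ∀ k : ℕ, ∀ σ ∈ A, (∃ x ∈ σ, Q x) → listLabel Q lab σ + k = p →
      listLabel Q lab (σ.map (g ^ k : Equiv.Perm X)) = 0 := by
    intro k
    induction k with
    | zero => intro σ hσ hex hk; exact absurd (h.label_lt hσ hex) (by omega)
    | succ k ih =>
      intro σ hσ hex hk
      have hm := h.label_map hσ hex
      have he : σ.map (g ^ (k + 1) : Equiv.Perm X) = (σ.map g).map (g ^ k : Equiv.Perm X) := by
        rw [List.map_map, pow_succ]; rfl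
      rw [he]
      split_ifs at hm with h1
      · have : k = 0 := by omega
        subst this
        simpa using hm
      · exact ih _ (h.adm_map _ hσ) ((h.map_exists σ).2 hex) (by omega)
  have hl := h.label_lt hσ hex
  refine ⟨listLabel Q lab σ, hl, σ.map (g ^ (p - listLabel Q lab σ) : Equiv.Perm X),
    h.map_pow_adm hσ _, (h.map_pow_exists _ _).2 hex, key _ σ hσ hex (by omega), ?_⟩
  rw [List.map_map, ← Equiv.Perm.coe_mul, ← pow_add, Nat.add_sub_cancel' hl.le, h.pow_eq_one]
  simp

lemma label_pow (h : ColourClass p g A Q lab) {σ : List X} (hσ : σ ∈ A) (hex : ∃ x ∈ σ, Q x)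
    (h0 : listLabel Q lab σ = 0) {l : ℕ} (hl : l < p) :
    listLabel Q lab (σ.map (g ^ l : Equiv.Perm X)) = l := by
  induction l with
  | zero => simpa using h0
  | succ l ih =>
    have := h.label_map (h.map_pow_adm hσ l) ((h.map_pow_exists σ l).2 hex)
    rw [ih (by omega), if_neg (by omega), List.map_map, ← Equiv.Perm.coe_mul, ← pow_succ'] at this
    exact this

lemma contractDiff_apply (h : ColourClass p g A Q lab) {σ : List X} (hσ : σ ∈ A)
    (hex : ∃ x ∈ σ, Q x) (h0 : listLabel Q lab σ = 0) {l : ℕ} (hl : l < p) :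
    contractDiff p g Q lab (push (g ^ l : Equiv.Perm X) (simplex F σ)) =
      ∑ j ∈ Finset.range l, push (g ^ j : Equiv.Perm X) (simplex F σ) := by
  rw [push_simplex, contractDiff, extend_simplex, if_pos ((h.map_pow_exists σ l).2 hex),
    h.label_pow hσ hex h0 hl]
  refine Finset.sum_congr rfl fun j _ => ?_
  rw [← push_simplex, push_pow_add, push_pow_add]
  have : g ^ (j + (p - l + l)) = g ^ j := by
    rw [Nat.sub_add_cancel hl.le, pow_add, h.pow_eq_one, mul_one]
  rw [← add_assoc] at this
  rw [this]

lemma contractNorm_apply (h : ColourClass p g A Q lab) {σ : List X} (hσ : σ ∈ A)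
    (hex : ∃ x ∈ σ, Q x) (h0 : listLabel Q lab σ = 0) {l : ℕ} (hl : l < p) :
    contractNorm p g Q lab (push (g ^ l : Equiv.Perm X) (simplex F σ)) =
      if l + 1 = p then simplex F σ else 0 := by
  rw [push_simplex, contractNorm, extend_simplex, h.label_pow hσ hex h0 hl]
  by_cases hlp : l + 1 = p
  · rw [if_pos ⟨(h.map_pow_exists σ l).2 hex, hlp⟩, if_pos hlp, ← push_simplex, push_pow_succ, hlp,
      h.pow_eq_one, Equiv.Perm.coe_one, push_id]
  · rw [if_neg (fun h => hlp h.2), if_neg hlp]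

lemma colourPart_push (h : ColourClass p g A Q lab) (c : ListChain F X) :
    colourPart Q (push g c) = push g (colourPart Q c) := by
  have : colourPart Q ∘ₗ push g = push (F := F) g ∘ₗ colourPart Q := by
    refine hom_ext fun σ => ?_
    have hex := h.map_exists σ
    simp only [LinearMap.comp_apply, push_simplex, colourPart, extend_simplex]
    by_cases he : ∃ x ∈ σ, Q x
    · rw [if_pos he, if_pos (hex.2 he), push_simplex]
    · rw [if_neg he, if_neg (fun h => he (hex.1 h)), map_zero]
  exact LinearMap.congr_fun this c

lemma colourPart_push_pow (h : ColourClass p g A Q lab) (j : ℕ) (c : ListChain F X) :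
    colourPart Q (push (g ^ j : Equiv.Perm X) c) =
      push (g ^ j : Equiv.Perm X) (colourPart Q c) := by
  induction j with
  | zero => simp [push_id]
  | succ j ih => rw [← push_pow_succ, h.colourPart_push, ih, push_pow_succ]

lemma colourPart_altOp (h : ColourClass p g A Q lab) (i : ℕ) (c : ListChain F X) :
    colourPart Q (altOp p g i c) = altOp p g i (colourPart Q c) := by
  by_cases hi : Even i <;>
  simp [altOp, hi, diffOp, normOp, h.colourPart_push, h.colourPart_push_pow]

/-- The two contractions split the two periodic operators on coloured lists. -/
lemma contraction_split (h : ColourClass p g A Q lab) (i : ℕ) {c : ListChain F X}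
    (hc : c ∈ on F A) (hp : 0 < p) :
    contraction p g Q lab (i + 1) (altOp p g i (colourPart Q c)) +
      altOp p g (i + 1) (contraction p g Q lab i (colourPart Q c)) = colourPart Q c := by
  refine eq_of_simplex (S := A) (contraction p g Q lab (i + 1) ∘ₗ altOp p g i ∘ₗ colourPart Q +
      altOp p g (i + 1) ∘ₗ contraction p g Q lab i ∘ₗ colourPart Q) (colourPart Q) ?_ hc
  intro σ hσ
  by_cases hex : ∃ x ∈ σ, Q x
  swap
  · have : colourPart Q (simplex F σ) = 0 := by simp only [colourPart, extend_simplex, if_neg hex]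
    simp [this]
  have hR : colourPart Q (simplex F σ) = simplex F σ := by
    simp only [colourPart, extend_simplex, if_pos hex]
  simp only [LinearMap.add_apply, LinearMap.comp_apply, hR]
  obtain ⟨l, hl, σ₀, hσ₀, hex₀, h0, rfl⟩ := h.exists_label_zero hσ hex
  have hD : ∀ {k}, k < p → contractDiff p g Q lab (push (g ^ k : Equiv.Perm X) (simplex F σ₀)) =
      ∑ j ∈ Finset.range k, push (g ^ j : Equiv.Perm X) (simplex F σ₀) :=
    fun hk => h.contractDiff_apply hσ₀ hex₀ h0 hk
  have hN : ∀ {k}, k < p → contractNorm p g Q lab (push (g ^ k : Equiv.Perm X) (simplex F σ₀)) =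
      if k + 1 = p then simplex F σ₀ else 0 :=
    fun hk => h.contractNorm_apply hσ₀ hex₀ h0 hk
  have hper : normOp p g (push (g ^ l : Equiv.Perm X) (simplex F σ₀))
      = normOp p g (simplex F σ₀) := by
    clear hσ hex hR hl
    induction l with
    | zero => simp
    | succ l ih =>
      rw [← ih, ← push_pow_succ]
      have := normOp_diffOp h.pow_eq_one (push (g ^ l : Equiv.Perm X) (simplex F σ₀))
      simpa [diffOp, sub_eq_zero] using this
  rw [← push_simplex]
  by_cases hi : Even i
  · have hi' : ¬ Even (i + 1) := by simpa [Nat.even_add_one] using hi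
    simp only [altOp, contraction, hi, hi', if_true, if_false]
    simp only [diffOp, LinearMap.sub_apply, LinearMap.id_apply, map_sub, push_pow_succ]
    rw [hD hl, hN hl]
    by_cases hlp : l + 1 = p
    · rw [if_pos hlp, hlp, h.pow_eq_one]
      have h00 := hD hp
      rw [pow_zero] at h00
      rw [h00, ← hlp]
      simp [normOp, Finset.sum_range_succ]
    · rw [if_neg hlp, hD (by omega), Finset.sum_range_succ]
      simp
  · have hi' : Even (i + 1) := by simpa [Nat.even_add_one] using hi
    simp only [altOp, contraction, hi, hi', if_true, if_false]
    rw [hper, hD hl]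
    have hv : contractNorm p g Q lab (normOp p g (simplex F σ₀)) = simplex F σ₀ := by
      rw [normOp, LinearMap.sum_apply, map_sum,
        Finset.sum_congr rfl (fun j hj => hN (Finset.mem_range.1 hj))]
      obtain ⟨q, rfl⟩ : ∃ q, p = q + 1 := ⟨p - 1, by omega⟩
      simp
    rw [hv]
    simp only [diffOp, LinearMap.sub_apply, LinearMap.id_apply, map_sum, push_pow_succ]
    rw [Finset.sum_range_sub (fun j => push (g ^ j : Equiv.Perm X) (simplex F σ₀))]
    simp

/-- Coloured faces of a multiple of a list. -/
lemma colourPart_bd_contraction (h : ColourClass p g A Q lab) (i : ℕ) {c : ListChain F X}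
    (hc : c ∈ on F A) :
    colourPart Q (bd (contraction p g Q lab i c)) =
      contraction p g Q lab i (colourPart Q (bd c)) := by
  refine eq_of_simplex (S := A) (colourPart Q ∘ₗ bd ∘ₗ contraction p g Q lab i)
    (contraction p g Q lab i ∘ₗ colourPart Q ∘ₗ bd) ?_ hc
  intro σ hσ
  simp only [LinearMap.comp_apply]
  by_cases hex : ∃ x ∈ σ, Q x
  swap
  · have h1 : contraction p g Q lab i (simplex F σ) = 0 := by
      by_cases hi : Even i
      · simp only [contraction, hi, if_true, contractNorm, extend_simplex]
        rw [if_neg (fun h => hex h.1)]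
      · simp only [contraction, hi, if_false, contractDiff, extend_simplex]
        rw [if_neg hex]
    have h2 : colourPart Q (bd (simplex F σ)) = 0 := by
      refine eq_of_simplex (F := F) (M := ListChain F X) (colourPart Q) 0 ?_ (bd_simplex_mem σ)
      rintro τ ⟨hτ, -⟩
      simp only [colourPart, extend_simplex, LinearMap.zero_apply]
      rw [if_neg]
      rintro ⟨x, hx, hQ⟩
      exact hex ⟨x, hτ.subset hx, hQ⟩
    simp [h1, h2]
  obtain ⟨x₀, hx₀, hQ₀⟩ := hex
  have hex : ∃ x ∈ σ, Q x := ⟨x₀, hx₀, hQ₀⟩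
  have hlab : ∀ τ : List X, τ.Sublist σ → (∃ x ∈ τ, Q x) →
      listLabel Q lab τ = listLabel Q lab σ := by
    rintro τ hτ ⟨x, hx, hQ⟩
    rw [h.label_eq (h.adm_sub σ hσ τ hτ) hx hQ, h.label_eq hσ (hτ.subset hx) hQ]
  by_cases hi : Even i
  · simp only [contraction, hi, if_true]
    by_cases hp : listLabel Q lab σ + 1 = p
    · have h1 : contractNorm p g Q lab (simplex F σ) = push g (simplex F σ) := by
        rw [contractNorm, extend_simplex, if_pos ⟨hex, hp⟩]
      rw [h1, ← push_bd, h.colourPart_push]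
      refine (eq_of_simplex (F := F) (M := ListChain F X) (push g ∘ₗ colourPart Q) (contractNorm p g Q lab ∘ₗ colourPart Q) ?_
        (bd_simplex_mem σ))
      rintro τ ⟨hτ, -⟩
      simp only [LinearMap.comp_apply, colourPart, extend_simplex]
      split_ifs with ht
      · rw [contractNorm, extend_simplex, if_pos ⟨ht, by rw [hlab τ hτ ht, hp]⟩]
      · simp
    · have h1 : contractNorm p g Q lab (simplex F σ) = 0 := by
        rw [contractNorm, extend_simplex, if_neg (fun h => hp h.2)]
      rw [h1, map_zero, map_zero]
      refine (eq_of_simplex (F := F) (M := ListChain F X) 0 (contractNorm p g Q lab ∘ₗ colourPart Q) ?_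
        (bd_simplex_mem σ))
      rintro τ ⟨hτ, -⟩
      simp only [LinearMap.comp_apply, colourPart, extend_simplex, LinearMap.zero_apply]
      split_ifs with ht
      · rw [contractNorm, extend_simplex, if_neg (fun h => hp (by rw [← hlab τ hτ ht, h.2]))]
      · simp
  · simp only [contraction, hi, if_false]
    set l := listLabel Q lab σ with hl
    have h1 : contractDiff p g Q lab (simplex F σ) =
        ∑ j ∈ Finset.range l, push (g ^ j : Equiv.Perm X)
          (push (g ^ (p - l) : Equiv.Perm X) (simplex F σ)) := by
      rw [contractDiff, extend_simplex, if_pos hex]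
    rw [h1]
    simp only [map_sum, ← push_bd, h.colourPart_push_pow]
    have := (eq_of_simplex (∑ j ∈ Finset.range l, push (g ^ j : Equiv.Perm X) ∘ₗ
          push (g ^ (p - l) : Equiv.Perm X) ∘ₗ colourPart Q)
        (contractDiff p g Q lab ∘ₗ colourPart Q) (c := bd (simplex F σ)) ?_
        (bd_simplex_mem σ))
    · simpa using this
    rintro τ ⟨hτ, -⟩
    simp only [LinearMap.comp_apply, colourPart, extend_simplex, LinearMap.sum_apply]
    split_ifs with ht
    · rw [contractDiff, extend_simplex, if_pos ht, hlab τ hτ ht]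
    · simp

lemma contraction_mem {S : Set (List X)}
    (hS : ∀ σ ∈ S, σ.map g ∈ S) (i : ℕ) {c : ListChain F X} (hc : c ∈ on F S) :
    contraction p g Q lab i c ∈ on F S := by
  have hj : ∀ (j : ℕ) {c : ListChain F X}, c ∈ on F S →
      push (g ^ j : Equiv.Perm X) c ∈ on F S := by
    intro j c hc
    induction j with
    | zero => simpa [push_id] using hc
    | succ j ih => rw [← push_pow_succ]; exact push_mem hS ih
  refine map_mem_of_simplex _ (fun σ hσ => ?_) hc
  by_cases hi : Even i
  · simp only [contraction, hi, if_true, contractNorm, extend_simplex]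
    split_ifs
    · exact push_mem hS (simplex_mem hσ)
    · exact Submodule.zero_mem _
  · simp only [contraction, hi, if_false, contractDiff, extend_simplex]
    split_ifs
    · exact Submodule.sum_mem _ fun j _ => hj _ (hj _ (simplex_mem hσ))
    · exact Submodule.zero_mem _

/-- Removing one colour class from a zigzag. -/
theorem eliminate (h : ColourClass p g A Q lab) (hp : 0 < p) {a : ListChain F X}
    {b : ℕ → ListChain F X} {T : ℕ}
    (hb : ∀ i, b i ∈ on F A) (ha : colourPart Q a = 0)
    (hrel : ∀ i < T + 1, bd (b (i + 1)) = altOp p g i (b i) + if i = 0 then a else 0) :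
    ∃ b' : ℕ → ListChain F X, (∀ i, b' i ∈ on F {σ ∈ A | ∀ x ∈ σ, ¬ Q x}) ∧
      ∀ i < T, bd (b' (i + 1)) = altOp p g i (b' i) + if i = 0 then a else 0 := by
  set κ : ℕ → ListChain F X →ₗ[F] ListChain F X := fun i => contraction p g Q lab i with hκ
  set b' : ℕ → ListChain F X := fun i =>
    b i - bd (κ (i + 1) (b (i + 1))) - altOp p g (i + 1) (κ i (b i)) with hb'
  have hmem : ∀ i, b' i ∈ on F A := fun i =>
    Submodule.sub_mem _ (Submodule.sub_mem _ (hb i)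
      (bd_mem (fun σ hσ τ hτ _ => h.adm_sub σ hσ τ hτ) (contraction_mem h.adm_map _ (hb _))))
      (altOp_mem h.adm_map _ (contraction_mem h.adm_map _ (hb _)))
  have hR : ∀ i < T + 1, colourPart Q (b' i) = 0 := by
    intro i hi
    have hcomm : ∀ (j : ℕ) {c : ListChain F X}, c ∈ on F A →
        colourPart Q (κ j c) = κ j (colourPart Q c) := by
      intro j c hc
      refine eq_of_simplex (F := F) (M := ListChain F X) (colourPart Q ∘ₗ κ j) (κ j ∘ₗ colourPart Q) (fun σ hσ => ?_) hc
      simp only [LinearMap.comp_apply]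
      by_cases hex : ∃ x ∈ σ, Q x
      · have hR : colourPart Q (simplex F σ) = simplex F σ := by
          simp only [colourPart, extend_simplex, if_pos hex]
        rw [hR]
        have : κ j (simplex F σ) ∈ on F {τ : List X | ∃ x ∈ τ, Q x} :=
          contraction_mem (fun τ hτ => (h.map_exists τ).2 hτ) j (simplex_mem hex)
        refine eq_of_simplex (F := F) (M := ListChain F X) (colourPart Q) LinearMap.id (fun τ hτ => ?_) this
        simp only [colourPart, extend_simplex, LinearMap.id_apply]
        exact if_pos hτ
      · have hR : colourPart Q (simplex F σ) = 0 := by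
          simp only [colourPart, extend_simplex, if_neg hex]
        have : κ j (simplex F σ) = 0 := by
          by_cases hj : Even j
          · simp only [hκ, contraction, hj, if_true, contractNorm, extend_simplex]
            rw [if_neg (fun h => hex h.1)]
          · simp only [hκ, contraction, hj, if_false, contractDiff, extend_simplex]
            rw [if_neg hex]
        simp [hR, this]
    simp only [hb', map_sub]
    have e1 : colourPart Q (bd (κ (i + 1) (b (i + 1)))) =
        κ (i + 1) (altOp p g i (colourPart Q (b i))) := by
      rw [h.colourPart_bd_contraction (i + 1) (hb _), hrel i hi, map_add, h.colourPart_altOp]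
      split_ifs <;> simp [ha, hκ]
    have e2 : colourPart Q (altOp p g (i + 1) (κ i (b i))) =
        altOp p g (i + 1) (κ i (colourPart Q (b i))) := by
      rw [h.colourPart_altOp, hcomm i (hb i)]
    rw [e1, e2, sub_sub, h.contraction_split i (hb i) hp, sub_self]
  have hrel' : ∀ i < T, bd (b' (i + 1)) = altOp p g i (b' i) + if i = 0 then a else 0 := by
    intro i hi
    simp only [hb', map_sub, bd_bd, bd_altOp, hrel i (by omega)]
    have e1 := altOp_altOp h.pow_eq_one (i + 1) (κ i (b i))
    have hee : ∀ c : ListChain F X, altOp p g (i + 1 + 1) c = altOp p g i c := by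
      intro c
      simp [altOp, Nat.even_add_one]
    rw [hee] at e1
    rw [hee, e1]
    abel
  refine ⟨fun i => if i < T + 1 then b' i else 0, fun i => ?_, fun i hi => ?_⟩
  · dsimp only
    split_ifs with hi
    · have hm : b' i - colourPart Q (b' i) ∈ on F {σ ∈ A | ∀ x ∈ σ, ¬ Q x} := by
        refine map_mem_of_simplex (LinearMap.id - colourPart Q) (fun σ hσ => ?_) (hmem i)
        simp only [LinearMap.sub_apply, LinearMap.id_apply, colourPart, extend_simplex]
        split_ifs with hex
        · simp
        · rw [sub_zero]
          exact simplex_mem ⟨hσ, fun x hx hQ => hex ⟨x, hx, hQ⟩⟩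
      rwa [hR i hi, sub_zero] at hm
    · exact Submodule.zero_mem _
  · simp only [show i + 1 < T + 1 by omega, show i < T + 1 by omega, if_true]
    exact hrel' i hi

end ColourClass

/-- Removing all colours from a zigzag: if every list of `A` has constant labels on each of the
`N` colours, a zigzag of length `N + 1` produces a relation between lists without colours. -/
theorem eliminate_all {p : ℕ} (hp : 0 < p) {g : Equiv.Perm X} (hg : g ^ p = 1)
    {A : Set (List X)} (hAg : ∀ σ ∈ A, σ.map g ∈ A)
    (hAs : ∀ σ ∈ A, ∀ τ : List X, τ.Sublist σ → τ ∈ A)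
    {N : ℕ} {col lab : X → ℕ} (hcol : ∀ x, col (g x) = col x)
    (hlt : ∀ x, col x < N → lab x < p)
    (hmap : ∀ x, col x < N → lab (g x) = if lab x + 1 = p then 0 else lab x + 1)
    (hconst : ∀ σ ∈ A, ∀ x ∈ σ, ∀ y ∈ σ, col x < N → col x = col y → lab x = lab y)
    {a : ListChain F X} (ha : a ∈ on F {σ : List X | ∀ x ∈ σ, N ≤ col x})
    {b : ℕ → ListChain F X} (hb : ∀ i, b i ∈ on F A)
    (hrel : ∀ i < N + 1, bd (b (i + 1)) = altOp p g i (b i) + if i = 0 then a else 0) :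
    ∃ b₀ b₁ : ListChain F X, b₀ ∈ on F {σ ∈ A | ∀ x ∈ σ, N ≤ col x} ∧
      b₁ ∈ on F {σ ∈ A | ∀ x ∈ σ, N ≤ col x} ∧ bd b₁ = diffOp g b₀ + a := by
  have key : ∀ k ≤ N, ∃ b' : ℕ → ListChain F X,
      (∀ i, b' i ∈ on F {σ ∈ A | ∀ x ∈ σ, k ≤ col x}) ∧
      ∀ i < N - k + 1, bd (b' (i + 1)) = altOp p g i (b' i) + if i = 0 then a else 0 := by
    intro k
    induction k with
    | zero => exact fun _ => ⟨b, by simpa using hb, by simpa using hrel⟩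
    | succ k ih =>
      intro hk
      obtain ⟨b', hb', hrel'⟩ := ih (by omega)
      have hC : ColourClass p g {σ ∈ A | ∀ x ∈ σ, k ≤ col x} (fun x => col x = k) lab := by
        refine ⟨hg, fun x => by rw [hcol], fun x hx => hlt x (by omega),
          fun x hx => hmap x (by omega), ?_, ?_, ?_⟩
        · rintro σ ⟨h1, h2⟩
          refine ⟨hAg σ h1, ?_⟩
          simpa [hcol] using h2
        · rintro σ ⟨h1, h2⟩ τ hτ
          exact ⟨hAs σ h1 τ hτ, fun x hx => h2 x (hτ.subset hx)⟩
        · rintro σ ⟨h1, h2⟩ x hx y hy hQx hQy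
          exact hconst σ h1 x hx y hy (by omega) (by rw [hQx, hQy])
      have ha' : colourPart (fun x => col x = k) a = 0 := by
        refine eq_of_simplex (F := F) (M := ListChain F X) (colourPart _) 0 (fun σ hσ => ?_) ha
        simp only [colourPart, extend_simplex, LinearMap.zero_apply]
        rw [if_neg]
        rintro ⟨x, hx, hxk⟩
        have := hσ x hx
        omega
      obtain ⟨b'', hb'', hrel''⟩ := hC.eliminate (T := N - (k + 1) + 1) hp hb' ha'
        (fun i hi => hrel' i (by omega))
      refine ⟨b'', fun i => on_mono ?_ (hb'' i), hrel''⟩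
      rintro σ ⟨⟨h1, h2⟩, h3⟩
      refine ⟨h1, fun x hx => ?_⟩
      have e1 := h2 x hx
      have e2 := h3 x hx
      omega
  obtain ⟨b', hb', hrel'⟩ := key N le_rfl
  refine ⟨b' 0, b' 1, hb' 0, hb' 1, ?_⟩
  have := hrel' 0 (by omega)
  simpa [altOp] using this

end ListChain

end

section

namespace ListChain

/-- Lists of length `n` with vertices in `C` and mutual distances at most `d`. -/
def nearLists {E : Type*} [PseudoMetricSpace E] (C : Set E) (d : ℝ) (n : ℕ) : Set (List E) :=
  {σ | σ.length = n ∧ (∀ x ∈ σ, x ∈ C) ∧ ∀ x ∈ σ, ∀ y ∈ σ, dist x y ≤ d}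

/-! ### Barycentric subdivision -/

section Subdivision

variable {F : Type*} [CommRing F] {E : Type*} [NormedAddCommGroup E] [NormedSpace ℝ E]

/-- The barycentre of a list of points. -/
def barycentre (σ : List E) : E := (σ.length : ℝ)⁻¹ • σ.sum

/-- The subdivision operator on lists of length `n`. -/
def subdiv (F : Type*) [CommRing F] {E : Type*} [NormedAddCommGroup E] [NormedSpace ℝ E] :
    ℕ → ListChain F E →ₗ[F] ListChain F E
  | 0 => LinearMap.id
  | n + 1 => extend fun σ => cone (barycentre σ) (subdiv F n (bd (simplex F σ)))

/-- The homotopy between the subdivision operator and the identity. -/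
def subdivHomotopy (F : Type*) [CommRing F] {E : Type*} [NormedAddCommGroup E] [NormedSpace ℝ E] :
    ℕ → ListChain F E →ₗ[F] ListChain F E
  | 0 => 0
  | n + 1 => extend fun σ => cone (barycentre σ)
      (simplex F σ - subdivHomotopy F n (bd (simplex F σ)))

lemma subdiv_succ_simplex (n : ℕ) (σ : List E) : subdiv F (n + 1) (simplex F σ) =
    cone (barycentre σ) (subdiv F n (bd (simplex F σ))) := by
  simp [subdiv]

lemma subdivHomotopy_succ_simplex (n : ℕ) (σ : List E) :
    subdivHomotopy F (n + 1) (simplex F σ) =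
    cone (barycentre σ) (simplex F σ - subdivHomotopy F n (bd (simplex F σ))) := by
  simp [subdivHomotopy]

lemma bd_subdiv (n : ℕ) (c : ListChain F E) :
    bd (subdiv F (n + 1) c) = subdiv F n (bd c) := by
  induction n generalizing c with
  | zero =>
    have : bd ∘ₗ subdiv F 1 = subdiv F 0 ∘ₗ (bd : ListChain F E →ₗ[F] _) :=
      hom_ext fun σ => by
        rw [LinearMap.comp_apply, subdiv_succ_simplex, bd_cone]
        simp [subdiv]
    exact LinearMap.congr_fun this c
  | succ n ih =>
    have : bd ∘ₗ subdiv F (n + 2) = subdiv F (n + 1) ∘ₗ (bd : ListChain F E →ₗ[F] _) :=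
      hom_ext fun σ => by
        rw [LinearMap.comp_apply, subdiv_succ_simplex, bd_cone, ih]
        simp
    exact LinearMap.congr_fun this c

lemma bd_subdivHomotopy_of_cycle (n : ℕ) {c : ListChain F E} (hc : bd c = 0) :
    bd (subdivHomotopy F n c) = c - subdiv F n c := by
  have key : ∀ n : ℕ, ∀ c : ListChain F E, bd (subdivHomotopy F (n + 1) c) =
      c - subdiv F (n + 1) c - subdivHomotopy F n (bd c) := by
    intro n
    induction n with
    | zero =>
      intro c
      have : bd ∘ₗ subdivHomotopy F 1 = LinearMap.id - subdiv F 1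
          - subdivHomotopy F 0 ∘ₗ (bd : ListChain F E →ₗ[F] _) :=
        hom_ext fun σ => by
          rw [LinearMap.comp_apply, subdivHomotopy_succ_simplex, bd_cone]
          simp [subdiv, subdivHomotopy]
      exact LinearMap.congr_fun this c
    | succ n ih =>
      intro c
      have : bd ∘ₗ subdivHomotopy F (n + 2) = LinearMap.id - subdiv F (n + 2)
          - subdivHomotopy F (n + 1) ∘ₗ (bd : ListChain F E →ₗ[F] _) :=
        hom_ext fun σ => by
          rw [LinearMap.comp_apply, subdivHomotopy_succ_simplex, bd_cone, map_sub, ih]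
          simp only [LinearMap.sub_apply, LinearMap.id_apply, LinearMap.comp_apply,
            subdiv_succ_simplex, bd_bd, map_zero, sub_zero, sub_sub_cancel]
          abel
      exact LinearMap.congr_fun this c
  cases n with
  | zero => simp [subdivHomotopy, subdiv]
  | succ n => simp [key, hc]

lemma barycentre_mem {σ : List E} (hσ : σ ≠ []) {C : Set E} (hC : Convex ℝ C)
    (h : ∀ x ∈ σ, x ∈ C) : barycentre σ ∈ C := by
  have key : ∀ σ : List E, σ ≠ [] → (∀ x ∈ σ, x ∈ C) → barycentre σ ∈ C := by
    intro σ
    induction σ with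
    | nil => intro h; exact absurd rfl h
    | cons x σ ih =>
      intro _ h
      by_cases hs : σ = []
      · subst hs
        simpa [barycentre] using h x (by simp)
      · have h1 := ih hs fun y hy => h y (by simp [hy])
        have h2 := h x (by simp)
        have hl : (0 : ℝ) < σ.length := by
          exact_mod_cast List.length_pos_iff.2 hs
        have := hC h2 h1 (a := ((σ.length : ℝ) + 1)⁻¹) (b := ((σ.length : ℝ) + 1)⁻¹ * σ.length)
          (by positivity) (by positivity) (by field_simp; ring)
        convert this using 1
        simp only [barycentre, List.length_cons, List.sum_cons, smul_add, smul_smul]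
        push_cast
        congr 2
        field_simp
  exact key σ hσ h

lemma dist_barycentre_le {σ : List E} {d : ℝ} (hd : ∀ x ∈ σ, ∀ y ∈ σ, dist x y ≤ d) {x : E}
    (hx : x ∈ σ) : dist (barycentre σ) x ≤ (1 - (σ.length : ℝ)⁻¹) * d := by
  have hl : (0 : ℝ) < σ.length := by exact_mod_cast List.length_pos_of_mem hx
  have key : ∀ τ : List E, (∀ y ∈ τ, dist y x ≤ d) → ‖τ.sum - (τ.length : ℝ) • x‖ ≤ τ.length * d := by
    intro τ
    induction τ with
    | nil => simp
    | cons y τ ih =>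
      intro h
      have h1 := ih fun z hz => h z (by simp [hz])
      have h2 := h y (by simp)
      rw [dist_eq_norm] at h2
      have : (y :: τ).sum - ((y :: τ).length : ℝ) • x =
          (y - x) + (τ.sum - (τ.length : ℝ) • x) := by
        simp only [List.sum_cons, List.length_cons]
        push_cast
        rw [add_smul, one_smul]; abel
      rw [this]
      refine (norm_add_le _ _).trans ?_
      simp only [List.length_cons]
      push_cast
      linarith
  obtain ⟨s, t, rfl⟩ := List.append_of_mem hx
  have hs := key (s ++ t) fun y hy => hd y (by
    simp only [List.mem_append, List.mem_cons] at hy ⊢; tauto) x hx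
  have e : barycentre (s ++ x :: t) - x = ((s ++ x :: t).length : ℝ)⁻¹ •
      ((s ++ t).sum - ((s ++ t).length : ℝ) • x) := by
    have : x = ((s ++ x :: t).length : ℝ)⁻¹ • (((s ++ x :: t).length : ℝ) • x) := by
      rw [smul_smul, inv_mul_cancel₀ hl.ne', one_smul]
    nth_rewrite 2 [this]
    rw [barycentre, ← smul_sub]
    congr 1
    simp only [List.length_append, List.length_cons, List.sum_append, List.sum_cons]
    push_cast
    module
  rw [dist_eq_norm, e, norm_smul, norm_inv, Real.norm_of_nonneg hl.le]
  have e2 : ((s ++ x :: t).length : ℝ) = (s ++ t).length + 1 := by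
    simp only [List.length_append, List.length_cons]
    push_cast; ring
  rw [e2] at hl ⊢
  calc _ ≤ (((s ++ t).length : ℝ) + 1)⁻¹ * ((s ++ t).length * d) := by gcongr
    _ = _ := by field_simp; ring

lemma convex_dist_le (x : E) (d : ℝ) : Convex ℝ {y : E | dist y x ≤ d} := convex_closedBall x d

lemma dist_hull_le {σ : List E} {d : ℝ} (hd : ∀ x ∈ σ, ∀ y ∈ σ, dist x y ≤ d) {x y : E}
    (hx : x ∈ convexHull ℝ {x | x ∈ σ}) (hy : y ∈ convexHull ℝ {x | x ∈ σ}) : dist x y ≤ d := by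
  have h1 : ∀ z ∈ σ, dist x z ≤ d := fun z hz =>
    convexHull_min (t := {y : E | dist y z ≤ d}) (fun w hw => hd w hw z hz)
      (convex_dist_le z d) hx
  rw [dist_comm]
  refine convexHull_min (t := {y : E | dist y x ≤ d}) (fun w hw => ?_) (convex_dist_le x d) hy
  rw [mem_ofPred_eq, dist_comm]
  exact h1 w hw

lemma subdiv_simplex_mem (n : ℕ) {σ : List E} (hn : σ.length = n) {d : ℝ} (hd0 : 0 ≤ d)
    (hd : ∀ x ∈ σ, ∀ y ∈ σ, dist x y ≤ d) :
    subdiv F n (simplex F σ) ∈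
      on F (nearLists (convexHull ℝ {x | x ∈ σ}) ((1 - (n : ℝ)⁻¹) * d) n) := by
  induction n generalizing σ with
  | zero =>
    have : σ = [] := List.length_eq_zero_iff.1 hn
    subst this
    exact simplex_mem ⟨rfl, by simp, by simp⟩
  | succ n ih =>
    have hne : σ ≠ [] := by rintro rfl; simp at hn
    have hb : barycentre σ ∈ convexHull ℝ {x | x ∈ σ} :=
      barycentre_mem hne (convex_convexHull ℝ _) fun x hx => subset_convexHull ℝ _ hx
    have hbd : ∀ y ∈ convexHull ℝ {x | x ∈ σ},
        dist y (barycentre σ) ≤ (1 - ((n + 1 : ℕ) : ℝ)⁻¹) * d := by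
      intro y hy
      refine convexHull_min (t := {y : E | dist y (barycentre σ) ≤ _}) (fun w hw => ?_)
        (convex_dist_le _ _) hy
      rw [mem_ofPred_eq, dist_comm, ← hn]
      exact dist_barycentre_le hd hw
    rw [subdiv_succ_simplex]
    refine cone_mem (S := nearLists (convexHull ℝ {x | x ∈ σ}) ((1 - ((n + 1 : ℕ) : ℝ)⁻¹) * d) n)
      ?_ ?_
    · rintro τ ⟨h1, h2, h3⟩
      refine ⟨by simp [h1], ?_, ?_⟩
      · intro x hx
        rcases List.mem_cons.1 hx with rfl | hx
        · exact hb
        · exact h2 x hx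
      · intro x hx y hy
        rcases List.mem_cons.1 hx with rfl | hx <;> rcases List.mem_cons.1 hy with rfl | hy
        · exact hbd _ hb
        · rw [dist_comm]; exact hbd _ (h2 y hy)
        · exact hbd _ (h2 x hx)
        · exact h3 x hx y hy
    · refine map_mem_of_simplex _ (fun τ hτ => ?_) (bd_simplex_mem σ)
      have hsub : {x | x ∈ τ} ⊆ {x | x ∈ σ} := fun x hx => hτ.1.subset hx
      refine on_mono ?_ (ih (σ := τ) (by have := hτ.2; omega)
        fun x hx y hy => hd x (hsub hx) y (hsub hy))
      rintro ρ ⟨h1, h2, h3⟩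
      refine ⟨h1, fun x hx => convexHull_mono hsub (h2 x hx), fun x hx y hy => (h3 x hx y hy).trans ?_⟩
      rcases Nat.eq_zero_or_pos n with rfl | hn0
      · have : ρ = [] := List.length_eq_zero_iff.1 h1
        subst this
        simp at hx
      · gcongr
        simp

lemma subdivHomotopy_simplex_mem (n : ℕ) {σ : List E} (hn : σ.length = n) :
    subdivHomotopy F n (simplex F σ) ∈
      on F {τ | τ.length = n + 1 ∧ ∀ x ∈ τ, x ∈ convexHull ℝ {x | x ∈ σ}} := by
  induction n generalizing σ with
  | zero => simp [subdivHomotopy]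
  | succ n ih =>
    have hne : σ ≠ [] := by rintro rfl; simp at hn
    have hb : barycentre σ ∈ convexHull ℝ {x | x ∈ σ} :=
      barycentre_mem hne (convex_convexHull ℝ _) fun x hx => subset_convexHull ℝ _ hx
    rw [subdivHomotopy_succ_simplex]
    refine cone_mem (S := {τ | τ.length = n + 1 ∧ ∀ x ∈ τ, x ∈ convexHull ℝ {x | x ∈ σ}}) ?_ ?_
    · rintro τ ⟨h1, h2⟩
      refine ⟨by simp [h1], fun x hx => ?_⟩
      rcases List.mem_cons.1 hx with rfl | hx
      · exact hb
      · exact h2 x hx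
    · refine Submodule.sub_mem _ (simplex_mem ⟨hn, fun x hx => subset_convexHull ℝ _ hx⟩) ?_
      refine map_mem_of_simplex _ (fun τ hτ => ?_) (bd_simplex_mem σ)
      refine on_mono ?_ (ih (σ := τ) (by have := hτ.2; omega))
      rintro ρ ⟨h1, h2⟩
      exact ⟨h1, fun x hx => convexHull_mono (fun y hy => hτ.1.subset hy) (h2 x hx)⟩

lemma subdiv_pow_simplex_mem (n m : ℕ) {C : Set E} {d : ℝ} (hd0 : 0 ≤ d) {σ : List E}
    (hn : σ.length = n) (hC : convexHull ℝ {x | x ∈ σ} ⊆ C) (hd : ∀ x ∈ σ, ∀ y ∈ σ, dist x y ≤ d) :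
    (subdiv F n ^ m) (simplex F σ) ∈ on F {τ ∈ nearLists C ((1 - (n : ℝ)⁻¹) ^ m * d) n |
      convexHull ℝ {x | x ∈ τ} ⊆ C} := by
  induction m with
  | zero =>
    rw [pow_zero, pow_zero, one_mul, Module.End.one_apply]
    exact simplex_mem ⟨⟨hn, fun x hx => hC (subset_convexHull ℝ _ hx), hd⟩, hC⟩
  | succ m ih =>
    rw [pow_succ' (subdiv F n), Module.End.mul_apply]
    refine map_mem_of_simplex _ ?_ ih
    rintro τ ⟨⟨h1, h2, h3⟩, h4⟩
    have hr : (0 : ℝ) ≤ 1 - (n : ℝ)⁻¹ := by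
      rcases Nat.eq_zero_or_pos n with rfl | hn0
      · simp
      · have : (1 : ℝ) ≤ n := by exact_mod_cast hn0
        rw [sub_nonneg]
        exact inv_le_one_of_one_le₀ this
    refine on_mono ?_ (subdiv_simplex_mem n h1 (by positivity) h3)
    rintro ρ ⟨r1, r2, r3⟩
    refine ⟨⟨r1, fun x hx => h4 (r2 x hx), ?_⟩,
      (convexHull_min (fun x hx => r2 x hx) (convex_convexHull ℝ _)).trans h4⟩
    rw [pow_succ', mul_assoc]
    exact r3

end Subdivision

/-- Small cycles bound small chains once they are pushed into a compact set and the nerve of a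
finite net of that set does not see them. -/
theorem exists_fill {E : Type*} [NormedAddCommGroup E] [NormedSpace ℝ E] [ProperSpace E]
    {D K : Set E} {W : E → E} (hD : IsOpen D) (hK : IsCompact K) (hKD : K ⊆ D)
    (hW : Continuous W) (hpath : ∀ z ∈ D, ∀ t ∈ Icc (0 : ℝ) 1, z + t • W z ∈ D)
    (hWK : ∀ z ∈ D, z + W z ∈ K) :
    ∃ (P : Finset E) (π : E → E), (∀ z ∈ D, π (z + W z) ∈ P) ∧
      ∀ (n : ℕ) (L : Set E), IsCompact L → L ⊆ D → ∃ L' : Set E, IsCompact L' ∧ L' ⊆ D ∧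
      ∀ ε > 0, ∃ δ > 0, ∀ (F : Type) [CommRing F], ∃ T : ListChain F E →ₗ[F] ListChain F E,
        (∀ c ∈ on F (nearLists L δ n), T c ∈ on F (nearLists L' ε (n + 1))) ∧
        ∀ c ∈ on F (nearLists L δ n), bd c = 0 → push (fun z => π (z + W z)) c = 0 →
          bd (T c) = c := by
  obtain ⟨ε₀, hε₀, hthick⟩ := hK.exists_cthickening_subset_open hD hKD
  obtain ⟨P, hPK, hP⟩ := hK.elim_finite_subcover_image (b := K) (c := fun x => ball x (ε₀ / 4))
    (fun x _ => isOpen_ball) (fun x hx => mem_biUnion hx (mem_ball_self (by positivity)))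
  obtain ⟨hPfin, hPcov⟩ := hP
  have hπ : ∀ y : E, ∃ q, y ∈ K → q ∈ P ∧ dist y q < ε₀ / 4 := by
    intro y
    by_cases hy : y ∈ K
    · obtain ⟨q, hq, hyq⟩ := mem_iUnion₂.1 (hPcov hy)
      exact ⟨q, fun _ => ⟨hq, hyq⟩⟩
    · exact ⟨y, fun h => absurd h hy⟩
  choose π hπ using hπ
  refine ⟨hPfin.toFinset, π, fun z hz => by simpa using (hπ _ (hWK z hz)).1, ?_⟩
  intro n L hL hLD
  set L₁ : Set E := (fun q : E × ℝ => q.1 + q.2 • W q.1) '' (L ×ˢ Icc 0 1) with hL₁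
  have hL₁c : IsCompact L₁ := (hL.prod isCompact_Icc).image (by fun_prop)
  have hmemL₁ : ∀ z ∈ L, ∀ t ∈ Icc (0 : ℝ) 1, z + t • W z ∈ L₁ := fun z hz t ht =>
    ⟨(z, t), ⟨hz, ht⟩, rfl⟩
  refine ⟨L₁ ∪ cthickening ε₀ K, hL₁c.union hK.cthickening, union_subset ?_ hthick, ?_⟩
  · rintro _ ⟨⟨z, t⟩, ⟨hz, ht⟩, rfl⟩
    exact hpath z (hLD hz) t ht
  intro ε hε
  obtain ⟨R, hR⟩ := (hL.image hW).isBounded.exists_norm_le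
  have hR' : ∀ z ∈ L, ‖W z‖ ≤ |R| := fun z hz =>
    (hR _ (mem_image_of_mem _ hz)).trans (le_abs_self R)
  obtain ⟨M, hM⟩ : ∃ M : ℕ, |R| / (M + 1) < ε / 4 := by
    obtain ⟨M, hM⟩ := exists_nat_gt (|R| / (ε / 4))
    refine ⟨M, ?_⟩
    rw [div_lt_iff₀ (by positivity)] at hM ⊢
    nlinarith
  obtain ⟨m, hm⟩ : ∃ m : ℕ, (1 - ((n + 1 : ℕ) : ℝ)⁻¹) ^ m * ε₀ < ε := by
    have h1 : (1 - ((n + 1 : ℕ) : ℝ)⁻¹) < 1 := by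
      have : (0 : ℝ) < ((n + 1 : ℕ) : ℝ)⁻¹ := by positivity
      linarith
    obtain ⟨m, hm⟩ := exists_pow_lt_of_lt_one (show 0 < ε / ε₀ by positivity) h1
    exact ⟨m, by rwa [lt_div_iff₀ hε₀] at hm⟩
  set η : ℝ := min (ε / 4) (ε₀ / 8) with hη
  have hη0 : 0 < η := by positivity
  obtain ⟨δ₁, hδ₁, hWδ⟩ := Metric.uniformContinuousOn_iff_le.1
    (hL.uniformContinuousOn_of_continuous hW.continuousOn) η hη0
  set δ : ℝ := min δ₁ η with hδ
  have hδ0 : 0 < δ := by positivity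
  refine ⟨δ, hδ0, fun F _ => ?_⟩
  set φ : ℕ → E → E := fun j z => z + ((j : ℝ) / (M + 1)) • W z with hφ
  have htj : ∀ j ≤ M + 1, ((j : ℝ) / (M + 1)) ∈ Icc (0 : ℝ) 1 := by
    intro j hj
    refine ⟨by positivity, (div_le_one (by positivity)).2 (by exact_mod_cast hj)⟩
  have hφL : ∀ j ≤ M + 1, ∀ z ∈ L, φ j z ∈ L₁ := fun j hj z hz => hmemL₁ z hz _ (htj j hj)
  have hφd : ∀ j ≤ M + 1, ∀ x ∈ L, ∀ y ∈ L, dist x y ≤ δ → dist (φ j x) (φ j y) ≤ 2 * η := by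
    intro j hj x hx y hy hxy
    have h1 : dist x y ≤ η := hxy.trans (min_le_right _ _)
    have h2 := hWδ x hx y hy (hxy.trans (min_le_left _ _))
    calc dist (φ j x) (φ j y) ≤ dist x y + dist (((j : ℝ) / (M + 1)) • W x)
          (((j : ℝ) / (M + 1)) • W y) := dist_add_add_le _ _ _ _
      _ ≤ η + 1 * η := by
        rw [dist_smul₀]
        gcongr
        rw [Real.norm_of_nonneg (htj j hj).1]
        exact (htj j hj).2
      _ = 2 * η := by ring
  have hφs : ∀ j, ∀ x ∈ L, dist (φ j x) (φ (j + 1) x) ≤ ε / 4 := by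
    intro j x hx
    have : φ j x - φ (j + 1) x = -((1 / ((M : ℝ) + 1)) • W x) := by
      simp only [hφ]
      push_cast
      rw [add_sub_add_left_eq_sub, ← sub_smul, ← neg_smul]
      congr 1
      ring
    rw [dist_eq_norm, this, norm_neg, norm_smul, Real.norm_of_nonneg (by positivity)]
    calc 1 / ((M : ℝ) + 1) * ‖W x‖ ≤ 1 / ((M : ℝ) + 1) * |R| := by gcongr; exact hR' x hx
      _ = |R| / (M + 1) := by ring
      _ ≤ ε / 4 := hM.le
  have hφM : φ (M + 1) = fun z => z + W z := by
    funext z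
    simp only [hφ]
    push_cast
    rw [div_self (by positivity), one_smul]
  set S : ListChain F E →ₗ[F] ListChain F E :=
    ∑ j ∈ Finset.range (M + 1), prism (φ j) (φ (j + 1)) with hS
  have hSmem : ∀ c ∈ on F (nearLists L δ n), S c ∈
      on F (nearLists (L₁ ∪ cthickening ε₀ K) ε (n + 1)) := by
    intro c hc
    rw [hS, LinearMap.sum_apply]
    refine Submodule.sum_mem _ fun j hj => prism_mem ?_ hc
    have hj' := Finset.mem_range.1 hj
    rintro σ ⟨h1, h2, h3⟩ τ hτ1 hτ2
    have hηε : η ≤ ε / 4 := min_le_left _ _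
    refine ⟨by omega, fun y hy => ?_, fun y hy y' hy' => ?_⟩
    · obtain ⟨x, hx, rfl | rfl⟩ := hτ2 y hy
      · exact Or.inl (hφL _ (by omega) x (h2 x hx))
      · exact Or.inl (hφL _ (by omega) x (h2 x hx))
    · obtain ⟨x, hx, hyx⟩ := hτ2 y hy
      obtain ⟨x', hx', hyx'⟩ := hτ2 y' hy'
      have a1 := hφd j (by omega) x (h2 x hx) x' (h2 x' hx') (h3 x hx x' hx')
      have a2 := hφs j x (h2 x hx)
      have a3 := hφs j x' (h2 x' hx')
      have b1 : dist y (φ j x) ≤ ε / 4 := by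
        rcases hyx with rfl | rfl
        · rw [dist_self]; positivity
        · rwa [dist_comm]
      have b2 : dist (φ j x') y' ≤ ε / 4 := by
        rcases hyx' with rfl | rfl
        · rw [dist_self]; positivity
        · exact a3
      have := dist_triangle4 y (φ j x) (φ j x') y'
      linarith
  have hSbd : ∀ c : ListChain F E, bd c = 0 → bd (S c) = push (φ (M + 1)) c - c := by
    intro c hc
    rw [hS, LinearMap.sum_apply, map_sum]
    have : ∀ j ∈ Finset.range (M + 1), bd (prism (φ j) (φ (j + 1)) c) =
        push (φ (j + 1)) c - push (φ j) c := by
      intro j _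
      rw [bd_prism, hc, map_zero, sub_zero]
    rw [Finset.sum_congr rfl this, Finset.sum_range_sub (fun j => push (φ j) c)]
    have h0 : φ 0 = id := by funext z; simp [hφ]
    rw [h0, push_id]
  set ψ : ListChain F E →ₗ[F] ListChain F E := push (fun z => z + W z) with hψ
  set Cp : ListChain F E →ₗ[F] ListChain F E := prism id π with hCp
  set Tm : ListChain F E →ₗ[F] ListChain F E :=
    ∑ i ∈ Finset.range m, subdivHomotopy F n ∘ₗ (subdiv F n ^ i) with hTm
  refine ⟨Tm ∘ₗ ψ - (subdiv F (n + 1) ^ m) ∘ₗ Cp ∘ₗ ψ - S, fun c hc => ?_, fun c hc hbc hpc => ?_⟩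
  · have hψc : ψ c ∈ on F (nearLists K (2 * η) n) := by
      refine push_mem ?_ hc
      rintro σ ⟨h1, h2, h3⟩
      refine ⟨by simp [h1], ?_, ?_⟩
      · intro y hy
        obtain ⟨x, hx, rfl⟩ := List.mem_map.1 hy
        exact hWK x (hLD (h2 x hx))
      · intro y hy y' hy'
        obtain ⟨x, hx, rfl⟩ := List.mem_map.1 hy
        obtain ⟨x', hx', rfl⟩ := List.mem_map.1 hy'
        have := hφd (M + 1) le_rfl x (h2 x hx) x' (h2 x' hx') (h3 x hx x' hx')
        rwa [hφM] at this
    have hη8 : η ≤ ε₀ / 8 := min_le_right _ _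
    have hη4 : η ≤ ε / 4 := min_le_left _ _
    have hhull : ∀ τ : List E, (∃ x ∈ K, ∀ y ∈ τ, dist y x ≤ ε₀) →
        convexHull ℝ {y | y ∈ τ} ⊆ L₁ ∪ cthickening ε₀ K := by
      rintro τ ⟨x, hx, h⟩
      refine (convexHull_min (t := closedBall x ε₀) (fun y hy => h y hy)
        (convex_closedBall x ε₀)).trans ?_
      exact (closedBall_subset_cthickening hx ε₀).trans subset_union_right
    refine Submodule.sub_mem _ (Submodule.sub_mem _ ?_ ?_) (hSmem c hc)
    · rw [LinearMap.comp_apply]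
      refine map_mem_of_simplex _ ?_ hψc
      rintro τ ⟨h1, h2, h3⟩
      by_cases hne : τ = []
      · subst hne
        have : n = 0 := h1.symm
        subst this
        simp [hTm, subdivHomotopy]
      obtain ⟨x₀, hx₀⟩ := List.exists_mem_of_ne_nil _ hne
      have hC := hhull τ ⟨x₀, h2 x₀ hx₀, fun y hy => (h3 y hy x₀ hx₀).trans (by linarith)⟩
      rw [hTm, LinearMap.sum_apply]
      refine Submodule.sum_mem _ fun i _ => ?_
      rw [LinearMap.comp_apply]
      refine map_mem_of_simplex _ ?_ (subdiv_pow_simplex_mem n i (by positivity) h1 hC h3)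
      rintro ρ ⟨⟨r1, r2, r3⟩, r4⟩
      refine on_mono ?_ (subdivHomotopy_simplex_mem n r1)
      rintro ρ' ⟨s1, s2⟩
      refine ⟨s1, fun x hx => r4 (s2 x hx), fun x hx y hy => ?_⟩
      refine (dist_hull_le r3 (s2 x hx) (s2 y hy)).trans ?_
      have hr : (1 - (n : ℝ)⁻¹) ^ i ≤ 1 := by
        refine pow_le_one₀ ?_ (by simp)
        rcases Nat.eq_zero_or_pos n with rfl | hn0
        · simp
        · have : (1 : ℝ) ≤ n := by exact_mod_cast hn0
          rw [sub_nonneg]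
          exact inv_le_one_of_one_le₀ this
      calc _ ≤ 1 * (2 * η) := by gcongr
        _ ≤ ε := by linarith
    · rw [LinearMap.comp_apply, LinearMap.comp_apply]
      have hC : Cp (ψ c) ∈ on F {τ : List E | τ.length = n + 1 ∧
          (∀ x ∈ τ, ∀ y ∈ τ, dist x y ≤ ε₀) ∧
          convexHull ℝ {x | x ∈ τ} ⊆ L₁ ∪ cthickening ε₀ K} := by
        refine prism_mem ?_ hψc
        rintro σ ⟨h1, h2, h3⟩ τ hτ1 hτ2
        have hd : ∀ y ∈ τ, ∃ x ∈ σ, dist y x ≤ ε₀ / 4 := by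
          intro y hy
          obtain ⟨x, hx, rfl | rfl⟩ := hτ2 y hy
          · exact ⟨y, hx, by rw [dist_self]; positivity⟩
          · refine ⟨x, hx, ?_⟩
            rw [dist_comm]
            exact (hπ x (h2 x hx)).2.le
        have hd2 : ∀ y ∈ τ, ∀ x ∈ σ, dist y x ≤ ε₀ / 2 := by
          intro y hy x hx
          obtain ⟨x', hx', hyx'⟩ := hd y hy
          have := dist_triangle y x' x
          have := h3 x' hx' x hx
          linarith
        have hne : τ ≠ [] := by rintro rfl; simp at hτ1
        obtain ⟨y₀, hy₀⟩ := List.exists_mem_of_ne_nil _ hne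
        obtain ⟨x₀, hx₀, -⟩ := hd y₀ hy₀
        refine ⟨by omega, fun y hy y' hy' => ?_, hhull τ ⟨x₀, h2 x₀ hx₀, fun y hy => ?_⟩⟩
        · have e1 := hd2 y hy x₀ hx₀
          have e2 := hd2 y' hy' x₀ hx₀
          have := dist_triangle_right y y' x₀
          linarith
        · have e1 := hd2 y hy x₀ hx₀
          linarith
      refine map_mem_of_simplex _ ?_ hC
      rintro τ ⟨h1, h2, h3⟩
      refine on_mono ?_ (subdiv_pow_simplex_mem (n + 1) m hε₀.le h1 h3 h2)
      rintro ρ ⟨⟨r1, r2, r3⟩, -⟩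
      exact ⟨r1, r2, fun x hx y hy => (r3 x hx y hy).trans hm.le⟩
  · have hcyc : bd (ψ c) = 0 := by rw [hψ, ← push_bd, hbc, map_zero]
    have hCbd : bd (Cp (ψ c)) = -ψ c := by
      rw [hCp, bd_prism, hcyc, map_zero, sub_zero, push_id, hψ, push_push]
      rw [show push (π ∘ fun z => z + W z) c = 0 from hpc, zero_sub]
    have hpow : ∀ i, bd ((subdiv F n ^ i) (ψ c)) = 0 := by
      intro i
      induction i with
      | zero => simpa using hcyc
      | succ i ih =>
        rw [pow_succ', Module.End.mul_apply]
        cases n with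
        | zero => simpa [subdiv] using ih
        | succ n => rw [bd_subdiv, ih, map_zero]
    have hT : bd (Tm (ψ c)) = ψ c - (subdiv F n ^ m) (ψ c) := by
      rw [hTm, LinearMap.sum_apply, map_sum]
      have : ∀ i ∈ Finset.range m, bd ((subdivHomotopy F n ∘ₗ (subdiv F n ^ i)) (ψ c)) =
          (subdiv F n ^ i) (ψ c) - (subdiv F n ^ (i + 1)) (ψ c) := by
        intro i _
        rw [LinearMap.comp_apply, bd_subdivHomotopy_of_cycle _ (hpow i), pow_succ',
          Module.End.mul_apply]
      rw [Finset.sum_congr rfl this, Finset.sum_range_sub' (fun i => (subdiv F n ^ i) (ψ c))]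
      simp
    have hsd : ∀ (i : ℕ) (e : ListChain F E),
        bd ((subdiv F (n + 1) ^ i) e) = (subdiv F n ^ i) (bd e) := by
      intro i e
      induction i with
      | zero => simp
      | succ i ih =>
        rw [pow_succ', Module.End.mul_apply, bd_subdiv, ih, pow_succ', Module.End.mul_apply]
    simp only [LinearMap.sub_apply, LinearMap.comp_apply, map_sub]
    rw [hT, hsd, hCbd, hSbd c hbc, hφM, map_neg]
    simp only [hψ]
    abel

end ListChain

end

section

/-! ### Packing and colouring orbits -/

open MeasureTheory in
lemma card_le_of_separated_ball {V : Type*} [NormedAddCommGroup V] [NormedSpace ℝ V]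
    [FiniteDimensional ℝ V] (s : Finset V) (R : ℕ) (hs : ∀ c ∈ s, ‖c‖ ≤ R)
    (h : ∀ c ∈ s, ∀ d ∈ s, c ≠ d → 1 ≤ ‖c - d‖) :
    s.card ≤ (2 * R + 1) ^ Module.finrank ℝ V := by
  borelize V
  let μ : Measure V := Measure.addHaar
  set δ : ℝ := (1 : ℝ) / 2 with hδ
  set ρ : ℝ := R + (1 : ℝ) / 2 with hρ
  have ρpos : 0 < ρ := by positivity
  have δpos : 0 < δ := by positivity
  set A := ⋃ c ∈ s, ball (c : V) δ with hA
  have hD : (s : Set V).Pairwise (fun c d => Disjoint (ball (c : V) δ) (ball d δ)) := by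
    rintro c hc d hd hcd
    apply ball_disjoint_ball
    rw [dist_eq_norm]
    have := h c hc d hd hcd
    rw [hδ]
    linarith
  have A_subset : A ⊆ ball (0 : V) ρ := by
    refine iUnion₂_subset fun x hx => ?_
    apply ball_subset_ball'
    rw [dist_zero_right]
    have := hs x hx
    rw [hδ, hρ]
    linarith
  have I : (s.card : ENNReal) * ENNReal.ofReal (δ ^ Module.finrank ℝ V) * μ (ball 0 1) ≤
      ENNReal.ofReal (ρ ^ Module.finrank ℝ V) * μ (ball 0 1) :=
    calc
      (s.card : ENNReal) * ENNReal.ofReal (δ ^ Module.finrank ℝ V) * μ (ball 0 1) = μ A := by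
        rw [hA, measure_biUnion_finset hD fun c _ => measurableSet_ball]
        simp only [μ.addHaar_ball_of_pos _ δpos]
        simp only [Finset.sum_const, nsmul_eq_mul, mul_assoc]
      _ ≤ μ (ball (0 : V) ρ) := measure_mono A_subset
      _ = ENNReal.ofReal (ρ ^ Module.finrank ℝ V) * μ (ball 0 1) := by
        simp only [μ.addHaar_ball_of_pos _ ρpos]
  have J : (s.card : ENNReal) * ENNReal.ofReal (δ ^ Module.finrank ℝ V) ≤
      ENNReal.ofReal (ρ ^ Module.finrank ℝ V) :=
    (ENNReal.mul_le_mul_iff_left (measure_ball_pos _ _ zero_lt_one).ne' measure_ball_lt_top.ne).1 I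
  have K : (s.card : ℝ) ≤ ((2 * R + 1 : ℕ) : ℝ) ^ Module.finrank ℝ V := by
    have h1 := ENNReal.toReal_le_of_le_ofReal (pow_nonneg ρpos.le _) J
    rw [ENNReal.toReal_mul, ENNReal.toReal_natCast, ENNReal.toReal_ofReal (by positivity)] at h1
    have h2 : ρ ^ Module.finrank ℝ V = ((2 * R + 1 : ℕ) : ℝ) ^ Module.finrank ℝ V *
        δ ^ Module.finrank ℝ V := by
      rw [← mul_pow]
      congr 1
      rw [hρ, hδ]
      push_cast
      ring
    rw [h2] at h1
    exact le_of_mul_le_mul_right h1 (by positivity)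
  exact_mod_cast K

section Orbits

variable {E : Type*} [NormedAddCommGroup E] [NormedSpace ℝ E]

/-- Closeness of all corresponding translates of two points. -/
def TransNear (g : Equiv.Perm E) (r : ℝ) (x y : E) : Prop :=
  ∀ j : ℤ, dist ((g ^ j) x) ((g ^ j) y) < r

/-- Closeness of two orbits. -/
def OrbitNear (g : Equiv.Perm E) (r : ℝ) (x y : E) : Prop :=
  ∃ k : ℤ, TransNear g r x ((g ^ k) y)

variable {g : Equiv.Perm E} {r s : ℝ} {x y z : E}

lemma zpow_zpow_apply (g : Equiv.Perm E) (j k : ℤ) (x : E) :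
    (g ^ j) ((g ^ k) x) = (g ^ (j + k)) x := by
  rw [zpow_add, Equiv.Perm.mul_apply]

lemma TransNear.zpow (h : TransNear g r x y) (k : ℤ) :
    TransNear g r ((g ^ k) x) ((g ^ k) y) := by
  intro j
  rw [zpow_zpow_apply, zpow_zpow_apply]
  exact h _

lemma TransNear.symm (h : TransNear g r x y) : TransNear g r y x := fun j => by
  rw [dist_comm]; exact h j

lemma TransNear.trans (h : TransNear g r x y) (h' : TransNear g s y z) :
    TransNear g (r + s) x z := fun j =>
  (dist_triangle _ _ _).trans_lt (add_lt_add (h j) (h' j))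

lemma TransNear.mono (h : TransNear g r x y) (hrs : r ≤ s) : TransNear g s x y :=
  fun j => (h j).trans_le hrs

lemma TransNear.refl (hr : 0 < r) : TransNear g r x x := fun j => by rwa [dist_self]

lemma TransNear.dist_lt (h : TransNear g r x y) : dist x y < r := by simpa using h 0

lemma OrbitNear.symm (h : OrbitNear g r x y) : OrbitNear g r y x := by
  obtain ⟨k, hk⟩ := h
  refine ⟨-k, ?_⟩
  have := (hk.zpow (-k)).symm
  rw [zpow_zpow_apply] at this
  simpa using this

lemma OrbitNear.trans (h : OrbitNear g r x y) (h' : OrbitNear g s y z) :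
    OrbitNear g (r + s) x z := by
  obtain ⟨k, hk⟩ := h
  obtain ⟨l, hl⟩ := h'
  refine ⟨k + l, hk.trans ?_⟩
  rw [← zpow_zpow_apply]
  exact hl.zpow k

lemma OrbitNear.mono (h : OrbitNear g r x y) (hrs : r ≤ s) : OrbitNear g s x y :=
  let ⟨k, hk⟩ := h; ⟨k, hk.mono hrs⟩

lemma TransNear.orbitNear (h : TransNear g r x y) : OrbitNear g r x y := ⟨0, by simpa using h⟩

lemma exists_zpow_eq_pow {p : ℕ} (hp : 0 < p) (hg : g ^ p = 1) (j : ℤ) :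
    ∃ i < p, g ^ j = g ^ i := by
  have hp' : (0 : ℤ) < p := by exact_mod_cast hp
  refine ⟨(j % p).toNat, ?_, ?_⟩
  · have := Int.emod_lt_of_pos j hp'
    have := Int.emod_nonneg j hp'.ne'
    omega
  · have h1 : ((j % p).toNat : ℤ) = j % p := Int.toNat_of_nonneg (Int.emod_nonneg j hp'.ne')
    rw [← zpow_natCast, h1]
    conv_lhs => rw [← Int.emod_add_mul_ediv j p, zpow_add, zpow_mul, zpow_natCast, hg, one_zpow,
      mul_one]

/-- The number of pairwise separated points in a bounded multiple of the separation scale is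
bounded in terms of the dimension only. -/
lemma card_le_of_transNear [FiniteDimensional ℝ E] {p : ℕ} (hp : 0 < p) (hg : g ^ p = 1)
    {D L : Set E} (hLc : IsCompact L) (hLD : L ⊆ D)
    (hdiff : ∀ j : ℕ, ∀ z ∈ D, ∃ A : E →L[ℝ] E, HasStrictFDerivAt (g ^ j : Equiv.Perm E) A z) :
    ∃ r₀ > 0, ∀ r, 0 < r → r ≤ r₀ → ∀ z₀ ∈ L, ∀ S : Finset E,
      (∀ w ∈ S, TransNear g (6 * r) z₀ w) →
      (∀ w ∈ S, ∀ w' ∈ S, w ≠ w' → ¬ TransNear g r w w') →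
      S.card ≤ 37 ^ Module.finrank ℝ E := by
  set Φ : E → (Fin p → E) := fun x i => (g ^ (i : ℕ)) x with hΦ
  have hloc : ∀ z : L, ∃ A : E →L[ℝ] (Fin p → E), ∃ U ∈ 𝓝 (z : E),
      ApproximatesLinearOn Φ A U (1 / 2) := by
    intro z
    choose A hA using fun i : Fin p => hdiff i z (hLD z.2)
    have : HasStrictFDerivAt Φ (ContinuousLinearMap.pi A) (z : E) := hasStrictFDerivAt_pi.2 hA
    obtain ⟨U, hU, h⟩ := this.approximates_deriv_on_nhds (c := 1 / 2)
      (Or.inr (by positivity))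
    exact ⟨_, U, hU, h⟩
  choose A U hU hA using hloc
  obtain ⟨δ, hδ, hcov⟩ := lebesgue_number_lemma_of_metric (c := fun z : L => interior (U z)) hLc
    (fun z => isOpen_interior) (fun z hz => mem_iUnion.2 ⟨⟨z, hz⟩, mem_interior_iff_mem_nhds.2 (hU ⟨z, hz⟩)⟩)
  refine ⟨δ / 6, by positivity, ?_⟩
  intro r hr hr₀ z₀ hz₀ S hS hsep
  obtain ⟨z, hz⟩ := hcov z₀ hz₀
  have hmem : ∀ w ∈ S, w ∈ U z := fun w hw => interior_subset (hz (by
    rw [mem_ball, dist_comm]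
    exact (hS w hw).dist_lt.trans_le (by linarith)))
  have hz₀U : z₀ ∈ U z := interior_subset (hz (mem_ball_self hδ))
  have hdist : ∀ x y : E, ‖x - y‖ ≤ ‖Φ x - Φ y‖ := by
    intro x y
    have := norm_le_pi_norm (Φ x - Φ y) ⟨0, hp⟩
    simpa [hΦ] using this
  have happ : ∀ x ∈ U z, ∀ y ∈ U z, ‖Φ x - Φ y - A z (x - y)‖ ≤ 1 / 2 * ‖Φ x - Φ y‖ := by
    intro x hx y hy
    have := hA z x hx y hy
    refine this.trans ?_
    have := hdist x y
    push_cast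
    linarith
  have hlow : ∀ w ∈ S, ∀ w' ∈ S, w ≠ w' → r / 2 ≤ ‖A z (w - w')‖ := by
    intro w hw w' hw' hne
    have h1 : r ≤ ‖Φ w - Φ w'‖ := by
      have := hsep w hw w' hw' hne
      simp only [TransNear, not_forall, not_lt] at this
      obtain ⟨j, hj⟩ := this
      obtain ⟨i, hi, hji⟩ := exists_zpow_eq_pow hp hg j
      rw [hji, dist_eq_norm] at hj
      exact hj.trans (norm_le_pi_norm (Φ w - Φ w') ⟨i, hi⟩)
    have h2 := happ w (hmem w hw) w' (hmem w' hw')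
    have h3 := norm_sub_norm_le (Φ w - Φ w') (A z (w - w'))
    linarith
  have hup : ∀ w ∈ S, ‖A z (w - z₀)‖ ≤ 9 * r := by
    intro w hw
    have h1 : ‖Φ w - Φ z₀‖ ≤ 6 * r := by
      refine (pi_norm_le_iff_of_nonneg (by positivity)).2 fun i => ?_
      have := (hS w hw).symm (i : ℕ)
      rw [dist_eq_norm, zpow_natCast] at this
      exact this.le
    have h2 := happ w (hmem w hw) z₀ hz₀U
    have h3 := norm_sub_norm_le (A z (w - z₀)) (Φ w - Φ z₀)
    rw [norm_sub_rev (A z (w - z₀)) (Φ w - Φ z₀)] at h3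
    linarith
  set V := LinearMap.range (A z : E →ₗ[ℝ] (Fin p → E)) with hV
  set R : E →ₗ[ℝ] V := (A z : E →ₗ[ℝ] (Fin p → E)).rangeRestrict
  have hRn : ∀ v, ‖R v‖ = ‖A z v‖ := fun v => rfl
  set q : E → V := fun w => (2 / r) • R (w - z₀) with hq
  have hqn : ∀ w, ‖q w‖ = 2 / r * ‖A z (w - z₀)‖ := by
    intro w
    rw [← hRn, ← Real.norm_of_nonneg (show 0 ≤ 2 / r by positivity)]
    exact (norm_smul _ _).trans (by rw [Real.norm_of_nonneg (show 0 ≤ 2 / r by positivity)])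
  have hqsub : ∀ w w', ‖q w - q w'‖ = 2 / r * ‖A z (w - w')‖ := by
    intro w w'
    have : q w - q w' = (2 / r) • R (w - w') := by
      simp only [hq, map_sub]
      module
    rw [this, norm_smul, Real.norm_of_nonneg (by positivity), hRn]
  have hsepq : ∀ w ∈ S, ∀ w' ∈ S, w ≠ w' → 1 ≤ ‖q w - q w'‖ := by
    intro w hw w' hw' hne
    rw [hqsub]
    have := hlow w hw w' hw' hne
    calc (1 : ℝ) = 2 / r * (r / 2) := by field_simp
      _ ≤ _ := by gcongr
  have hinj : Set.InjOn q S := by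
    intro w hw w' hw' he
    by_contra hne
    have := hsepq w hw w' hw' hne
    rw [he, sub_self, norm_zero] at this
    linarith
  classical
  have := card_le_of_separated_ball (S.image q) 18 ?_ ?_
  · rw [Finset.card_image_of_injOn hinj] at this
    refine this.trans (Nat.pow_le_pow_right (by norm_num) ?_)
    exact LinearMap.finrank_range_le _
  · intro c hc
    obtain ⟨w, hw, rfl⟩ := Finset.mem_image.1 hc
    rw [hqn]
    have := hup w hw
    calc 2 / r * ‖A z (w - z₀)‖ ≤ 2 / r * (9 * r) := by gcongr
      _ = ((18 : ℕ) : ℝ) := by field_simp; norm_num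
  · intro c hc d hd hcd
    obtain ⟨w, hw, rfl⟩ := Finset.mem_image.1 hc
    obtain ⟨w', hw', rfl⟩ := Finset.mem_image.1 hd
    exact hsepq w hw w' hw' (fun h => hcd (by rw [h]))

/-- Greedy colouring of a finite symmetric relation of bounded degree. -/
lemma exists_greedy_colouring {α : Type*} (R : α → α → Prop) (hR : ∀ a b, R a b → R b a) {N : ℕ}
    (Z : Finset α) (hdeg : ∀ z ∈ Z, ∀ S ⊆ Z, (∀ w ∈ S, R z w) → S.card ≤ N) :
    ∃ c : α → ℕ, (∀ z, c z < N + 1) ∧ ∀ z ∈ Z, ∀ w ∈ Z, R z w → c z = c w → z = w := by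
  classical
  induction Z using Finset.induction_on with
  | empty => exact ⟨fun _ => 0, by simp, by simp⟩
  | insert z Z hz ih =>
    obtain ⟨c, hc, hcol⟩ := ih fun w hw S hS h =>
      hdeg w (Finset.mem_insert_of_mem hw) S (hS.trans (Finset.subset_insert _ _)) h
    obtain ⟨k, hk, hkn⟩ : ∃ k ∈ Finset.range (N + 1), k ∉ (Z.filter (R z)).image c := by
      refine Finset.exists_mem_notMem_of_card_lt_card ?_
      rw [Finset.card_range]
      refine Nat.lt_succ_of_le (Finset.card_image_le.trans ?_)
      exact hdeg z (Finset.mem_insert_self _ _) _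
        ((Finset.filter_subset _ _).trans (Finset.subset_insert _ _))
        fun w hw => (Finset.mem_filter.1 hw).2
    have hk' : ∀ w ∈ Z, R z w → c w ≠ k := fun w hw hzw he =>
      hkn (Finset.mem_image.2 ⟨w, Finset.mem_filter.2 ⟨hw, hzw⟩, he⟩)
    refine ⟨Function.update c z k, fun w => ?_, fun w hw w' hw' hww' he => ?_⟩
    · by_cases h : w = z
      · subst h; simpa using hk
      · simpa [h] using hc w
    · by_cases h : w = z <;> by_cases h' : w' = z
      · rw [h, h']
      · have hw'' : w' ∈ Z := (Finset.mem_insert.1 hw').resolve_left h'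
        subst h
        rw [Function.update_self, Function.update_of_ne h'] at he
        exact absurd he.symm (hk' w' hw'' hww')
      · have hw'' : w ∈ Z := (Finset.mem_insert.1 hw).resolve_left h
        subst h'
        rw [Function.update_self, Function.update_of_ne h] at he
        exact absurd he (hk' w hw'' (hR _ _ hww'))
      · rw [Function.update_of_ne h, Function.update_of_ne h'] at he
        exact hcol w ((Finset.mem_insert.1 hw).resolve_left h) w'
          ((Finset.mem_insert.1 hw').resolve_left h') hww' he

lemma transNear_of_lt {p : ℕ} (hp : 0 < p) (hg : g ^ p = 1)
    (h : ∀ i < p, dist ((g ^ i) x) ((g ^ i) y) < r) : TransNear g r x y := by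
  intro j
  obtain ⟨i, hi, hj⟩ := exists_zpow_eq_pow hp hg j
  rw [hj]
  exact h i hi

lemma orbitNear_zpow_left (k : ℤ) : OrbitNear g r ((g ^ k) x) y ↔ OrbitNear g r x y := by
  constructor
  · rintro ⟨l, hl⟩
    refine ⟨-k + l, ?_⟩
    have := hl.zpow (-k)
    rw [zpow_zpow_apply, zpow_zpow_apply] at this
    simpa using this
  · rintro ⟨l, hl⟩
    refine ⟨k + l, ?_⟩
    have := hl.zpow k
    rwa [zpow_zpow_apply] at this

/-- Powers of a permutation of prime order with a fixed point of a nontrivial power. -/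
lemma apply_eq_of_zpow_apply_eq {p : ℕ} (hp : p.Prime) (hg : g ^ p = 1) {k : ℤ}
    (hk : ¬ (p : ℤ) ∣ k) (h : (g ^ k) x = x) : g x = x := by
  have hco : IsCoprime (p : ℤ) k := (Nat.prime_iff_prime_int.1 hp).coprime_iff_not_dvd.2 hk
  obtain ⟨a, b, hab⟩ := hco
  have h1 : ∀ n : ℤ, ((g ^ k) ^ n) x = x := fun n =>
    Equiv.Perm.zpow_apply_eq_self_of_apply_eq_self h n
  have h2 : g = (g ^ k) ^ b := by
    conv_lhs => rw [← zpow_one g, ← hab, zpow_add, mul_comm a, zpow_mul, zpow_natCast, hg, one_zpow,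
      one_mul, mul_comm b, zpow_mul]
  rw [h2]
  exact h1 b

lemma exists_free_scale {p : ℕ} (hp : p.Prime) (hg : g ^ p = 1) {L : Set E} (hLc : IsCompact L)
    (hcont : ∀ j : ℕ, ContinuousOn (g ^ j : Equiv.Perm E) L) (hfree : ∀ x ∈ L, g x ≠ x) :
    ∃ ρ > 0, ∀ x ∈ L, ∀ k : ℤ, TransNear g ρ x ((g ^ k) x) → (p : ℤ) ∣ k := by
  have h1 : ∀ i ∈ Finset.Ico 1 p, ∀ᶠ ρ in 𝓝[>] (0 : ℝ), ∀ x ∈ L, ρ ≤ dist x ((g ^ i) x) := by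
    intro i hi
    rw [Finset.mem_Ico] at hi
    obtain ⟨ρ, hρ, h⟩ := hLc.exists_forall_le' (f := fun x => dist x ((g ^ i) x)) (a := 0)
      (by have := hcont i; fun_prop) (fun x hx => dist_pos.2 fun he => hfree x hx
        (apply_eq_of_zpow_apply_eq hp hg (k := i) (fun hd => by
          have := Nat.le_of_dvd (by omega) (Int.natCast_dvd_natCast.1 hd)
          omega) (by rw [zpow_natCast]; exact he.symm)))
    filter_upwards [Ioo_mem_nhdsGT hρ] with ρ' hρ' x hx
    exact hρ'.2.le.trans (h x hx)
  obtain ⟨ρ, hρ, hρ0⟩ := (((Filter.eventually_all_finset _).2 h1).and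
    self_mem_nhdsWithin).exists
  refine ⟨ρ, hρ0, fun x hx k hk => ?_⟩
  by_contra hd
  have hp' : (0 : ℤ) < p := by exact_mod_cast hp.pos
  have h0 : k % p ≠ 0 := fun h => hd (Int.dvd_of_emod_eq_zero h)
  have h2 := Int.emod_nonneg k hp'.ne'
  have h3 := Int.emod_lt_of_pos k hp'
  have h4 := hρ (k % p).toNat (Finset.mem_Ico.2 ⟨by omega, by omega⟩) x hx
  have h5 : g ^ (k % p).toNat = g ^ k := by
    rw [← zpow_natCast, Int.toNat_of_nonneg h2]
    conv_rhs => rw [← Int.emod_add_mul_ediv k p, zpow_add, zpow_mul, zpow_natCast, hg, one_zpow,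
      mul_one]
  rw [h5] at h4
  exact absurd hk.dist_lt (not_lt.2 h4)

/-- A finite net of orbits whose members have disjoint orbit neighbourhoods. -/
lemma exists_orbit_net {p : ℕ} (hp : 0 < p) (hg : g ^ p = 1) {L : Set E} (hLc : IsCompact L)
    (hcont : ∀ j : ℕ, ∀ x ∈ L, ContinuousAt (g ^ j : Equiv.Perm E) x) (hr : 0 < r) :
    ∃ Z : Finset E, (∀ z ∈ Z, z ∈ L) ∧ (∀ x ∈ L, ∃ z ∈ Z, OrbitNear g (2 * r) x z) ∧
      ∀ z ∈ Z, ∀ w ∈ Z, z ≠ w → ¬ OrbitNear g r z w := by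
  classical
  obtain ⟨T, hTL, hT⟩ := hLc.elim_nhds_subcover (fun x => {x' | TransNear g r x' x}) (by
    intro x hx
    have : ∀ i ∈ Finset.range p, ∀ᶠ x' in 𝓝 x, dist ((g ^ i) x') ((g ^ i) x) < r := fun i _ =>
      Metric.tendsto_nhds.1 (hcont i x hx) r hr
    filter_upwards [(Filter.eventually_all_finset _).2 this] with x' hx'
    exact transNear_of_lt hp hg fun i hi => hx' i (Finset.mem_range.2 hi))
  obtain ⟨Z, hZ⟩ := (T.powerset.filter fun Z : Finset E =>
    ∀ z ∈ Z, ∀ w ∈ Z, z ≠ w → ¬ OrbitNear g r z w).exists_maximal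
    ⟨∅, by simp⟩
  have hZm := Finset.mem_filter.1 hZ.prop
  have hZT := Finset.mem_powerset.1 hZm.1
  refine ⟨Z, fun z hz => hTL z (hZT hz), fun x hx => ?_, hZm.2⟩
  obtain ⟨t, ht, hxt⟩ := mem_iUnion₂.1 (hT hx)
  have hxt' : TransNear g r x t := hxt
  suffices ∃ z ∈ Z, OrbitNear g r t z by
    obtain ⟨z, hz, h⟩ := this
    exact ⟨z, hz, by rw [two_mul]; exact hxt'.orbitNear.trans h⟩
  by_contra! hcon
  have htZ : t ∉ Z := fun h => hcon t h (TransNear.refl hr).orbitNear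
  have hins : insert t Z ∈ T.powerset.filter fun Z : Finset E =>
      ∀ z ∈ Z, ∀ w ∈ Z, z ≠ w → ¬ OrbitNear g r z w := by
    refine Finset.mem_filter.2 ⟨Finset.mem_powerset.2 (Finset.insert_subset ht hZT), ?_⟩
    intro z hz w hw hne
    rcases Finset.mem_insert.1 hz with rfl | hzZ <;> rcases Finset.mem_insert.1 hw with rfl | hwZ
    · exact absurd rfl hne
    · exact hcon w hwZ
    · exact fun h => hcon z hzZ h.symm
    · exact hZm.2 z hzZ w hwZ hne
  exact htZ (hZ.le_of_ge hins (Finset.subset_insert _ _) (Finset.mem_insert_self _ _))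

/-- Invariant colouring with labels of the part of a compact set that is far from the fixed
points, together with an invariant retraction of the rest onto the fixed points; the number of
colours depends only on the dimension. -/
theorem exists_colouring [FiniteDimensional ℝ E] {p : ℕ} (hp : p.Prime) (hg : g ^ p = 1)
    {D L : Set E} (hLc : IsCompact L) (hLD : L ⊆ D) (hgL : ∀ x, g x ∈ L ↔ x ∈ L)
    (hdiff : ∀ j : ℕ, ∀ z ∈ D, ∃ A : E →L[ℝ] E, HasStrictFDerivAt (g ^ j : Equiv.Perm E) A z)
    {ε : ℝ} (hε : 0 < ε) {C : ℕ} (hC : C = 37 ^ Module.finrank ℝ E + 1) :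
    ∃ (col lab : E → ℕ) (ι : E → E), ∃ η > 0, (∀ x, col (g x) = col x) ∧
      (∀ x, col x < C → lab x < p) ∧
      (∀ x, col x < C → lab (g x) = if lab x + 1 = p then 0 else lab x + 1) ∧
      (∀ x y, TransNear g η x y → col x < C → col x = col y → lab x = lab y) ∧
      (∀ x ∈ L, C ≤ col x → g (ι x) = ι x ∧ ι x ∈ L ∧ dist x (ι x) < ε) ∧
      (∀ x, ι (g x) = ι x) ∧ ∀ x, g x = x → ι x = x ∧ C ≤ col x := by
  classical
  have hp' : (0 : ℤ) < p := by exact_mod_cast hp.pos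
  have hcontD : ∀ j : ℕ, ∀ x ∈ D, ContinuousAt (g ^ j : Equiv.Perm E) x := fun j x hx => by
    obtain ⟨A, hA⟩ := hdiff j x hx
    exact hA.hasFDerivAt.continuousAt
  set Q : E → E → Prop := fun x y => g y = y ∧ y ∈ L ∧ ∀ j : ℤ, dist ((g ^ j) x) y < ε with hQ
  have hgz : ∀ (j : ℤ) x, (g ^ j) (g x) = (g ^ (j + 1)) x := fun j x => by
    rw [zpow_add, zpow_one, Equiv.Perm.mul_apply]
  have hQg : ∀ x, Q (g x) = Q x := by
    intro x
    funext y
    simp only [hQ, eq_iff_iff]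
    refine and_congr_right fun _ => and_congr_right fun _ => ⟨fun h j => ?_, fun h j => ?_⟩
    · have := h (j - 1)
      rwa [hgz, sub_add_cancel] at this
    · rw [hgz]; exact h _
  set V : Set E := {x | ∃ y, Q x y} with hV
  have hVg : ∀ x, g x ∈ V ↔ x ∈ V := fun x => by
    simp only [hV, mem_ofPred_eq, hQg]
  have hfixV : ∀ x ∈ L, g x = x → x ∈ V := fun x hx hgx => ⟨x, hgx, hx, fun j => by
    rw [Equiv.Perm.zpow_apply_eq_self_of_apply_eq_self hgx, dist_self]; exact hε⟩
  have hVint : ∀ x ∈ L, x ∈ V → x ∈ interior V := by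
    rintro x hx ⟨y, hy, hyL, h⟩
    rw [mem_interior_iff_mem_nhds]
    have : ∀ i ∈ Finset.range p, ∀ᶠ x' in 𝓝 x, dist ((g ^ i) x') y < ε := fun i _ => by
      refine ((hcontD i x (hLD hx)).dist continuousAt_const).eventually (gt_mem_nhds ?_)
      simpa using h i
    filter_upwards [(Filter.eventually_all_finset _).2 this] with x' hx'
    refine ⟨y, hy, hyL, fun j => ?_⟩
    obtain ⟨i, hi, hj⟩ := exists_zpow_eq_pow hp.pos hg j
    rw [hj]
    exact hx' i (Finset.mem_range.2 hi)
  set L₁ : Set E := L \ interior V with hL₁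
  have hL₁c : IsCompact L₁ := hLc.diff isOpen_interior
  have hL₁L : L₁ ⊆ L := sdiff_subset
  obtain ⟨ρ, hρ, hfree⟩ := exists_free_scale hp hg hL₁c
    (fun j x hx => (hcontD j x (hLD (hL₁L hx))).continuousWithinAt)
    (fun x hx hgx => hx.2 (hVint x hx.1 (hfixV x hx.1 hgx)))
  obtain ⟨r₀, hr₀, hpack⟩ := card_le_of_transNear hp.pos hg hLc hLD hdiff
  set r : ℝ := min r₀ (ρ / 6) with hr
  have hrpos : 0 < r := lt_min hr₀ (by positivity)
  have hrρ : 6 * r ≤ ρ := by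
    have : r ≤ ρ / 6 := min_le_right _ _
    linarith
  obtain ⟨Z, hZL, hZcov, hZsep⟩ := exists_orbit_net hp.pos hg hL₁c
    (fun j x hx => hcontD j x (hLD (hL₁L hx))) hrpos
  obtain ⟨c, hcC, hcol⟩ := exists_greedy_colouring (OrbitNear g (6 * r)) (fun a b h => h.symm)
    (N := 37 ^ Module.finrank ℝ E) Z (by
      intro z hz S hS hzS
      choose! k hk using hzS
      have hsep : ∀ w ∈ S, ∀ w' ∈ S, w ≠ w' →
          ¬ TransNear g r ((g ^ k w) w) ((g ^ k w') w') := fun w hw w' hw' hne h =>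
        hZsep w (hS hw) w' (hS hw') hne
          ((orbitNear_zpow_left (k w)).1 ⟨k w', h⟩)
      rw [← Finset.card_image_of_injOn (f := fun w => (g ^ k w) w) (s := S) (by
        intro w hw w' hw' he
        by_contra hne
        refine hsep w hw w' hw' hne ?_
        have he' : (g ^ k w) w = (g ^ k w') w' := he
        rw [he']
        exact TransNear.refl hrpos)]
      refine hpack r hrpos (min_le_left _ _) z (hL₁L (hZL z hz)) _ ?_ ?_
      · intro w hw
        obtain ⟨v, hv, rfl⟩ := Finset.mem_image.1 hw
        exact hk v hv
      · intro w hw w' hw' hne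
        obtain ⟨v, hv, rfl⟩ := Finset.mem_image.1 hw
        obtain ⟨v', hv', rfl⟩ := Finset.mem_image.1 hw'
        exact hsep v hv v' hv' fun h => hne (by rw [h]))
  set zf : E → E := fun x => Classical.epsilon fun w => w ∈ Z ∧ OrbitNear g (2 * r) x w with hzf
  have hzg : ∀ x, zf (g x) = zf x := by
    intro x
    have : (fun w => w ∈ Z ∧ OrbitNear g (2 * r) (g x) w) =
        fun w => w ∈ Z ∧ OrbitNear g (2 * r) x w := by
      funext w
      have := orbitNear_zpow_left (g := g) (r := 2 * r) (x := x) (y := w) 1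
      rw [zpow_one] at this
      rw [this]
    simp only [hzf, this]
  have hzs : ∀ x ∈ L₁, zf x ∈ Z ∧ OrbitNear g (2 * r) x (zf x) := by
    intro x hx
    obtain ⟨z, hz, h⟩ := hZcov x hx
    exact Classical.epsilon_spec (p := fun w => w ∈ Z ∧ OrbitNear g (2 * r) x w) ⟨z, hz, h⟩
  have huniq : ∀ z ∈ Z, ∀ i < p, ∀ j < p, TransNear g (6 * r) ((g ^ i) z) ((g ^ j) z) → i = j := by
    intro z hz i hi j hj h
    have h1 := h.zpow (-(i : ℤ))
    rw [← zpow_natCast, ← zpow_natCast, zpow_zpow_apply, zpow_zpow_apply, neg_add_cancel,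
      zpow_zero] at h1
    obtain ⟨m, hm⟩ := hfree z (hZL z hz) _ (h1.mono hrρ)
    have : m = 0 := by
      have h2 : (p : ℤ) * m < p * 1 := by rw [← hm]; omega
      have h3 : (p : ℤ) * (-1) < p * m := by rw [← hm]; omega
      have h4 := lt_of_mul_lt_mul_left h2 hp'.le
      have h5 := lt_of_mul_lt_mul_left h3 hp'.le
      omega
    rw [this, mul_zero] at hm
    omega
  set lab : E → ℕ := fun x => Classical.epsilon fun j => j < p ∧ TransNear g (2 * r) x ((g ^ j) (zf x))
    with hlab
  have hlabs : ∀ x ∈ L₁, lab x < p ∧ TransNear g (2 * r) x ((g ^ lab x) (zf x)) := by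
    intro x hx
    obtain ⟨k, hk⟩ := (hzs x hx).2
    obtain ⟨i, hi, hki⟩ := exists_zpow_eq_pow hp.pos hg k
    rw [hki] at hk
    exact Classical.epsilon_spec (p := fun j => j < p ∧ TransNear g (2 * r) x ((g ^ j) (zf x)))
      ⟨i, hi, hk⟩
  have hL₁g : ∀ x, g x ∈ L₁ ↔ x ∈ L₁ := by
    have : ∀ x, x ∈ L₁ ↔ x ∈ L ∧ x ∉ V := fun x => and_congr_right fun hx =>
      not_congr ⟨fun h => interior_subset h, hVint x hx⟩
    intro x
    rw [this, this, hgL, hVg]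
  have hcolC : ∀ x, (if x ∈ L₁ then c (zf x) else C) < C ↔ x ∈ L₁ := by
    intro x
    split_ifs with h
    · exact ⟨fun _ => h, fun _ => by rw [hC]; exact hcC _⟩
    · simp [h]
  refine ⟨fun x => if x ∈ L₁ then c (zf x) else C, lab,
    fun x => if g x = x then x else Classical.epsilon (Q x), r, hrpos, ?_, ?_, ?_, ?_, ?_, ?_, ?_⟩
  · intro x
    simp only [hL₁g, hzg]
  · intro x hx
    exact (hlabs x ((hcolC x).1 hx)).1
  · intro x hx
    have hx' := (hcolC x).1 hx
    obtain ⟨h1, h2⟩ := hlabs x hx'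
    obtain ⟨h3, h4⟩ := hlabs (g x) ((hL₁g x).2 hx')
    rw [hzg] at h4
    have h5 := h2.zpow 1
    rw [zpow_one, ← Equiv.Perm.mul_apply, ← pow_succ'] at h5
    have hz := (hzs x hx').1
    have key : ∀ j < p, (g ^ (lab x + 1)) (zf x) = (g ^ j) (zf x) → lab (g x) = j := by
      intro j hj he
      rw [he] at h5
      exact huniq _ hz _ h3 _ hj ((h4.symm.trans h5).mono (by linarith))
    split_ifs with h
    · refine key 0 hp.pos ?_
      rw [h, hg, pow_zero]
    · exact key _ (by omega) rfl
  · intro x y hxy hx hcxy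
    have hx' := (hcolC x).1 hx
    have hy' := (hcolC y).1 (by
      have hcxy' : (if x ∈ L₁ then c (zf x) else C) = if y ∈ L₁ then c (zf y) else C := hcxy
      rw [← hcxy']; exact hx)
    simp only [hx', hy', if_true] at hcxy
    obtain ⟨h1, h2⟩ := hlabs x hx'
    obtain ⟨h3, h4⟩ := hlabs y hy'
    have h5 : TransNear g (6 * r) ((g ^ lab x) (zf x)) ((g ^ lab y) (zf y)) :=
      ((h2.symm.trans hxy).trans h4).mono (by linarith)
    have hzz : zf x = zf y := by
      refine hcol _ (hzs x hx').1 _ (hzs y hy').1 ?_ hcxy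
      rw [← orbitNear_zpow_left (lab x : ℤ)]
      exact ⟨lab y, by rw [zpow_natCast, zpow_natCast]; exact h5⟩
    rw [← hzz] at h5
    exact huniq _ (hzs x hx').1 _ h1 _ h3 h5
  · intro x hx hcx
    have hx1 : x ∉ L₁ := fun h => absurd ((hcolC x).2 h) (not_lt.2 hcx)
    have hxV : x ∈ V := by
      by_contra h
      exact hx1 ⟨hx, fun h' => h (interior_subset h')⟩
    by_cases hgx : g x = x
    · simp only [if_pos hgx, dist_self]
      exact ⟨hgx, hx, hε⟩
    · simp only [if_neg hgx]
      obtain ⟨h1, h2, h3⟩ := Classical.epsilon_spec hxV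
      exact ⟨h1, h2, by simpa using h3 0⟩
  · intro x
    have : g (g x) = g x ↔ g x = x := g.injective.eq_iff
    by_cases hgx : g x = x
    · simp only [hgx]
    · simp only [this, hgx, if_false, hQg]
  · intro x hgx
    refine ⟨by simp only [hgx, if_true], not_lt.1 fun h => ?_⟩
    have hx' := (hcolC x).1 h
    exact hx'.2 (hVint x hx'.1 (hfixV x hx'.1 hgx))

end Orbits

end

section

/-! ### Bounding cycles of fixed points -/

section Bounding

open ListChain

variable {E : Type*} [NormedAddCommGroup E] [NormedSpace ℝ E]

lemma exists_transNear_of_dist {p : ℕ} {g : Equiv.Perm E} (hp : 0 < p) (hg : g ^ p = 1)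
    {L : Set E} (hLc : IsCompact L) (hcont : ∀ j : ℕ, ContinuousOn (g ^ j : Equiv.Perm E) L)
    {ε : ℝ} (hε : 0 < ε) :
    ∃ δ > 0, ∀ x ∈ L, ∀ y ∈ L, dist x y ≤ δ → TransNear g ε x y := by
  have h1 : ∀ i ∈ Finset.range p, ∀ᶠ δ in 𝓝[>] (0 : ℝ), ∀ x ∈ L, ∀ y ∈ L, dist x y ≤ δ →
      dist ((g ^ i) x) ((g ^ i) y) < ε := by
    intro i _
    obtain ⟨δ, hδ, h⟩ := Metric.uniformContinuousOn_iff.1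
      (hLc.uniformContinuousOn_of_continuous (hcont i)) ε hε
    filter_upwards [Ioo_mem_nhdsGT hδ] with δ' hδ' x hx y hy hxy
    exact h x hx y hy (hxy.trans_lt hδ'.2)
  obtain ⟨δ, hδ, hδ0⟩ := (((Filter.eventually_all_finset _).2 h1).and
    self_mem_nhdsWithin).exists
  exact ⟨δ, hδ0, fun x hx y hy hxy => transNear_of_lt hp hg fun i hi =>
    hδ i (Finset.mem_range.2 hi) x hx y hy hxy⟩

lemma exists_invariant_compact {p : ℕ} {g : Equiv.Perm E} (hp : 0 < p) (hg : g ^ p = 1)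
    {D L : Set E} (hgD : ∀ x, g x ∈ D ↔ x ∈ D) (hLc : IsCompact L) (hLD : L ⊆ D)
    (hcont : ∀ j : ℕ, ContinuousOn (g ^ j : Equiv.Perm E) D) :
    ∃ L' : Set E, IsCompact L' ∧ L' ⊆ D ∧ L ⊆ L' ∧ ∀ x, g x ∈ L' ↔ x ∈ L' := by
  have hpD : ∀ (j : ℕ), ∀ x ∈ D, (g ^ j) x ∈ D := by
    intro j
    induction j with
    | zero => exact fun x hx => by simpa using hx
    | succ j ih =>
      intro x hx
      rw [pow_succ', Equiv.Perm.mul_apply]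
      exact (hgD _).2 (ih x hx)
  have key : ∀ x, x ∈ (⋃ j ∈ Finset.range p, (g ^ j : Equiv.Perm E) '' L) ↔
      ∃ k : ℤ, ∃ y ∈ L, (g ^ k) y = x := by
    intro x
    simp only [mem_iUnion, Finset.mem_range, mem_image, exists_prop]
    constructor
    · rintro ⟨j, _, y, hy, h⟩
      exact ⟨j, y, hy, by simpa using h⟩
    · rintro ⟨k, y, hy, h⟩
      obtain ⟨i, hi, hk⟩ := exists_zpow_eq_pow hp hg k
      exact ⟨i, hi, y, hy, by rw [← hk, h]⟩
  refine ⟨⋃ j ∈ Finset.range p, (g ^ j : Equiv.Perm E) '' L,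
    (Finset.range p).isCompact_biUnion fun j _ => hLc.image_of_continuousOn ((hcont j).mono hLD),
    ?_, ?_, ?_⟩
  · refine iUnion₂_subset fun j _ => ?_
    rintro _ ⟨y, hy, rfl⟩
    exact hpD j y (hLD hy)
  · exact fun x hx => (key x).2 ⟨0, x, hx, rfl⟩
  · intro x
    rw [key, key]
    constructor
    · rintro ⟨k, y, hy, h⟩
      refine ⟨-1 + k, y, hy, ?_⟩
      rw [← zpow_zpow_apply, h]
      simp
    · rintro ⟨k, y, hy, rfl⟩
      exact ⟨1 + k, y, hy, by rw [← zpow_zpow_apply]; simp⟩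

/-- The next right-hand side in the construction of an equivariant resolution. -/
def zigzagTarget {F : Type*} [CommRing F] (p : ℕ) (g : Equiv.Perm E)
    (b : ℕ → ListChain F E →ₗ[F] ListChain F E) (i : ℕ) : ListChain F E →ₗ[F] ListChain F E :=
  altOp p g i ∘ₗ b i + if i = 0 then LinearMap.id else 0

lemma nearLists_mono {C C' : Set E} {d d' : ℝ} {n : ℕ} (h : C ⊆ C') (hd : d ≤ d') :
    nearLists C d n ⊆ nearLists C' d' n := fun _ hσ =>
  ⟨hσ.1, fun x hx => h (hσ.2.1 x hx), fun x hx y hy => (hσ.2.2 x hx y hy).trans hd⟩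

lemma push_eq_self_of_fixed {F : Type*} [CommRing F] {g : E → E} {L : Set E} {d : ℝ} {n : ℕ}
    {c : ListChain F E} (hc : c ∈ on F (nearLists (L ∩ {x | g x = x}) d n)) : push g c = c := by
  refine eq_of_simplex (F := F) (M := ListChain F E) (push g) LinearMap.id (fun σ hσ => ?_) hc
  rw [push_simplex, LinearMap.id_apply]
  congr 1
  conv_rhs => rw [← List.map_id σ]
  exact List.map_congr_left fun x hx => (hσ.2.1 x hx).2

lemma push_pow_eq_self {F : Type*} [CommRing F] {g : Equiv.Perm E} {c : ListChain F E}
    (h : push g c = c) (j : ℕ) : push (g ^ j : Equiv.Perm E) c = c := by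
  induction j with
  | zero => simpa using push_id c
  | succ j ih => rw [← push_pow_succ, ih, h]

lemma normOp_eq_zero {p : ℕ} {g : Equiv.Perm E} {c : ListChain (ZMod p) E}
    (h : push g c = c) : normOp p g c = 0 := by
  simp [normOp, push_pow_eq_self h, ← Nat.cast_smul_eq_nsmul (ZMod p)]

lemma altOp_mem_nearLists {F : Type*} [CommRing F] {p : ℕ} {g : Equiv.Perm E} {L : Set E} (hgL : ∀ x, g x ∈ L ↔ x ∈ L) {δ ε : ℝ}
    (hδ : ∀ x ∈ L, ∀ y ∈ L, dist x y ≤ δ → TransNear g ε x y) {n : ℕ} (i : ℕ)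
    {c : ListChain F E} (hc : c ∈ on F (nearLists L δ n)) :
    altOp p g i c ∈ on F (nearLists L ε n) := by
  set S : Set (List E) := {σ | σ.length = n ∧ (∀ x ∈ σ, x ∈ L) ∧
    ∀ x ∈ σ, ∀ y ∈ σ, TransNear g ε x y} with hS
  have hS1 : nearLists L δ n ⊆ S := fun σ hσ => ⟨hσ.1, hσ.2.1, fun x hx y hy =>
    hδ x (hσ.2.1 x hx) y (hσ.2.1 y hy) (hσ.2.2 x hx y hy)⟩
  have hS2 : S ⊆ nearLists L ε n := fun σ hσ =>
    ⟨hσ.1, hσ.2.1, fun x hx y hy => (hσ.2.2 x hx y hy).dist_lt.le⟩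
  refine on_mono hS2 (altOp_mem (fun σ hσ => ?_) i (on_mono hS1 hc))
  refine ⟨by simpa using hσ.1, fun x hx => ?_, fun x hx y hy => ?_⟩
  · obtain ⟨x', hx', rfl⟩ := List.mem_map.1 hx
    exact (hgL x').2 (hσ.2.1 x' hx')
  · obtain ⟨x', hx', rfl⟩ := List.mem_map.1 hx
    obtain ⟨y', hy', rfl⟩ := List.mem_map.1 hy
    simpa using (hσ.2.2 x' hx' y' hy').zpow 1

variable [ProperSpace E] {D K : Set E} {W : E → E}

lemma exists_zigzag {f : E → E} {ℓ : ℕ}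
    (hfill : ∀ (n : ℕ) (L : Set E), IsCompact L → L ⊆ D → ∃ L' : Set E, IsCompact L' ∧ L' ⊆ D ∧
      ∀ ε > 0, ∃ δ > 0, ∀ (F : Type) [CommRing F], ∃ T : ListChain F E →ₗ[F] ListChain F E,
        (∀ c ∈ on F (nearLists L δ n), T c ∈ on F (nearLists L' ε (n + 1))) ∧
        ∀ c ∈ on F (nearLists L δ n), bd c = 0 → push f c = 0 → bd (T c) = c)
    {p : ℕ} (hp : p.Prime) {g : Equiv.Perm E} (hg : g ^ p = 1)
    (hgD : ∀ x, g x ∈ D ↔ x ∈ D) (hcont : ∀ j : ℕ, ContinuousOn (g ^ j : Equiv.Perm E) D)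
    {L₀ : Set E} (hL₀ : IsCompact L₀) (hL₀D : L₀ ⊆ D) (k : ℕ) :
    ∃ L : Set E, IsCompact L ∧ L ⊆ D ∧ L₀ ⊆ L ∧ (∀ x, g x ∈ L ↔ x ∈ L) ∧
      ∀ ε > 0, ∃ δ > 0, δ ≤ ε ∧ ∃ b : ℕ → ListChain (ZMod p) E →ₗ[ZMod p] ListChain (ZMod p) E,
        b 0 = 0 ∧ (∀ i ≤ k, ∀ c ∈ on (ZMod p) (nearLists (L₀ ∩ {x | g x = x}) δ ℓ),
          b i c ∈ on (ZMod p) (nearLists L ε (ℓ + i))) ∧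
        (∀ i < k, ∀ c ∈ on (ZMod p) (nearLists (L₀ ∩ {x | g x = x}) δ ℓ),
          zigzagTarget p g b i c ∈ on (ZMod p) (nearLists L ε (ℓ + i))) ∧
        ∀ c ∈ on (ZMod p) (nearLists (L₀ ∩ {x | g x = x}) δ ℓ), bd c = 0 →
          (∀ i < k, push f (zigzagTarget p g b i c) = 0) →
          ∀ i < k, bd (b (i + 1) c) = zigzagTarget p g b i c := by
  induction k with
  | zero =>
    obtain ⟨L, hLc, hLD, hL₀L, hgL⟩ := exists_invariant_compact hp.pos hg hgD hL₀ hL₀D hcont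
    exact ⟨L, hLc, hLD, hL₀L, hgL, fun ε hε => ⟨ε, hε, le_rfl, fun _ => 0,
      rfl, fun i _ c _ => by simp, by simp, by simp⟩⟩
  | succ k ih =>
    obtain ⟨L, hLc, hLD, hL₀L, hgL, hb⟩ := ih
    obtain ⟨L', hL'c, hL'D, hT⟩ := hfill (ℓ + k) L hLc hLD
    obtain ⟨M, hMc, hMD, hLM, hgM⟩ := exists_invariant_compact hp.pos hg hgD (hLc.union hL'c)
      (union_subset hLD hL'D) hcont
    refine ⟨M, hMc, hMD, hL₀L.trans (subset_union_left.trans hLM), hgM, fun ε hε => ?_⟩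
    obtain ⟨δ₁, hδ₁, hT⟩ := hT ε hε
    obtain ⟨δ₂, hδ₂, hδ₂'⟩ := exists_transNear_of_dist hp.pos hg hLc (fun j => (hcont j).mono hLD)
      (lt_min hδ₁ hε)
    obtain ⟨T, hTmem, hTbd⟩ := hT (ZMod p)
    obtain ⟨δ, hδ, hδle, b, hb0, hb1, hb2, hb3⟩ := hb (min (min δ₁ ε) δ₂)
      (lt_min (lt_min hδ₁ hε) hδ₂)
    have hle : min (min δ₁ ε) δ₂ ≤ ε := (min_le_left _ _).trans (min_le_right _ _)
    have hle1 : min (min δ₁ ε) δ₂ ≤ δ₁ := (min_le_left _ _).trans (min_le_left _ _)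
    have hLM' : L ⊆ M := subset_union_left.trans hLM
    set b' := Function.update b (k + 1) (T ∘ₗ zigzagTarget p g b k) with hb'
    have hbb : ∀ i ≤ k, b' i = b i := fun i hi => by
      rw [hb', Function.update_of_ne (by omega)]
    have hzz : ∀ i ≤ k, zigzagTarget p g b' i = zigzagTarget p g b i := fun i hi => by
      simp only [zigzagTarget, hbb i hi]
    have hbk : b' (k + 1) = T ∘ₗ zigzagTarget p g b k := by rw [hb', Function.update_self]
    have hzmem : ∀ c ∈ on (ZMod p) (nearLists (L₀ ∩ {x | g x = x}) δ ℓ),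
        zigzagTarget p g b k c ∈ on (ZMod p) (nearLists L (min δ₁ ε) (ℓ + k)) := by
      intro c hc
      rw [zigzagTarget, LinearMap.add_apply]
      refine Submodule.add_mem _ ?_ ?_
      · exact altOp_mem_nearLists hgL hδ₂' k
          (on_mono (nearLists_mono subset_rfl (min_le_right _ _)) (hb1 k le_rfl c hc))
      · split_ifs with h
        · subst h
          exact on_mono (nearLists_mono (inter_subset_left.trans hL₀L)
            (hδle.trans (min_le_left _ _))) hc
        · simp
    refine ⟨δ, hδ, hδle.trans hle, b', by rw [hbb 0 (Nat.zero_le _), hb0], ?_, ?_, ?_⟩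
    · intro i hi c hc
      rcases Nat.lt_or_ge k i with h | h
      · obtain rfl : i = k + 1 := by omega
        rw [hbk, LinearMap.comp_apply]
        exact on_mono (nearLists_mono (subset_union_right.trans hLM) le_rfl)
          (hTmem _ (on_mono (nearLists_mono subset_rfl (min_le_left _ _)) (hzmem c hc)))
      · rw [hbb i h]
        exact on_mono (nearLists_mono hLM' hle) (hb1 i h c hc)
    · intro i hi c hc
      rw [hzz i (by omega)]
      rcases Nat.lt_or_ge i k with h | h
      · exact on_mono (nearLists_mono hLM' hle) (hb2 i h c hc)
      · obtain rfl : i = k := by omega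
        exact on_mono (nearLists_mono hLM' (min_le_right _ _)) (hzmem c hc)
    · intro c hc hbdc hpush i hi
      have hrel := hb3 c hc hbdc fun i hi => by
        rw [← hzz i (by omega)]; exact hpush i (by omega)
      rw [hzz i (by omega)]
      rcases Nat.lt_or_ge i k with h | h
      · rw [hbb _ (by omega)]
        exact hrel i h
      · obtain rfl : i = k := by omega
        rw [hbk, LinearMap.comp_apply]
        refine hTbd _ (on_mono (nearLists_mono subset_rfl (min_le_left _ _)) (hzmem c hc)) ?_ ?_
        · rcases i with _ | i
          · simp [zigzagTarget, hb0, hbdc]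
          · have h1 := hrel i (by omega)
            simp only [zigzagTarget, LinearMap.add_apply, LinearMap.comp_apply, Nat.succ_ne_zero,
              if_false, add_zero, bd_altOp] at h1 ⊢
            rw [h1, map_add, altOp_altOp hg, zero_add]
            split_ifs with hi0
            · subst hi0
              simpa [altOp] using normOp_eq_zero (push_eq_self_of_fixed hc)
            · simp
        · rw [← hzz i le_rfl]
          exact hpush i hi


/-- The part of a chain carried by the lists of a given length. -/
def lengthPart {F X : Type*} [CommRing F] (n : ℕ) : ListChain F X →ₗ[F] ListChain F X :=
  extend fun σ => if σ.length = n then simplex F σ else 0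

lemma bd_lengthPart {F X : Type*} [CommRing F] (n : ℕ) (c : ListChain F X) :
    bd (lengthPart (n + 1) c) = lengthPart n (bd c) := by
  have key : (bd ∘ₗ lengthPart (n + 1) : ListChain F X →ₗ[F] ListChain F X) =
      lengthPart n ∘ₗ bd := by
    refine hom_ext fun σ => ?_
    rw [LinearMap.comp_apply, LinearMap.comp_apply, lengthPart, extend_simplex]
    by_cases h : σ.length = n + 1
    · rw [if_pos h]
      symm
      refine eq_of_simplex (F := F) (M := ListChain F X) (lengthPart n) LinearMap.id
        (fun τ hτ => ?_) (bd_simplex_mem σ)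
      have := hτ.2
      rw [lengthPart, extend_simplex, if_pos (by omega), LinearMap.id_apply]
    · rw [if_neg h, map_zero]
      symm
      refine eq_of_simplex (F := F) (M := ListChain F X) (lengthPart n) 0
        (fun τ hτ => ?_) (bd_simplex_mem σ)
      have := hτ.2
      rw [lengthPart, extend_simplex, if_neg (by omega), LinearMap.zero_apply]
  exact LinearMap.congr_fun key c

lemma lengthPart_mem {F X : Type*} [CommRing F] (n : ℕ) {S : Set (List X)} {c : ListChain F X}
    (hc : c ∈ on F S) : lengthPart n c ∈ on F {σ ∈ S | σ.length = n} := by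
  refine map_mem_of_simplex (lengthPart n) (fun σ hσ => ?_) hc
  rw [lengthPart, extend_simplex]
  split_ifs with h
  · exact simplex_mem ⟨hσ, h⟩
  · exact Submodule.zero_mem _

lemma lengthPart_eq {F X : Type*} [CommRing F] {n : ℕ} {c : ListChain F X}
    (hc : c ∈ on F {σ : List X | σ.length = n}) : lengthPart n c = c := by
  refine eq_of_simplex (F := F) (M := ListChain F X) (lengthPart n) LinearMap.id
    (fun σ hσ => ?_) hc
  have : σ.length = n := hσ
  rw [lengthPart, extend_simplex, if_pos this, LinearMap.id_apply]

lemma finite_lists_le {X : Type*} (P : Finset X) (n : ℕ) :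
    {σ : List X | σ.length ≤ n ∧ ∀ x ∈ σ, x ∈ P}.Finite := by
  have h := (List.finite_length_le (P : Set X) n).image (List.map Subtype.val)
  refine h.subset fun σ hσ => ?_
  lift σ to List (P : Set X) using hσ.2
  exact ⟨σ, by simpa using hσ.1, rfl⟩

/-- **Smith theory.** Among sufficiently many small cycles of fixed points of a transformation
of prime order `p`, some nontrivial combination modulo `p` bounds a small chain of fixed points;
the number of cycles needed does not depend on the transformation. -/
theorem exists_bounding [FiniteDimensional ℝ E] (hD : IsOpen D) (hK : IsCompact K) (hKD : K ⊆ D)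
    (hW : Continuous W) (hpath : ∀ z ∈ D, ∀ t ∈ Icc (0 : ℝ) 1, z + t • W z ∈ D)
    (hWK : ∀ z ∈ D, z + W z ∈ K) (ℓ : ℕ) :
    ∃ B : ℕ, ∀ p : ℕ, p.Prime → ∀ g : Equiv.Perm E, g ^ p = 1 → (∀ x, g x ∈ D ↔ x ∈ D) →
      (∀ j : ℕ, ∀ z ∈ D, ∃ A : E →L[ℝ] E, HasStrictFDerivAt (g ^ j : Equiv.Perm E) A z) →
      ∀ L₀ : Set E, IsCompact L₀ → L₀ ⊆ D → ∃ L : Set E, IsCompact L ∧ L ⊆ D ∧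
      ∀ ε > 0, ∃ δ > 0, ∀ n > B, ∀ a : Fin n → ListChain (ZMod p) E,
        (∀ i, a i ∈ on (ZMod p) (nearLists (L₀ ∩ {x | g x = x}) δ ℓ)) → (∀ i, bd (a i) = 0) →
        ∃ x : Fin n → ZMod p, x ≠ 0 ∧
          ∃ e ∈ on (ZMod p) (nearLists (L ∩ {x | g x = x}) ε (ℓ + 1)),
            bd e = ∑ i, x i • a i := by
  obtain ⟨P, π, hπ, hfill⟩ := exists_fill hD hK hKD hW hpath hWK
  set f : E → E := fun z => π (z + W z) with hf
  set N : ℕ := 37 ^ Module.finrank ℝ E + 1 with hN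
  have hSfin := finite_lists_le P (ℓ + N)
  set S : Set (List E) := {σ : List E | σ.length ≤ ℓ + N ∧ ∀ x ∈ σ, x ∈ P} with hS
  have : Fintype S := hSfin.fintype
  refine ⟨(N + 1) * Fintype.card S, fun p hp g hg hgD hdiff L₀ hL₀ hL₀D => ?_⟩
  have : Fact p.Prime := ⟨hp⟩
  have hcont : ∀ j : ℕ, ContinuousOn (g ^ j : Equiv.Perm E) D := fun j x hx => by
    obtain ⟨A, hA⟩ := hdiff j x hx
    exact hA.hasFDerivAt.continuousAt.continuousWithinAt
  obtain ⟨L, hLc, hLD, hL₀L, hgL, hzz⟩ :=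
    exists_zigzag (ℓ := ℓ) hfill hp hg hgD hcont hL₀ hL₀D (N + 1)
  refine ⟨L, hLc, hLD, fun ε hε => ?_⟩
  obtain ⟨col, lab, ι, η, hη, hcol, hlt, hmap, hconst, hι, hιg, hιfix⟩ :=
    exists_colouring hp hg hLc hLD hgL hdiff (ε := ε / 3) (by positivity) hN
  obtain ⟨ε', hε', hnear⟩ := exists_transNear_of_dist hp.pos hg hLc
    (fun j => (hcont j).mono hLD) (lt_min hη (show 0 < ε / 3 by positivity))
  obtain ⟨δ, hδ, hδε', b, hb0, hbmem, hzmem, hbrel⟩ := hzz ε' hε'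
  refine ⟨δ, hδ, fun n hn a ha hbda => ?_⟩
  set comb : (Fin n → ZMod p) →ₗ[ZMod p] ListChain (ZMod p) E :=
    Fintype.linearCombination (ZMod p) a with hcomb
  have hcombx : ∀ x, comb x = ∑ i, x i • a i := fun x => Fintype.linearCombination_apply _ _ _
  have hcmem : ∀ x, comb x ∈ on (ZMod p) (nearLists (L₀ ∩ {x | g x = x}) δ ℓ) := fun x => by
    rw [hcombx]
    exact Submodule.sum_mem _ fun i _ => Submodule.smul_mem _ _ (ha i)
  have hcbd : ∀ x, bd (comb x) = 0 := fun x => by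
    rw [hcombx, map_sum]
    exact Finset.sum_eq_zero fun i _ => by rw [map_smul, hbda, smul_zero]
  set Ψ : (Fin n → ZMod p) →ₗ[ZMod p] (Fin (N + 1) × S → ZMod p) :=
    LinearMap.pi fun q => Finsupp.lapply (q.2 : List E) ∘ₗ push f ∘ₗ
      zigzagTarget p g b (q.1 : ℕ) ∘ₗ comb with hΨ
  obtain ⟨x, hxker, hx0⟩ := Submodule.exists_mem_ne_zero_of_ne_bot
    (LinearMap.ker_ne_bot_of_finrank_lt (f := Ψ) (by
      rw [Module.finrank_fin_fun, Module.finrank_fintype_fun_eq_card, Fintype.card_prod,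
        Fintype.card_fin]
      exact hn))
  refine ⟨x, hx0, ?_⟩
  rw [← hcombx]
  have hpush : ∀ i < N + 1, push f (zigzagTarget p g b i (comb x)) = 0 := by
    intro i hi
    have hmem : push f (zigzagTarget p g b i (comb x)) ∈ on (ZMod p) S := by
      refine push_mem (fun σ hσ => ?_) (hzmem i hi _ (hcmem x))
      refine ⟨by rw [List.length_map, hσ.1]; omega, fun y hy => ?_⟩
      obtain ⟨z, hz, rfl⟩ := List.mem_map.1 hy
      exact hπ z (hLD (hσ.2.1 z hz))
    ext σ
    by_cases hσ : σ ∈ S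
    · exact congr_fun (LinearMap.mem_ker.1 hxker) (⟨i, hi⟩, ⟨σ, hσ⟩)
    · exact Finsupp.notMem_support_iff.1 fun h => hσ (hmem h)
  have hrel := hbrel _ (hcmem x) (hcbd x) hpush
  set A : Set (List E) := {σ | (∀ x ∈ σ, x ∈ L) ∧
    ∀ x ∈ σ, ∀ y ∈ σ, TransNear g (min η (ε / 3)) x y} with hA
  have hnA : ∀ m, nearLists L ε' m ⊆ A := fun m σ hσ => ⟨hσ.2.1, fun x hx y hy =>
    hnear x (hσ.2.1 x hx) y (hσ.2.1 y hy) (hσ.2.2 x hx y hy)⟩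
  have hfixcol : nearLists (L₀ ∩ {x | g x = x}) δ ℓ ⊆ {σ | ∀ x ∈ σ, N ≤ col x} :=
    fun σ hσ x hx => (hιfix x (hσ.2.1 x hx).2).2
  obtain ⟨b₀, b₁, hb₀, hb₁, hbd⟩ := eliminate_all (F := ZMod p) hp.pos hg (A := A) (N := N)
    (col := col) (lab := lab) (a := comb x)
    (b := fun i => if i ≤ N + 1 then b i (comb x) else 0)
    (by
      rintro σ ⟨hσ1, hσ2⟩
      refine ⟨fun x hx => ?_, fun x hx y hy => ?_⟩
      · obtain ⟨x', hx', rfl⟩ := List.mem_map.1 hx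
        exact (hgL x').2 (hσ1 x' hx')
      · obtain ⟨x', hx', rfl⟩ := List.mem_map.1 hx
        obtain ⟨y', hy', rfl⟩ := List.mem_map.1 hy
        simpa using (hσ2 x' hx' y' hy').zpow 1)
    (fun σ hσ τ hτ => ⟨fun x hx => hσ.1 x (hτ.subset hx), fun x hx y hy =>
      hσ.2 x (hτ.subset hx) y (hτ.subset hy)⟩)
    hcol hlt hmap
    (fun σ hσ x hx y hy => hconst x y ((hσ.2 x hx y hy).mono (min_le_left _ _)))
    (on_mono hfixcol (hcmem x))
    (fun i => by
      split_ifs with h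
      · exact on_mono (hnA _) (hbmem i h _ (hcmem x))
      · exact Submodule.zero_mem _)
    (fun i hi => by
      rw [if_pos (by omega), if_pos (by omega), hrel i hi]
      simp only [zigzagTarget, LinearMap.add_apply, LinearMap.comp_apply]
      split_ifs <;> simp)
  have hιa : push ι (comb x) = comb x := by
    refine eq_of_simplex (F := ZMod p) (M := ListChain (ZMod p) E) (push ι) LinearMap.id
      (fun σ hσ => ?_) (hcmem x)
    rw [push_simplex, LinearMap.id_apply]
    congr 1
    conv_rhs => rw [← List.map_id σ]
    exact List.map_congr_left fun x hx => (hιfix x (hσ.2.1 x hx).2).1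
  have hιdiff : push ι (diffOp g b₀) = 0 := by
    have : ι ∘ g = ι := funext hιg
    rw [diffOp, LinearMap.sub_apply, map_sub, push_push, this, LinearMap.id_apply, sub_self]
  refine ⟨lengthPart (ℓ + 1) (push ι b₁), ?_, ?_⟩
  · have h1 : push ι b₁ ∈ on (ZMod p) {σ : List E | (∀ x ∈ σ, x ∈ L ∩ {x | g x = x}) ∧
        ∀ x ∈ σ, ∀ y ∈ σ, dist x y ≤ ε} := by
      refine push_mem (fun σ hσ => ?_) hb₁
      refine ⟨fun x hx => ?_, fun x hx y hy => ?_⟩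
      · obtain ⟨x', hx', rfl⟩ := List.mem_map.1 hx
        obtain ⟨h1, h2, -⟩ := hι x' (hσ.1.1 x' hx') (hσ.2 x' hx')
        exact ⟨h2, h1⟩
      · obtain ⟨x', hx', rfl⟩ := List.mem_map.1 hx
        obtain ⟨y', hy', rfl⟩ := List.mem_map.1 hy
        have h1 := (hι x' (hσ.1.1 x' hx') (hσ.2 x' hx')).2.2
        have h2 := (hι y' (hσ.1.1 y' hy') (hσ.2 y' hy')).2.2
        have h3 := ((hσ.1.2 x' hx' y' hy').mono (min_le_right _ _)).dist_lt
        have h4 := dist_triangle4 (ι x') x' y' (ι y')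
        rw [dist_comm (ι x') x'] at h4
        linarith
    refine on_mono ?_ (lengthPart_mem (ℓ + 1) h1)
    rintro σ ⟨⟨h2, h3⟩, h4⟩
    exact ⟨h4, h2, h3⟩
  · rw [bd_lengthPart, ← push_bd, hbd, map_add, hιdiff, zero_add, hιa]
    exact lengthPart_eq (on_mono (fun σ hσ => hσ.1) (hcmem x))

end Bounding

end

section

/-! ### Pushing a bounded domain with smooth boundary into itself -/

section PushInside

variable {E : Type*} [NormedAddCommGroup E] [NormedSpace ℝ E] [FiniteDimensional ℝ E]

lemma exists_inward_field {A : Set E} (hA : IsClosed A) {α : E → E →L[ℝ] ℝ}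
    (hα : ContinuousOn α A) (h0 : ∀ z ∈ A, α z ≠ 0) :
    ∃ V : E → E, Continuous V ∧ ∀ z ∈ A, α z (V z) < 0 := by
  set e := Module.finBasis ℝ E
  have hc : ContinuousOn (fun z => fun i => - α z (e i)) A := by
    refine continuousOn_pi.2 fun i => ?_
    exact (hα.clm_apply continuousOn_const).neg
  obtain ⟨F, hF⟩ := ContinuousMap.exists_restrict_eq hA
    ⟨A.domRestrict (fun z => fun i => - α z (e i)), continuousOn_iff_continuous_domRestrict.1 hc⟩
  have hF' : ∀ z ∈ A, ∀ i, F z i = - α z (e i) := fun z hz i =>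
    congr_fun (DFunLike.congr_fun hF ⟨z, hz⟩) i
  refine ⟨fun z => ∑ i, F z i • e i, ?_, fun z hz => ?_⟩
  · refine continuous_finsetSum _ fun i _ => ?_
    have : Continuous fun z => F z i := (continuous_apply i).comp F.continuous
    exact this.smul continuous_const
  · have h1 : α z (∑ i, F z i • e i) = - ∑ i, (α z (e i)) ^ 2 := by
      rw [map_sum, ← Finset.sum_neg_distrib]
      refine Finset.sum_congr rfl fun i _ => ?_
      rw [map_smul, hF' z hz, smul_eq_mul]
      ring
    rw [h1, neg_lt_zero]
    refine lt_of_le_of_ne (Finset.sum_nonneg fun i _ => sq_nonneg _) fun h => h0 z hz ?_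
    have h2 := (Finset.sum_eq_zero_iff_of_nonneg fun i _ => sq_nonneg (α z (e i))).1 h.symm
    ext v
    have h3 : (α z : E →ₗ[ℝ] ℝ) = 0 := e.ext fun i => by
      simpa using h2 i (Finset.mem_univ i)
    exact LinearMap.congr_fun h3 v

/-- A bounded domain with smooth boundary can be pushed into a compact subset of itself along
straight segments. -/
theorem exists_push {D U : Set E} {ρ : E → ℝ} (hD : IsOpen D) (hb : Bornology.IsBounded D)
    (hU : IsOpen U) (hDU : frontier D ⊆ U) (hρ : AnalyticOnNhd ℝ ρ U)
    (hneg : D ∩ U = {z ∈ U | ρ z < 0}) (hzero : frontier D = {z ∈ U | ρ z = 0})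
    (hgrad : ∀ z ∈ frontier D, fderiv ℝ ρ z ≠ 0) :
    ∃ (K : Set E) (W : E → E), IsCompact K ∧ K ⊆ D ∧ Continuous W ∧
      (∀ z ∈ D, ∀ t ∈ Icc (0 : ℝ) 1, z + t • W z ∈ D) ∧ ∀ z ∈ D, z + W z ∈ K := by
  have hKc : IsCompact (closure D) := hb.isCompact_closure
  obtain ⟨V, hV, hVneg⟩ := exists_inward_field isClosed_frontier
    (hρ.fderiv.continuousOn.mono hDU) hgrad
  have hflow : Continuous fun q : E × ℝ => q.1 + q.2 • V q.1 := by fun_prop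
  have hloc : ∀ q ∈ closure D, ∀ᶠ x : E × ℝ in 𝓝 (q, 0), x.1 ∈ closure D → 0 < x.2 →
      x.1 + x.2 • V x.1 ∈ D := by
    intro q hq
    have hflowt : Tendsto (fun q : E × ℝ => q.1 + q.2 • V q.1) (𝓝 (q, 0)) (𝓝 q) := by
      simpa using hflow.tendsto (q, (0 : ℝ))
    by_cases hqD : q ∈ D
    · filter_upwards [hflowt (hD.mem_nhds hqD)] with x hx _ _
      exact hx
    · have hqf : q ∈ frontier D := by
        rw [hD.frontier_eq]; exact ⟨hq, hqD⟩
      have hqU := hDU hqf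
      have hs : HasStrictFDerivAt ρ (fderiv ℝ ρ q) q := (hρ q hqU).hasStrictFDerivAt
      set c := - fderiv ℝ ρ q (V q) with hc
      have hcpos : 0 < c := by
        have := hVneg q hqf
        rw [hc]
        linarith
      have h1 : ∀ᶠ x : E × ℝ in 𝓝 (q, 0), fderiv ℝ ρ q (V x.1) < - (3 / 4) * c := by
        have : Continuous fun x : E × ℝ => fderiv ℝ ρ q (V x.1) := by fun_prop
        refine (this.tendsto (q, (0 : ℝ))).eventually (gt_mem_nhds ?_)
        simp only [hc]
        linarith
      have h2 : ∀ᶠ x : E × ℝ in 𝓝 (q, 0), ‖V x.1‖ < ‖V q‖ + 1 := by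
        have : Continuous fun x : E × ℝ => ‖V x.1‖ := by fun_prop
        refine (this.tendsto (q, (0 : ℝ))).eventually (gt_mem_nhds ?_)
        simp
      have hη : 0 < c / 4 / (‖V q‖ + 1) := by positivity
      have h3 := (hs.isLittleO.bound hη)
      have h4 : Tendsto (fun x : E × ℝ => (x.1 + x.2 • V x.1, x.1)) (𝓝 (q, 0)) (𝓝 (q, q)) :=
        hflowt.prodMk_nhds (continuous_fst.tendsto (q, (0 : ℝ)))
      filter_upwards [h1, h2, h4.eventually h3, hflowt (hU.mem_nhds hqU),
        (continuous_fst.tendsto (q, (0 : ℝ))) (hU.mem_nhds hqU)] with x hx1 hx2 hx3 hx4 hx5 hxD hx0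
      have hx4' : x.1 + x.2 • V x.1 ∈ U := hx4
      have hx5' : x.1 ∈ U := hx5
      have hle : ρ x.1 ≤ 0 := by
        by_cases hD' : x.1 ∈ D
        · have : x.1 ∈ D ∩ U := ⟨hD', hx5'⟩
          rw [hneg] at this
          exact this.2.le
        · have : x.1 ∈ frontier D := by
            rw [hD.frontier_eq]; exact ⟨hxD, hD'⟩
          rw [hzero] at this
          exact this.2.le
      have hlt : ρ (x.1 + x.2 • V x.1) < 0 := by
        simp only [add_sub_cancel_left, map_smul, smul_eq_mul, norm_smul, Real.norm_eq_abs,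
          abs_of_pos hx0] at hx3
        have h5 : x.2 * fderiv ℝ ρ q (V x.1) ≤ x.2 * (- (3 / 4) * c) := by gcongr
        have h6 : c / 4 / (‖V q‖ + 1) * (x.2 * ‖V x.1‖) ≤ x.2 * (c / 4) := by
          calc c / 4 / (‖V q‖ + 1) * (x.2 * ‖V x.1‖)
              ≤ c / 4 / (‖V q‖ + 1) * (x.2 * (‖V q‖ + 1)) := by gcongr
            _ = x.2 * (c / 4) := by field_simp
        have h7 := (abs_le.1 hx3).2
        have h8 : 0 < x.2 * c := by positivity
        linarith
      have : x.1 + x.2 • V x.1 ∈ D ∩ U := by rw [hneg]; exact ⟨hx4', hlt⟩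
      exact this.1
  obtain ⟨s, hs, hsD⟩ : ∃ s > (0 : ℝ), ∀ z ∈ closure D, ∀ t, 0 < t → t ≤ s →
      z + t • V z ∈ D := by
    refine hKc.induction_on (p := fun A => ∃ s > (0 : ℝ), ∀ z ∈ A, ∀ t, 0 < t → t ≤ s →
      z + t • V z ∈ D) ⟨1, one_pos, by simp⟩ ?_ ?_ ?_
    · rintro A B hAB ⟨s, hs, h⟩
      exact ⟨s, hs, fun z hz => h z (hAB hz)⟩
    · rintro A B ⟨s, hs, h⟩ ⟨s', hs', h'⟩
      refine ⟨min s s', lt_min hs hs', ?_⟩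
      rintro z (hz | hz) t ht hts
      · exact h z hz t ht (hts.trans (min_le_left _ _))
      · exact h' z hz t ht (hts.trans (min_le_right _ _))
    · intro q hq
      have := hloc q hq
      rw [nhds_prod_eq] at this
      obtain ⟨P, hP, Q, hQ, h⟩ := eventually_prod_iff.1 this
      obtain ⟨s, hs, hs'⟩ := Metric.eventually_nhds_iff.1 hQ
      refine ⟨{z | P z} ∩ closure D, Filter.inter_mem (mem_nhdsWithin_of_mem_nhds hP)
        self_mem_nhdsWithin, s / 2, by positivity, ?_⟩
      rintro z ⟨hzP, hzD⟩ t ht hts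
      refine h hzP (hs' (y := t) ?_) hzD ht
      rw [Real.dist_eq, sub_zero, abs_of_pos ht]
      linarith
  refine ⟨(fun z => z + s • V z) '' closure D, fun z => s • V z,
    hKc.image (by fun_prop), ?_, by fun_prop, ?_, ?_⟩
  · rintro _ ⟨z, hz, rfl⟩
    exact hsD z hz s hs le_rfl
  · intro z hz t ht
    rcases ht.1.eq_or_lt with h | h
    · simpa [← h] using hz
    · rw [smul_smul]
      exact hsD z (subset_closure hz) _ (by positivity) (by nlinarith [ht.2])
  · exact fun z hz => mem_image_of_mem _ (subset_closure hz)

end PushInside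

end

section

namespace Holo

variable {E G : Type*} [NormedAddCommGroup E] [NormedSpace ℂ E]
  [NormedAddCommGroup G] [NormedSpace ℂ G] [CompleteSpace G]

theorem disc_estimates {h : ℂ → G} {r M : ℝ} (hr : 0 < r)
    (hd : DifferentiableOn ℂ h (ball 0 r)) (hM : ∀ t ∈ ball (0 : ℂ) r, ‖h t‖ ≤ M)
    {t : ℂ} (ht : t ∈ ball (0 : ℂ) r) :
    ‖h t - h 0‖ ≤ 2 * M / r * ‖t‖ ∧
      ‖h t - h 0 - t • deriv h 0‖ ≤ 4 * M / r ^ 2 * ‖t‖ ^ 2 := by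
  have h0 : (0 : ℂ) ∈ ball (0 : ℂ) r := mem_ball_self hr
  have hmaps : MapsTo h (ball 0 r) (closedBall (h 0) (2 * M)) := fun s hs => by
    rw [mem_closedBall, dist_eq_norm]
    linarith [norm_sub_le (h s) (h 0), hM s hs, hM 0 h0]
  have b1 : ∀ s ∈ ball (0 : ℂ) r, ‖dslope h 0 s‖ ≤ 2 * M / r := fun s hs =>
    Complex.norm_dslope_le_div_of_mapsTo_ball hd hmaps hs
  have hd1 : DifferentiableOn ℂ (dslope h 0) (ball 0 r) :=
    (Complex.differentiableOn_dslope (ball_mem_nhds 0 hr)).2 hd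
  have hmaps1 : MapsTo (dslope h 0) (ball 0 r) (closedBall (dslope h 0 0) (4 * M / r)) :=
    fun s hs => by
      rw [mem_closedBall, dist_eq_norm]
      have := norm_sub_le (dslope h 0 s) (dslope h 0 0)
      have h1 := b1 s hs
      have h2 := b1 0 h0
      have h3 : 4 * M / r = 2 * M / r + 2 * M / r := by ring
      linarith
  have b2 := Complex.norm_dslope_le_div_of_mapsTo_ball hd1 hmaps1 ht
  have e1 : h t - h 0 = t • dslope h 0 t := by
    have := sub_smul_dslope h 0 t
    simpa using this.symm
  have e2 : dslope h 0 t - deriv h 0 = t • dslope (dslope h 0) 0 t := by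
    have := sub_smul_dslope (dslope h 0) 0 t
    simpa [dslope_same] using this.symm
  constructor
  · rw [e1, norm_smul, mul_comm]
    exact mul_le_mul_of_nonneg_right (b1 t ht) (norm_nonneg _)
  · rw [e1, ← smul_sub, e2, norm_smul, norm_smul]
    have : 4 * M / r ^ 2 * ‖t‖ ^ 2 = ‖t‖ * (‖t‖ * (4 * M / r / r)) := by
      field_simp
    rw [this]
    gcongr

theorem ball_estimates {F : E → G} {z : E} {r M : ℝ}
    (hd : DifferentiableOn ℂ F (ball z r)) (hM : ∀ w ∈ ball z r, ‖F w‖ ≤ M)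
    {w : E} (hw : w ∈ ball z r) :
    ‖F w - F z‖ ≤ 2 * M / r * ‖w - z‖ ∧
      ‖F w - F z - fderiv ℂ F z (w - z)‖ ≤ 4 * M / r ^ 2 * ‖w - z‖ ^ 2 := by
  rcases eq_or_ne w z with rfl | hne
  · simp
  have hr : 0 < r := dist_nonneg.trans_lt (mem_ball.1 hw)
  have hn : 0 < ‖w - z‖ := norm_pos_iff.2 (sub_ne_zero.2 hne)
  set v : E := (‖w - z‖⁻¹ : ℂ) • (w - z) with hv
  have hv1 : ‖v‖ = 1 := by
    rw [hv, norm_smul]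
    simp [hn.ne']
  have hmem : ∀ t ∈ ball (0 : ℂ) r, z + t • v ∈ ball z r := fun t ht => by
    rw [mem_ball_iff_norm, add_sub_cancel_left, norm_smul, hv1, mul_one]
    simpa using ht
  have hdl : ∀ t : ℂ, HasFDerivAt (fun t : ℂ => z + t • v)
      ((ContinuousLinearMap.id ℂ ℂ).smulRight v) t := fun t => by
    exact ((ContinuousLinearMap.id ℂ ℂ).smulRight v).hasFDerivAt.const_add z
  have hdh : DifferentiableOn ℂ (fun t : ℂ => F (z + t • v)) (ball 0 r) :=
    hd.comp (fun t _ => (hdl t).differentiableAt.differentiableWithinAt) hmem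
  have htm : ((‖w - z‖ : ℝ) : ℂ) ∈ ball (0 : ℂ) r := by
    simpa [dist_eq_norm] using hw
  have hwz : z + ((‖w - z‖ : ℝ) : ℂ) • v = w := by
    rw [hv, smul_smul, mul_inv_cancel₀ (by exact_mod_cast hn.ne'), one_smul]
    abel
  have hder : deriv (fun t : ℂ => F (z + t • v)) 0 = fderiv ℂ F z v := by
    have h1 : HasFDerivAt F (fderiv ℂ F z) (z + (0 : ℂ) • v) := by
      rw [zero_smul, add_zero]
      exact (hd.differentiableAt (ball_mem_nhds z hr)).hasFDerivAt
    have := (h1.comp (0 : ℂ) (hdl 0)).hasDerivAt.deriv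
    simpa [Function.comp_def] using this
  have key := disc_estimates hr hdh (fun t ht => hM _ (hmem t ht)) htm
  simp only [hwz, zero_smul, add_zero, hder] at key
  rw [← map_smul] at key
  have e : ((‖w - z‖ : ℝ) : ℂ) • v = w - z := by
    rw [← add_right_inj z, hwz]; abel
  rw [e] at key
  simpa using key

theorem norm_fderiv_le {F : E → G} {z : E} {r M : ℝ} (hr : 0 < r) (hM0 : 0 ≤ M)
    (hd : DifferentiableOn ℂ F (ball z r)) (hM : ∀ w ∈ ball z r, ‖F w‖ ≤ M) :
    ‖fderiv ℂ F z‖ ≤ 2 * M / r := by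
  refine (hd.differentiableAt (ball_mem_nhds z hr)).hasFDerivAt.le_of_lip' (by positivity) ?_
  filter_upwards [ball_mem_nhds z hr] with w hw
  exact (ball_estimates hd hM hw).1

theorem norm_fderiv_sub_le {F : E → G} {z : E} {r M : ℝ} (hr : 0 < r) (hM0 : 0 ≤ M)
    (hd : DifferentiableOn ℂ F (ball z (2 * r))) (hM : ∀ w ∈ ball z (2 * r), ‖F w‖ ≤ M)
    {w : E} (hw : w ∈ ball z r) :
    ‖fderiv ℂ F w - fderiv ℂ F z‖ ≤ 4 * M / r ^ 2 * ‖w - z‖ := by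
  have hsub : ∀ x ∈ ball z r, ball x r ⊆ ball z (2 * r) := fun x hx =>
    ball_subset_ball' (by linarith [mem_ball.1 hx])
  have hwn : ‖w - z‖ < r := mem_ball_iff_norm.1 hw
  have hx1 : ∀ x ∈ ball z r, x + (w - z) ∈ ball x r := fun x _ => by
    rw [mem_ball_iff_norm]; simpa using hwn
  have hD : DifferentiableOn ℂ (fun x => F (x + (w - z)) - F x) (ball z r) := by
    refine DifferentiableOn.sub (hd.comp (by fun_prop) fun x hx => hsub x hx (hx1 x hx))
      (hd.mono (ball_subset_ball (by linarith)))
  have hb : ∀ x ∈ ball z r, ‖F (x + (w - z)) - F x‖ ≤ 2 * M / r * ‖w - z‖ := fun x hx => by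
    have := (ball_estimates (hd.mono (hsub x hx)) (fun y hy => hM y (hsub x hx hy)) (hx1 x hx)).1
    simpa using this
  have h := norm_fderiv_le hr (by positivity) hD hb
  have e : fderiv ℂ (fun x => F (x + (w - z)) - F x) z = fderiv ℂ F w - fderiv ℂ F z := by
    have h1 : HasFDerivAt F (fderiv ℂ F w) (z + (w - z)) := by
      rw [add_sub_cancel]
      exact (hd.differentiableAt (isOpen_ball.mem_nhds
        (hsub z (mem_ball_self hr) hw))).hasFDerivAt
    have h2 : HasFDerivAt F (fderiv ℂ F z) z :=
      (hd.differentiableAt (ball_mem_nhds z (by linarith))).hasFDerivAt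
    have h3 : HasFDerivAt (fun x => F (x + (w - z)) - F x)
        ((fderiv ℂ F w).comp (ContinuousLinearMap.id ℂ E) - fderiv ℂ F z) z :=
      (h1.comp z ((hasFDerivAt_id z).add_const (w - z))).sub h2
    rw [h3.fderiv, ContinuousLinearMap.comp_id]
  rw [e] at h
  refine h.trans (le_of_eq ?_)
  field_simp
  ring

theorem exists_ball_bound {F : E → G} {D : Set E} (hD : IsOpen D) (hd : DifferentiableOn ℂ F D)
    {z : E} (hz : z ∈ D) :
    ∃ r > 0, ∃ M ≥ 0, ball z (2 * r) ⊆ D ∧ ∀ w ∈ ball z (2 * r), ‖F w‖ ≤ M := by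
  have hc : ContinuousAt F z := (hd.differentiableAt (hD.mem_nhds hz)).continuousAt
  have h1 : ∀ᶠ w in 𝓝 z, w ∈ D ∧ ‖F w‖ < ‖F z‖ + 1 :=
    (hD.eventually_mem hz).and (hc.norm.eventually_lt_const (lt_add_one _))
  obtain ⟨r, hr, h⟩ := Metric.eventually_nhds_iff_ball.1 h1
  refine ⟨r / 2, by positivity, ‖F z‖ + 1, by positivity, ?_, ?_⟩
  · intro w hw
    exact (h w (by simpa [mul_div_cancel₀] using hw)).1
  · intro w hw
    exact (h w (by simpa [mul_div_cancel₀] using hw)).2.le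

theorem continuousAt_fderiv {F : E → G} {D : Set E} (hD : IsOpen D)
    (hd : DifferentiableOn ℂ F D) {z : E} (hz : z ∈ D) : ContinuousAt (fderiv ℂ F) z := by
  obtain ⟨r, hr, M, hM0, hsub, hM⟩ := exists_ball_bound hD hd hz
  rw [ContinuousAt, tendsto_iff_norm_sub_tendsto_zero]
  have : Tendsto (fun w => 4 * M / r ^ 2 * ‖w - z‖) (𝓝 z) (𝓝 0) := by
    have : Continuous (fun w => 4 * M / r ^ 2 * ‖w - z‖) := by fun_prop
    simpa using this.tendsto z
  refine squeeze_zero' (Eventually.of_forall fun _ => norm_nonneg _) ?_ this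
  filter_upwards [ball_mem_nhds z hr] with w hw
  exact norm_fderiv_sub_le hr hM0 (hd.mono hsub) hM hw

theorem hasStrictFDerivAt {F : E → G} {D : Set E} (hD : IsOpen D)
    (hd : DifferentiableOn ℂ F D) {z : E} (hz : z ∈ D) :
    HasStrictFDerivAt F (fderiv ℂ F z) z := by
  refine hasStrictFDerivAt_of_hasFDerivAt_of_continuousAt (𝕜 := ℂ) ?_
    (continuousAt_fderiv hD hd hz)
  filter_upwards [hD.mem_nhds hz] with w hw
  exact (hd.differentiableAt (hD.mem_nhds hw)).hasFDerivAt

theorem exists_ultralimit [FiniteDimensional ℂ E] [FiniteDimensional ℂ G] {ι : Type*}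
    (U : Ultrafilter ι) {F : ι → E → G} {D : Set E} (hD : IsOpen D)
    (hd : ∀ i, DifferentiableOn ℂ (F i) D) {M : ℝ} (hM : ∀ i, ∀ z ∈ D, ‖F i z‖ ≤ M) :
    ∃ H : E → G, DifferentiableOn ℂ H D ∧ ∀ z ∈ D, Tendsto (fun i => F i z) U (𝓝 (H z)) ∧
      Tendsto (fun i => fderiv ℂ (F i) z) U (𝓝 (fderiv ℂ H z)) := by
  have : ProperSpace G := FiniteDimensional.proper ℂ G
  have : ProperSpace (E →L[ℂ] G) := FiniteDimensional.proper ℂ _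
  rcases U.neBot.nonempty_of_mem univ_mem with ⟨i0, -⟩
  have h1 : ∀ z, ∃ y, z ∈ D → Tendsto (fun i => F i z) U (𝓝 y) := fun z => by
    by_cases hz : z ∈ D
    · obtain ⟨y, -, hy⟩ := (isCompact_closedBall (0 : G) M).ultrafilter_le_nhds'
        (U.map fun i => F i z) (Eventually.of_forall (p := fun i => F i z ∈ closedBall 0 M)
          fun i => by simpa using hM i z hz)
      exact ⟨y, fun _ => hy⟩
    · exact ⟨0, fun h => absurd h hz⟩
  choose H hH using h1
  have h2 : ∀ z ∈ D, ∃ A : E →L[ℂ] G, Tendsto (fun i => fderiv ℂ (F i) z) U (𝓝 A) ∧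
      HasFDerivAt H A z := fun z hz => by
    have hM0 : 0 ≤ M := (norm_nonneg _).trans (hM i0 z hz)
    obtain ⟨r, hr, hrD⟩ := Metric.isOpen_iff.1 hD z hz
    obtain ⟨A, -, hA⟩ := (isCompact_closedBall (0 : E →L[ℂ] G) (2 * M / r)).ultrafilter_le_nhds'
        (U.map fun i => fderiv ℂ (F i) z)
        (Eventually.of_forall (p := fun i => fderiv ℂ (F i) z ∈ closedBall 0 (2 * M / r))
          fun i => by
            simpa using norm_fderiv_le hr hM0 ((hd i).mono hrD) (fun w hw => hM i w (hrD hw)))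
    refine ⟨A, hA, ?_⟩
    have hq : ∀ w ∈ ball z r, ‖H w - H z - A (w - z)‖ ≤ 4 * M / r ^ 2 * ‖w - z‖ ^ 2 :=
      fun w hw => by
        have ha : Tendsto (fun i => fderiv ℂ (F i) z (w - z)) U (𝓝 (A (w - z))) :=
          ((ContinuousLinearMap.apply ℂ G (w - z)).continuous.tendsto A).comp hA
        refine le_of_tendsto (((hH w (hrD hw)).sub (hH z hz)).sub ha).norm
          (Eventually.of_forall fun i => ?_)
        exact (ball_estimates ((hd i).mono hrD) (fun w hw => hM i w (hrD hw)) hw).2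
    rw [hasFDerivAt_iff_isLittleO]
    have hO : (fun w => H w - H z - A (w - z)) =O[𝓝 z] fun w => ‖w - z‖ ^ 2 := by
      refine Asymptotics.IsBigO.of_bound (4 * M / r ^ 2) ?_
      filter_upwards [ball_mem_nhds z hr] with w hw
      simpa using hq w hw
    refine hO.trans_isLittleO ?_
    rw [Asymptotics.isLittleO_norm_right.symm]
    have := (Asymptotics.isLittleO_pow_id (𝕜 := ℝ) (n := 2) (by norm_num)).comp_tendsto
      (show Tendsto (fun w => ‖w - z‖) (𝓝 z) (𝓝 0) by
        have : Continuous (fun w => ‖w - z‖) := by fun_prop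
        simpa using this.tendsto z)
    simpa [Function.comp_def] using this
  refine ⟨H, fun z hz => ?_, fun z hz => ⟨hH z hz, ?_⟩⟩
  · obtain ⟨A, -, h⟩ := h2 z hz
    exact h.differentiableAt.differentiableWithinAt
  · obtain ⟨A, hA, h⟩ := h2 z hz
    rwa [h.fderiv]

theorem limit_holomorphic [FiniteDimensional ℂ E] [FiniteDimensional ℂ G] {ι : Type*}
    {l : Filter ι} [l.NeBot] {F : ι → E → G} {H : E → G} {D : Set E} (hD : IsOpen D)
    (hd : ∀ i, DifferentiableOn ℂ (F i) D) {M : ℝ} (hM : ∀ i, ∀ z ∈ D, ‖F i z‖ ≤ M)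
    (hl : ∀ z ∈ D, Tendsto (fun i => F i z) l (𝓝 (H z))) :
    DifferentiableOn ℂ H D ∧
      ∀ z ∈ D, Tendsto (fun i => fderiv ℂ (F i) z) l (𝓝 (fderiv ℂ H z)) := by
  have key : ∀ U : Ultrafilter ι, (U : Filter ι) ≤ l → DifferentiableOn ℂ H D ∧
      ∀ z ∈ D, Tendsto (fun i => fderiv ℂ (F i) z) U (𝓝 (fderiv ℂ H z)) := fun U hU => by
    obtain ⟨H', hH', hlim⟩ := exists_ultralimit U hD hd hM
    have he : EqOn H H' D := fun z hz =>
      tendsto_nhds_unique ((hl z hz).mono_left hU) (hlim z hz).1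
    refine ⟨hH'.congr he, fun z hz => ?_⟩
    have : H =ᶠ[𝓝 z] H' := he.eventuallyEq_of_mem (hD.mem_nhds hz)
    rw [this.fderiv_eq]
    exact (hlim z hz).2
  refine ⟨(key (Ultrafilter.of l) (Ultrafilter.of_le l)).1, fun z hz => ?_⟩
  rw [tendsto_iff_ultrafilter]
  exact fun U hU => (key U hU).2 z hz

theorem eqOn_ball_of_eventuallyEq {F H : E → G} {x₁ x : E} {r : ℝ}
    (hF : DifferentiableOn ℂ F (ball x r)) (hH : DifferentiableOn ℂ H (ball x r))
    (hx : x₁ ∈ ball x r) (h : F =ᶠ[𝓝 x₁] H) : EqOn F H (ball x r) := by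
  intro z hz
  set L : ℂ → E := fun t => x₁ + t • (z - x₁) with hL
  have hLc : Continuous L := by fun_prop
  have hLd : Differentiable ℂ L := fun t =>
    (((ContinuousLinearMap.id ℂ ℂ).smulRight (z - x₁)).hasFDerivAt.const_add x₁).differentiableAt
  set V : Set ℂ := L ⁻¹' ball x r with hV
  have hVo : IsOpen V := isOpen_ball.preimage hLc
  let _ : NormedSpace ℝ E := NormedSpace.complexToReal
  have hVc : Convex ℝ V := by
    intro a ha b hb s t hs ht hst
    have := (convex_ball x r) ha hb hs ht hst
    rw [hV, mem_preimage]
    convert this using 1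
    simp only [hL]
    have hs' : (s : ℂ) + t = 1 := by exact_mod_cast hst
    rw [smul_add, smul_add, add_smul]
    have e1 : ∀ (c : ℝ) (u : E), c • u = (c : ℂ) • u := fun c u => rfl
    simp only [e1, smul_smul, Complex.real_smul]
    have : x₁ = (s : ℂ) • x₁ + (t : ℂ) • x₁ := by rw [← add_smul, hs', one_smul]
    nth_rewrite 1 [this]
    abel
  have h0 : (0 : ℂ) ∈ V := by simpa [hV, hL] using hx
  have h1 : (1 : ℂ) ∈ V := by simpa [hV, hL] using hz
  have hFa : AnalyticOnNhd ℂ (fun t => F (L t)) V :=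
    (hF.comp hLd.differentiableOn fun _ h => h).analyticOnNhd hVo
  have hHa : AnalyticOnNhd ℂ (fun t => H (L t)) V :=
    (hH.comp hLd.differentiableOn fun _ h => h).analyticOnNhd hVo
  have he : (fun t => F (L t)) =ᶠ[𝓝 0] fun t => H (L t) := by
    have : Tendsto L (𝓝 0) (𝓝 x₁) := by simpa [hL] using hLc.tendsto 0
    exact this.eventually h
  have := hFa.eqOn_of_preconnected_of_eventuallyEq hHa hVc.isPreconnected h0 he h1
  simpa [hL] using this

theorem eqOn_of_eventuallyEq {F H : E → G} {D : Set E} (hD : IsOpen D)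
    (hc : IsPreconnected D) (hF : DifferentiableOn ℂ F D) (hH : DifferentiableOn ℂ H D) {p : E}
    (hp : p ∈ D) (h : F =ᶠ[𝓝 p] H) : EqOn F H D := by
  set S : Set E := {x | F =ᶠ[𝓝 x] H} with hS
  have hSo : IsOpen S := isOpen_setOfPred_eventually_nhds
  have hsub : D ⊆ S := by
    refine hc.subset_of_closure_inter_subset hSo ⟨p, hp, h⟩ ?_
    rintro x ⟨hx, hxD⟩
    obtain ⟨r, hr, hrD⟩ := Metric.isOpen_iff.1 hD x hxD
    obtain ⟨x₁, h₁, hx₁⟩ := Metric.mem_closure_iff.1 hx r hr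
    have := eqOn_ball_of_eventuallyEq (hF.mono hrD) (hH.mono hrD)
      (show x₁ ∈ ball x r by rwa [mem_ball, dist_comm]) h₁
    exact this.eventuallyEq_of_mem (ball_mem_nhds x hr)
  exact fun x hx => (hsub hx).self_of_nhds

end Holo

end

section

namespace Torsion

/-- The lines through the origin contained in a closed subgroup. -/
def lines {V : Type*} [AddCommGroup V] [Module ℝ V] [TopologicalSpace V]
    (A : AddSubgroup V) : Submodule ℝ V where
  carrier := {v | ∀ t : ℝ, t • v ∈ A}
  add_mem' := fun ha hb t => by rw [smul_add]; exact A.add_mem (ha t) (hb t)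
  zero_mem' := fun t => by rw [smul_zero]; exact A.zero_mem
  smul_mem' := fun c v hv t => by rw [smul_smul]; exact hv _

theorem small_mem_lines {V : Type*} [NormedAddCommGroup V] [NormedSpace ℝ V]
    [FiniteDimensional ℝ V] (A : AddSubgroup V) (hA : IsClosed (A : Set V)) :
    ∃ δ > 0, ∀ v ∈ A, ‖v‖ < δ → v ∈ lines A := by
  have : ProperSpace V := FiniteDimensional.proper ℝ V
  obtain ⟨Q, hQ⟩ := Submodule.exists_isCompl (lines A)
  set P : V →ₗ[ℝ] V := Q.subtype ∘ₗ Q.projectionOnto _ hQ.symm with hP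
  have hPc : Continuous P := P.continuous_of_finiteDimensional
  have hPQ : ∀ v, P v ∈ Q := fun v => (Q.projectionOnto _ hQ.symm v).2
  have hPl : ∀ v, v - P v ∈ lines A := fun v => by
    have h := Submodule.projectionOnto_apply_eq_zero_iff hQ.symm (x := v - P v)
    refine h.1 ?_
    have h2 : Q.projectionOnto _ hQ.symm (P v) = Q.projectionOnto _ hQ.symm v :=
      Submodule.projectionOnto_apply_left hQ.symm _
    rw [map_sub, h2, sub_self]
  by_contra! hcon
  have hseq : ∀ n : ℕ, ∃ q : V, q ∈ A ∧ q ∈ Q ∧ q ≠ 0 ∧ ‖q‖ < 1 / (n + 1 : ℝ) := fun n => by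
    have hP0 : Tendsto P (𝓝 0) (𝓝 0) := by simpa using hPc.tendsto 0
    obtain ⟨δ, hδ, h⟩ := Metric.tendsto_nhds_nhds.1 hP0 (1 / (n + 1 : ℝ)) (by positivity)
    obtain ⟨v, hvA, hvδ, hv⟩ := hcon δ hδ
    refine ⟨P v, ?_, hPQ v, ?_, ?_⟩
    · have := (hPl v) 1
      rw [one_smul] at this
      simpa using A.sub_mem hvA this
    · intro h0
      apply hv
      simpa [h0] using hPl v
    · simpa using h (by simpa using hvδ)
  choose q hqA hqQ hq0 hqn using hseq
  have hq' : Tendsto (fun n => ‖q n‖) atTop (𝓝 0) :=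
    squeeze_zero (fun _ => norm_nonneg _) (fun n => (hqn n).le)
      tendsto_one_div_add_atTop_nhds_zero_nat
  obtain ⟨u, hu, φ, hφ, hlim⟩ := (isCompact_sphere (0 : V) 1).tendsto_subseq
    (x := fun n => ‖q n‖⁻¹ • q n) (fun n => by simp [norm_smul, hq0 n])
  have huQ : u ∈ Q := (Submodule.closed_of_finiteDimensional Q).mem_of_tendsto hlim
    (Eventually.of_forall fun n => Q.smul_mem _ (hqQ _))
  have hul : u ∈ lines A := fun t => by
    have h1 : Tendsto (fun n => ((⌊t / ‖q (φ n)‖⌋ : ℤ) : ℝ) • q (φ n)) atTop (𝓝 (t • u)) := by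
      have h2 : Tendsto (fun n => ((⌊t / ‖q (φ n)‖⌋ : ℤ) : ℝ) * ‖q (φ n)‖) atTop (𝓝 t) := by
        rw [tendsto_iff_norm_sub_tendsto_zero]
        refine squeeze_zero (fun _ => norm_nonneg _) (fun n => ?_) (hq'.comp hφ.tendsto_atTop)
        have hp : 0 < ‖q (φ n)‖ := norm_pos_iff.2 (hq0 _)
        have a1 := Int.floor_le (t / ‖q (φ n)‖)
        have a2 := (Int.lt_floor_add_one (t / ‖q (φ n)‖)).le
        rw [le_div_iff₀ hp] at a1
        rw [div_le_iff₀ hp, add_mul, one_mul] at a2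
        rw [Real.norm_eq_abs, abs_le]
        constructor <;> simp only [Function.comp_apply] <;> linarith
      have := h2.smul hlim
      refine this.congr fun n => ?_
      have hp : ‖q (φ n)‖ ≠ 0 := norm_ne_zero_iff.2 (hq0 _)
      simp only [Function.comp_apply, smul_smul]
      rw [mul_assoc, mul_inv_cancel₀ hp, mul_one]
    refine hA.mem_of_tendsto h1 (Eventually.of_forall fun n => ?_)
    rw [Int.cast_smul_eq_zsmul]
    exact A.zsmul_mem (hqA _) _
  have : u = 0 := by
    have := hQ.disjoint.le_bot ⟨hul, huQ⟩
    simpa using this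
  simp [this] at hu

theorem exists_simultaneous {ι : Type*} [Fintype ι] (α : ι → ℝ) {ε : ℝ} (hε : 0 < ε) :
    ∃ k : ℕ, 0 < k ∧ ∃ w : ι → ℤ, ‖(k : ℝ) • α - fun i => (w i : ℝ)‖ < ε := by
  set x : ℕ → ι → ℝ := fun k i => Int.fract (k * α i) with hx
  obtain ⟨a, -, φ, hφ, hlim⟩ := (isCompact_Icc (a := (0 : ι → ℝ)) (b := 1)).tendsto_subseq
    (x := x) (fun n => ⟨fun i => Int.fract_nonneg _, fun i => (Int.fract_lt_one _).le⟩)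
  obtain ⟨N, hN⟩ := Metric.cauchySeq_iff.1 hlim.cauchySeq ε hε
  have h := hN (N + 1) (by omega) N le_rfl
  have hlt : φ N < φ (N + 1) := hφ (Nat.lt_succ_self N)
  refine ⟨φ (N + 1) - φ N, by omega, fun i => ⌊φ (N + 1) * α i⌋ - ⌊φ N * α i⌋, ?_⟩
  rw [dist_eq_norm] at h
  refine lt_of_eq_of_lt (congrArg norm ?_) h
  ext i
  simp only [hx, Function.comp_apply, Pi.sub_apply, Pi.smul_apply, smul_eq_mul, Int.fract]
  push_cast [Nat.cast_sub hlt.le]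
  ring

variable {E : Type*} [NormedAddCommGroup E] [NormedSpace ℂ E] [FiniteDimensional ℂ E]

theorem hom_pow {B : ℤ → E →L[ℂ] E} (h0 : B 0 = 1) (hadd : ∀ j k, B (j + k) = B j * B k)
    (j : ℤ) (k : ℕ) : B j ^ k = B (j * k) := by
  induction k with
  | zero => simp [h0]
  | succ k ih => rw [pow_succ, ih, ← hadd]; congr 1; push_cast; ring

theorem hom_inv {B : ℤ → E →L[ℂ] E} (h0 : B 0 = 1) (hadd : ∀ j k, B (j + k) = B j * B k)
    (j : ℤ) (v : E) : B (-j) (B j v) = v := by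
  rw [← mul_apply_eq_comp, ← hadd, neg_add_cancel, h0]; rfl

theorem eigen_hom {B : ℤ → E →L[ℂ] E} (h0 : B 0 = 1) (hadd : ∀ j k, B (j + k) = B j * B k)
    {u : E} {μ : ℂ} (hμ : μ ≠ 0) (hu : B 1 u = μ • u) (k : ℤ) : B k u = μ ^ k • u := by
  have hn : ∀ k : ℕ, B k u = μ ^ k • u := fun k => by
    induction k with
    | zero => simp [h0]
    | succ k ih =>
      rw [Nat.cast_succ, hadd, mul_apply_eq_comp, hu, map_smul, ih, smul_smul, pow_succ,
        mul_comm]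
  obtain ⟨n, rfl | rfl⟩ := k.eq_nat_or_neg
  · simpa using hn n
  · have := hom_inv h0 hadd (n : ℤ) u
    rw [hn, map_smul] at this
    rw [zpow_neg, zpow_natCast, ← this, smul_smul, inv_mul_cancel₀ (pow_ne_zero _ hμ), one_smul,
      this]

theorem norm_eigenvalue {B : ℤ → E →L[ℂ] E} (h0 : B 0 = 1)
    (hadd : ∀ j k, B (j + k) = B j * B k) {M : ℝ} (hM : ∀ k, ‖B k‖ ≤ M)
    {u : E} {μ : ℂ} (hu0 : u ≠ 0) (hu : B 1 u = μ • u) : ‖μ‖ = 1 := by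
  have hμ : μ ≠ 0 := by
    rintro rfl
    have := hom_inv h0 hadd 1 u
    rw [hu] at this
    simp at this
    exact hu0 this.symm
  have hb : ∀ k : ℤ, ‖μ‖ ^ k ≤ M := fun k => by
    have h1 := (B k).le_of_opNorm_le (hM k) u
    rw [eigen_hom h0 hadd hμ hu, norm_smul, norm_zpow] at h1
    exact le_of_mul_le_mul_right h1 (norm_pos_iff.2 hu0)
  have hp : ∀ c : ℝ, (∀ k : ℕ, c ^ k ≤ M) → c ≤ 1 := fun c hc => by
    by_contra! h
    obtain ⟨n, hn⟩ := pow_unbounded_of_one_lt M h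
    exact absurd (hc n) (not_le.2 hn)
  refine le_antisymm (hp _ fun k => by simpa using hb k) ?_
  have := hp ‖μ‖⁻¹ fun k => by simpa using hb (-k)
  exact (inv_le_one₀ (norm_pos_iff.2 hμ)).1 this

theorem semisimple {B : ℤ → E →L[ℂ] E} (h0 : B 0 = 1)
    (hadd : ∀ j k, B (j + k) = B j * B k) {M : ℝ} (hM : ∀ k, ‖B k‖ ≤ M)
    {w u : E} {μ : ℂ} (hw : B 1 w = μ • w + u) (hu : B 1 u = μ • u) : u = 0 := by
  by_contra hu0
  have hμ1 := norm_eigenvalue h0 hadd hM hu0 hu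
  have hn : ∀ k : ℕ, B k w = μ ^ k • w + (k * μ ^ (k - 1) : ℂ) • u := fun k => by
    induction k with
    | zero => simp [h0]
    | succ k ih =>
      have hμ0 : μ ≠ 0 := by rintro rfl; simp at hμ1
      have h2 := eigen_hom h0 hadd hμ0 hu k
      rw [Nat.cast_succ, hadd, mul_apply_eq_comp, hw, map_add, map_smul, ih, h2,
        smul_add, smul_smul, smul_smul, zpow_natCast, add_assoc, ← add_smul, pow_succ']
      congr 2
      rcases k with _ | k
      · simp
      · push_cast
        simp only [pow_succ]
        ring
  have hb : ∀ k : ℕ, k * ‖u‖ ≤ M * ‖w‖ + ‖w‖ := fun k => by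
    have h1 := (B k).le_of_opNorm_le (hM k) w
    have h2 : (k * μ ^ (k - 1) : ℂ) • u = B k w - μ ^ k • w := by rw [hn]; abel
    have h3 : ‖(k * μ ^ (k - 1) : ℂ) • u‖ = k * ‖u‖ := by
      rw [norm_smul, norm_mul, norm_pow, hμ1]; simp
    rw [← h3, h2]
    refine (norm_sub_le _ _).trans ?_
    rw [norm_smul, norm_pow, hμ1]
    simpa using h1
  obtain ⟨k, hk⟩ := exists_nat_gt ((M * ‖w‖ + ‖w‖) / ‖u‖)
  rw [div_lt_iff₀ (norm_pos_iff.2 hu0)] at hk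
  exact absurd (hb k) (not_le.2 hk)

theorem exists_eigenbasis {B : ℤ → E →L[ℂ] E} (h0 : B 0 = 1)
    (hadd : ∀ j k, B (j + k) = B j * B k) {M : ℝ} (hM : ∀ k, ‖B k‖ ≤ M) :
    ∃ (s : Set E) (_ : Fintype s) (b : Module.Basis s ℂ E) (α : s → ℝ), ∀ i,
      B 1 (b i) = Complex.exp (2 * Real.pi * Complex.I * α i) • b i := by
  set f : Module.End ℂ E := (B 1 : E →ₗ[ℂ] E) with hf
  have hgen : ∀ μ, ∀ n : ℕ, ∀ w, ((f - algebraMap ℂ _ μ) ^ n) w = 0 → f w = μ • w := by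
    intro μ n
    induction n with
    | zero => intro w hw; simp at hw; simp [hw]
    | succ n ih =>
      intro w hw
      rw [pow_succ, Module.End.mul_apply] at hw
      have h1 := ih _ hw
      have h2 := semisimple h0 hadd hM (w := w) (u := (f - algebraMap ℂ _ μ) w) (μ := μ)
        (by simp [hf]) h1
      simpa [sub_eq_zero] using h2
  set S : Set E := {v | v ≠ 0 ∧ ∃ μ : ℂ, f v = μ • v} with hS
  have hspan : Submodule.span ℂ S = ⊤ := by
    rw [eq_top_iff, ← Module.End.iSup_maxGenEigenspace_eq_top f]
    refine iSup_le fun μ w hw => ?_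
    obtain ⟨n, hn⟩ := (Module.End.mem_maxGenEigenspace f μ w).1 hw
    by_cases hw0 : w = 0
    · simp [hw0]
    · exact Submodule.subset_span ⟨hw0, μ, hgen μ n w hn⟩
  obtain ⟨s, hsS, hs, hli⟩ := exists_linearIndependent ℂ S
  have hfin : Finite s := hli.finite
  have : Fintype s := Fintype.ofFinite s
  set b : Module.Basis s ℂ E := Module.Basis.mk hli (by
    rw [Subtype.range_coe, hs, hspan]) with hb
  have hev : ∀ i : s, ∃ a : ℝ, B 1 (b i) = Complex.exp (2 * Real.pi * Complex.I * a) • b i := by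
    intro i
    obtain ⟨hi0, μ, hμ⟩ := hsS i.2
    have hbi : b i = i := by simp [hb]
    have hn := norm_eigenvalue h0 hadd hM hi0 hμ
    refine ⟨μ.arg / (2 * Real.pi), ?_⟩
    rw [hbi]
    have : Complex.exp (2 * Real.pi * Complex.I * ((μ.arg / (2 * Real.pi) : ℝ) : ℂ)) = μ := by
      have h1 := Complex.norm_mul_exp_arg_mul_I μ
      rw [hn, Complex.ofReal_one, one_mul] at h1
      have : (Real.pi : ℂ) ≠ 0 := by exact_mod_cast Real.pi_ne_zero
      refine Eq.trans (congrArg Complex.exp ?_) h1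
      push_cast
      field_simp
    rw [this]
    exact hμ
  choose α hα using hev
  exact ⟨s, this, b, α, hα⟩

theorem exists_torsion {B : ℤ → E →L[ℂ] E} (h0 : B 0 = 1)
    (hadd : ∀ j k, B (j + k) = B j * B k) {M : ℝ} (hM : ∀ k, ‖B k‖ ≤ M) {ε : ℝ} (hε : 0 < ε) :
    ∃ B' ∈ closure (range B), ‖B' - B 1‖ < ε ∧ ∃ m : ℕ, 0 < m ∧ B' ^ m = 1 := by
  obtain ⟨s, _, b, α, hα⟩ := exists_eigenbasis h0 hadd hM
  set e : (s → ℝ) → s → ℂ := fun v i => Complex.exp (2 * Real.pi * Complex.I * v i) with he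
  have headd : ∀ v w i, e (v + w) i = e v i * e w i := fun v w i => by
    simp only [he, Pi.add_apply]
    rw [← Complex.exp_add]
    congr 1
    push_cast
    ring
  set Φ : (s → ℝ) → E →L[ℂ] E := fun v => ∑ i, e v i •
    (LinearMap.toContinuousLinearMap (b.coord i)).smulRight (b i) with hΦ
  have hΦb : ∀ v i, Φ v (b i) = e v i • b i := fun v i => by
    simp only [hΦ, sum_apply, smul_apply]
    rw [Finset.sum_eq_single i]
    · simp
    · intro j _ hj
      simp [Finsupp.single_eq_of_ne hj]
    · simp
  have hext : ∀ T T' : E →L[ℂ] E, (∀ i, T (b i) = T' (b i)) → T = T' := fun T T' h => by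
    apply ContinuousLinearMap.coe_injective
    exact b.ext h
  have hΦadd : ∀ v w, Φ (v + w) = Φ v * Φ w := fun v w => hext _ _ fun i => by
    rw [mul_apply_eq_comp, hΦb, hΦb, map_smul, hΦb, smul_smul, headd, mul_comm]
  have hΦint : ∀ w : s → ℤ, Φ (fun i => (w i : ℝ)) = 1 := fun w => hext _ _ fun i => by
    rw [hΦb]
    simp only [he]
    have : Complex.exp (2 * Real.pi * Complex.I * ((w i : ℝ) : ℂ)) = 1 :=
      Complex.exp_eq_one_iff.2 ⟨w i, by push_cast; ring⟩
    rw [this, one_smul]; rfl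
  have hΦ0 : Φ 0 = 1 := (congrArg Φ (by ext; simp)).trans (hΦint 0)
  have hΦα : Φ α = B 1 := hext _ _ fun i => by rw [hΦb, hα]
  have hΦnat : ∀ (k : ℕ) v, Φ ((k : ℝ) • v) = Φ v ^ k := fun k v => by
    induction k with
    | zero => simp [hΦ0]
    | succ k ih => rw [Nat.cast_succ, add_smul, one_smul, hΦadd, ih, pow_succ]
  have hΦc : Continuous Φ := by
    refine continuous_finsetSum _ fun i _ => ?_
    have : Continuous fun v : s → ℝ => e v i := by simp only [he]; fun_prop
    exact this.smul continuous_const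
  have hclmul : ∀ S ∈ closure (range B), ∀ T ∈ closure (range B), S * T ∈ closure (range B) :=
    fun S hS T hT => map_mem_closure₂ (f := fun S T : E →L[ℂ] E => S * T) continuous_mul hS hT
      (by rintro _ ⟨j, rfl⟩ _ ⟨k, rfl⟩; exact ⟨j + k, hadd j k⟩)
  have hneg : ∀ v, Φ v ∈ closure (range B) → Φ (-v) ∈ closure (range B) := fun v hv => by
    obtain ⟨u, hu, hlim⟩ := mem_closure_iff_seq_limit.1 hv
    choose k hk using hu
    have hinv : Φ (-v) * Φ v = 1 := by rw [← hΦadd, neg_add_cancel, hΦ0]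
    refine mem_closure_iff_seq_limit.2 ⟨fun n => B (-k n), fun n => ⟨_, rfl⟩, ?_⟩
    rw [tendsto_iff_norm_sub_tendsto_zero]
    have h1 : ∀ n, B (-k n) - Φ (-v) = Φ (-v) * (Φ v - u n) * B (-k n) := fun n => by
      have h2 : u n * B (-k n) = 1 := by rw [← hk, ← hadd, add_neg_cancel, h0]
      rw [mul_sub, sub_mul, hinv, one_mul, mul_assoc, h2, mul_one]
    have h3 : Tendsto (fun n => ‖Φ (-v)‖ * ‖Φ v - u n‖ * M) atTop (𝓝 0) := by
      have : Tendsto (fun n => ‖Φ v - u n‖) atTop (𝓝 0) := by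
        simpa using (tendsto_const_nhds (x := Φ v).sub hlim).norm
      simpa using (this.const_mul ‖Φ (-v)‖).mul_const M
    refine squeeze_zero (fun _ => norm_nonneg _) (fun n => ?_) h3
    rw [h1]
    refine (norm_mul_le _ _).trans ?_
    exact mul_le_mul (norm_mul_le _ _) (hM _) (norm_nonneg _) (by positivity)
  set A : AddSubgroup (s → ℝ) :=
    { carrier := Φ ⁻¹' closure (range B)
      add_mem' := fun {v w} hv hw => by
        rw [mem_preimage, hΦadd]; exact hclmul _ hv _ hw
      zero_mem' := by
        rw [mem_preimage, hΦ0, ← h0]; exact subset_closure ⟨0, rfl⟩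
      neg_mem' := fun {v} hv => hneg v hv } with hA
  have hAc : IsClosed (A : Set (s → ℝ)) := isClosed_closure.preimage hΦc
  obtain ⟨δ, hδ, hline⟩ := small_mem_lines A hAc
  obtain ⟨η, hη, hcont⟩ := Metric.continuousAt_iff.1 (hΦc.continuousAt (x := α)) ε hε
  obtain ⟨k, hk, w, hw⟩ := exists_simultaneous α (lt_min hδ hη)
  set v : s → ℝ := (k : ℝ) • α - fun i => (w i : ℝ) with hv
  have hαA : α ∈ A := by
    change Φ α ∈ closure (range B)
    rw [hΦα]; exact subset_closure ⟨1, rfl⟩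
  have hwA : (fun i => (w i : ℝ)) ∈ A := by
    change Φ _ ∈ closure (range B)
    rw [hΦint, ← h0]; exact subset_closure ⟨0, rfl⟩
  have hvA : v ∈ A := by
    refine A.sub_mem ?_ hwA
    rw [Nat.cast_smul_eq_nsmul]
    exact A.nsmul_mem hαA k
  have hvl := hline v hvA (hw.trans_le (min_le_left _ _)) (k : ℝ)⁻¹
  have hk0 : (k : ℝ) ≠ 0 := by positivity
  have hk1 : (1 : ℝ) ≤ k := by exact_mod_cast hk
  refine ⟨Φ (α - (k : ℝ)⁻¹ • v), A.sub_mem hαA hvl, ?_, k, hk, ?_⟩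
  · rw [← hΦα, ← dist_eq_norm]
    apply hcont
    rw [dist_eq_norm, sub_sub_cancel_left, norm_neg, norm_smul, norm_inv, Real.norm_natCast]
    have : (k : ℝ)⁻¹ ≤ 1 := inv_le_one_of_one_le₀ hk1
    calc (k : ℝ)⁻¹ * ‖v‖ ≤ 1 * ‖v‖ := by gcongr
      _ < η := by rw [one_mul]; exact hw.trans_le (min_le_right _ _)
  · rw [← hΦnat, smul_sub, smul_smul, mul_inv_cancel₀ hk0, one_smul, hv, sub_sub_cancel]
    exact hΦint w

end Torsion

end

section

/-- A permutation of the ambient space that is a holomorphic automorphism of `D` and is the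
identity off `D`. -/
structure IsAut {E : Type*} [NormedAddCommGroup E] [NormedSpace ℂ E] (D : Set E)
    (F : Equiv.Perm E) : Prop where
  mem_iff : ∀ x, F x ∈ D ↔ x ∈ D
  holo : DifferentiableOn ℂ F D
  holo_inv : DifferentiableOn ℂ (F⁻¹ : Equiv.Perm E) D
  off : ∀ x, x ∉ D → F x = x

namespace IsAut

variable {E : Type*} [NormedAddCommGroup E] [NormedSpace ℂ E] {D : Set E} {F F' : Equiv.Perm E}

theorem one : IsAut D (1 : Equiv.Perm E) :=
  ⟨fun _ => Iff.rfl, differentiableOn_id, by rw [inv_one]; exact differentiableOn_id,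
    fun _ _ => rfl⟩

theorem inv (h : IsAut D F) : IsAut D F⁻¹ := by
  refine ⟨fun x => ?_, h.holo_inv, by rw [inv_inv]; exact h.holo, fun x hx => ?_⟩
  · rw [← h.mem_iff, show F (F⁻¹ x) = x from F.apply_symm_apply x]
  · rw [Equiv.Perm.inv_eq_iff_eq]
    exact (h.off x hx).symm

theorem mul (h : IsAut D F) (h' : IsAut D F') : IsAut D (F * F') := by
  refine ⟨fun x => ?_, ?_, ?_, fun x hx => ?_⟩
  · rw [Equiv.Perm.mul_apply, h.mem_iff, h'.mem_iff]
  · rw [Equiv.Perm.coe_mul]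
    exact h.holo.comp h'.holo fun x hx => (h'.mem_iff x).2 hx
  · rw [mul_inv_rev, Equiv.Perm.coe_mul]
    exact h'.holo_inv.comp h.holo_inv fun x hx => (h.inv.mem_iff x).2 hx
  · rw [Equiv.Perm.mul_apply, h'.off x hx, h.off x hx]

theorem pow (h : IsAut D F) (k : ℕ) : IsAut D (F ^ k) := by
  induction k with
  | zero => rw [pow_zero]; exact one
  | succ k ih => rw [pow_succ]; exact ih.mul h

theorem zpow (h : IsAut D F) (k : ℤ) : IsAut D (F ^ k) := by
  obtain ⟨n, rfl | rfl⟩ := k.eq_nat_or_neg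
  · rw [zpow_natCast]; exact h.pow n
  · rw [zpow_neg, zpow_natCast]; exact (h.pow n).inv

theorem zpow_fix {x : E} (hx : F x = x) (k : ℤ) : (F ^ k) x = x :=
  Equiv.Perm.zpow_apply_eq_self_of_apply_eq_self hx k

theorem ext_on (h : IsAut D F) (h' : IsAut D F') (he : ∀ x ∈ D, F x = F' x) : F = F' := by
  ext x
  by_cases hx : x ∈ D
  · exact he x hx
  · rw [h.off x hx, h'.off x hx]

theorem fderiv_mul (hD : IsOpen D) (h : IsAut D F) (h' : IsAut D F') {x : E} (hx : x ∈ D) :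
    fderiv ℂ (F * F' : Equiv.Perm E) x = (fderiv ℂ F (F' x)).comp (fderiv ℂ F' x) := by
  rw [Equiv.Perm.coe_mul]
  exact fderiv_comp x (h.holo.differentiableAt (hD.mem_nhds ((h'.mem_iff x).2 hx)))
    (h'.holo.differentiableAt (hD.mem_nhds hx))

/-- The derivatives of the iterates at a fixed point. -/
def jac (F : Equiv.Perm E) (p : E) (k : ℤ) : E →L[ℂ] E := fderiv ℂ (F ^ k : Equiv.Perm E) p

theorem jac_zero (p : E) : jac F p 0 = 1 := by
  rw [jac, zpow_zero]; exact fderiv_id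

theorem jac_add (hD : IsOpen D) (h : IsAut D F) {p : E} (hp : p ∈ D) (hF : F p = p) (j k : ℤ) :
    jac F p (j + k) = jac F p j * jac F p k := by
  rw [jac, zpow_add, fderiv_mul hD (h.zpow j) (h.zpow k) hp, zpow_fix hF]
  rfl

theorem jac_one (p : E) : jac F p 1 = fderiv ℂ F p := by rw [jac, zpow_one]

variable [FiniteDimensional ℂ E] {R : ℝ}

theorem lipschitz (hD : IsOpen D) (hR : ∀ x ∈ D, ‖x‖ ≤ R) {z : E} (hz : z ∈ D) :
    ∃ r > 0, ∃ L > 0, closedBall z r ⊆ D ∧ ∀ F, IsAut D F →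
      ∀ w ∈ closedBall z r, ∀ w' ∈ closedBall z r, ‖F w - F w'‖ ≤ L * ‖w - w'‖ := by
  have : CompleteSpace E := FiniteDimensional.complete ℂ E
  obtain ⟨ε, hε, hsub⟩ := Metric.isOpen_iff.1 hD z hz
  have hR0 : 0 ≤ R := (norm_nonneg z).trans (hR z hz)
  refine ⟨ε / 4, by positivity, 2 * R / (ε / 4 * 3) + 1, by positivity,
    (closedBall_subset_ball (by linarith)).trans hsub, fun F hF w hw w' hw' => ?_⟩
  have hs : ball w' (ε / 4 * 3) ⊆ D := by
    refine (ball_subset_ball' ?_).trans hsub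
    linarith [mem_closedBall.1 hw']
  have hww : w ∈ ball w' (ε / 4 * 3) := by
    rw [mem_ball]
    linarith [dist_triangle_right w w' z, mem_closedBall.1 hw, mem_closedBall.1 hw']
  have h1 := (Holo.ball_estimates (hF.holo.mono hs)
    (fun x hx => hR _ ((hF.mem_iff x).2 (hs hx))) hww).1
  refine h1.trans ?_
  gcongr
  linarith

theorem jac_bounded (hD : IsOpen D) (hR : ∀ x ∈ D, ‖x‖ ≤ R) (h : IsAut D F) {p : E}
    (hp : p ∈ D) : ∃ M, ∀ k, ‖jac F p k‖ ≤ M := by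
  have : CompleteSpace E := FiniteDimensional.complete ℂ E
  obtain ⟨r, hr, hsub⟩ := Metric.isOpen_iff.1 hD p hp
  exact ⟨2 * R / r, fun k => Holo.norm_fderiv_le hr ((norm_nonneg p).trans (hR p hp))
    ((h.zpow k).holo.mono hsub) fun w hw => hR _ (((h.zpow k).mem_iff w).2 (hsub hw))⟩

theorem orbit_compact (hD : IsOpen D) (hc : IsPreconnected D) (hR : ∀ x ∈ D, ‖x‖ ≤ R)
    (h : IsAut D F) {p : E} (hp : p ∈ D) (hF : F p = p) {x : E} (hx : x ∈ D) :
    ∃ K, IsCompact K ∧ K ⊆ D ∧ ∀ k : ℤ, (F ^ k) x ∈ K := by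
  have : ProperSpace E := FiniteDimensional.proper ℂ E
  set S : Set E := {x | x ∈ D ∧ ∃ K, IsCompact K ∧ K ⊆ D ∧ ∀ k : ℤ, (F ^ k) x ∈ K} with hS
  have hSo : IsOpen S := by
    rw [Metric.isOpen_iff]
    rintro x ⟨hx, K, hK, hKD, hxK⟩
    obtain ⟨r, hr, L, hL, hrD, hlip⟩ := lipschitz hD hR hx
    obtain ⟨δ, hδ, hδD⟩ := hK.exists_cthickening_subset_open hD hKD
    refine ⟨min r (δ / L), lt_min hr (by positivity), fun w hw => ?_⟩
    have hwr : w ∈ closedBall x r := (ball_subset_closedBall.trans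
      (closedBall_subset_closedBall (min_le_left _ _))) hw
    refine ⟨hrD hwr, cthickening δ K, hK.cthickening, hδD, fun k => ?_⟩
    refine mem_cthickening_of_dist_le _ _ _ _ (hxK k) ?_
    rw [dist_eq_norm]
    refine (hlip _ (h.zpow k) w hwr x (mem_closedBall_self hr.le)).trans ?_
    have h1 : ‖w - x‖ < δ / L := (mem_ball_iff_norm.1 hw).trans_le (min_le_right _ _)
    rw [lt_div_iff₀ hL] at h1
    linarith
  have hsub : D ⊆ S := by
    refine hc.subset_of_closure_inter_subset hSo
      ⟨p, hp, hp, {p}, isCompact_singleton, by simpa using hp, fun k => by simp [zpow_fix hF]⟩ ?_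
    rintro y ⟨hyS, hyD⟩
    obtain ⟨r, hr, L, hL, hrD, hlip⟩ := lipschitz hD hR hyD
    obtain ⟨x, ⟨hxD, K, hK, hKD, hxK⟩, hxy⟩ :=
      Metric.mem_closure_iff.1 hyS (min r (r / (8 * L))) (lt_min hr (by positivity))
    have hxr : x ∈ closedBall y r := by
      rw [mem_closedBall, dist_comm]; exact (hxy.trans_le (min_le_left _ _)).le
    have hclose : ∀ k : ℤ, ‖(F ^ k) x - (F ^ k) y‖ ≤ r / 8 := fun k => by
      refine (hlip _ (h.zpow k) x hxr y (mem_closedBall_self hr.le)).trans ?_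
      rw [dist_comm, dist_eq_norm] at hxy
      have := hxy.le.trans (min_le_right _ _)
      rw [le_div_iff₀ (by positivity)] at this
      linarith
    have key : ∃ K', IsCompact K' ∧ K' ⊆ D ∧ ∀ k : ℤ, (F ^ k) x ∈ K → (F ^ k) y ∈ K' := by
      refine hK.induction_on (p := fun s => ∃ K', IsCompact K' ∧ K' ⊆ D ∧
        ∀ k : ℤ, (F ^ k) x ∈ s → (F ^ k) y ∈ K') ?_ ?_ ?_ ?_
      · exact ⟨∅, isCompact_empty, empty_subset _, fun k hk => hk.elim⟩
      · rintro s t hst ⟨K', h1, h2, h3⟩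
        exact ⟨K', h1, h2, fun k hk => h3 k (hst hk)⟩
      · rintro s t ⟨K₁, h1, h2, h3⟩ ⟨K₂, h4, h5, h6⟩
        exact ⟨K₁ ∪ K₂, h1.union h4, union_subset h2 h5, fun k hk =>
          hk.elim (fun hk => Or.inl (h3 k hk)) (fun hk => Or.inr (h6 k hk))⟩
      · intro x' hx'
        obtain ⟨r', hr', L', hL', hrD', hlip'⟩ := lipschitz hD hR (hKD hx')
        refine ⟨ball x' (min r' (r / (8 * L'))), mem_nhdsWithin_of_mem_nhds
          (ball_mem_nhds _ (lt_min hr' (by positivity))), ?_⟩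
        by_cases hex : ∃ j : ℤ, (F ^ j) x ∈ ball x' (min r' (r / (8 * L')))
        · obtain ⟨j, hj⟩ := hex
          refine ⟨(F ^ j) '' closedBall y r, (isCompact_closedBall y r).image_of_continuousOn
            ((h.zpow j).holo.continuousOn.mono hrD), ?_, fun k hk => ?_⟩
          · rintro _ ⟨w, hw, rfl⟩
            exact ((h.zpow j).mem_iff w).2 (hrD hw)
          · have hm : ∀ {u}, u ∈ ball x' (min r' (r / (8 * L'))) → u ∈ closedBall x' r' :=
              fun hu => (ball_subset_closedBall.trans
                (closedBall_subset_closedBall (min_le_left _ _))) hu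
            have h1 := hlip' _ (h.zpow (-j)) _ (hm hk) _ (hm hj)
            have h2 : ‖(F ^ k) x - (F ^ j) x‖ ≤ r / (4 * L') := by
              rw [← dist_eq_norm]
              have a1 := (mem_ball.1 hk).le.trans (min_le_right _ _)
              have a2 := (mem_ball.1 hj).le.trans (min_le_right _ _)
              have a3 : r / (4 * L') = r / (8 * L') + r / (8 * L') := by field_simp; norm_num
              linarith [dist_triangle_right ((F ^ k) x) ((F ^ j) x) x']
            rw [le_div_iff₀ (by positivity)] at h2
            rw [← Equiv.Perm.mul_apply, ← Equiv.Perm.mul_apply, ← zpow_add, ← zpow_add,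
              neg_add_cancel, zpow_zero, Equiv.Perm.one_apply] at h1
            refine ⟨(F ^ (-j + k)) y, ?_, ?_⟩
            · have h3 := hclose (-j + k)
              have h4 : ‖x - y‖ ≤ r / 8 := by simpa using hclose 0
              rw [mem_closedBall, dist_eq_norm]
              have h5 : (F ^ (-j + k)) y - y = ((F ^ (-j + k)) x - x) -
                ((F ^ (-j + k)) x - (F ^ (-j + k)) y) + (x - y) := by abel
              rw [h5]
              refine (norm_add_le _ _).trans ?_
              linarith [norm_sub_le ((F ^ (-j + k)) x - x) ((F ^ (-j + k)) x - (F ^ (-j + k)) y)]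
            · rw [← Equiv.Perm.mul_apply, ← zpow_add]
              congr 2
              ring_nf
        · exact ⟨∅, isCompact_empty, empty_subset _, fun k hk => (hex ⟨k, hk⟩).elim⟩
    obtain ⟨K', h1, h2, h3⟩ := key
    exact ⟨hyD, K', h1, h2, fun k => h3 k (hxK k)⟩
  exact (hsub hx).2

end IsAut

end

section

namespace IsAut

variable {E : Type*} [NormedAddCommGroup E] [NormedSpace ℂ E] [FiniteDimensional ℂ E]
  {D : Set E} {F : Equiv.Perm E} {R : ℝ} {p : E}

theorem exists_linearization (hD : IsOpen D) (hR : ∀ x ∈ D, ‖x‖ ≤ R) (h : IsAut D F)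
    (hp : p ∈ D) (hF : F p = p) :
    ∃ φ : E → E, DifferentiableOn ℂ φ D ∧ φ p = 0 ∧ fderiv ℂ φ p = ContinuousLinearMap.id ℂ E ∧
      ∀ z ∈ D, φ (F z) = fderiv ℂ F p (φ z) := by
  obtain ⟨M, hM⟩ := jac_bounded hD hR h hp
  have hM0 : 0 ≤ M := (norm_nonneg _).trans (hM 0)
  have hR0 : 0 ≤ R := (norm_nonneg p).trans (hR p hp)
  set a : ℕ → E → E := fun j z => jac F p (-j) ((F ^ (j : ℤ)) z - p) with ha
  have had : ∀ j, DifferentiableOn ℂ (a j) D := fun j =>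
    (jac F p (-j)).differentiable.comp_differentiableOn (((h.zpow j).holo).sub_const p)
  have hab : ∀ j, ∀ z ∈ D, ‖a j z‖ ≤ M * (R + R) := fun j z hz => by
    refine ((jac F p (-j)).le_of_opNorm_le (hM _) _).trans ?_
    gcongr
    exact (norm_sub_le _ _).trans (add_le_add (hR _ (((h.zpow j).mem_iff z).2 hz)) (hR p hp))
  have hafd : ∀ j, HasFDerivAt (a j) (ContinuousLinearMap.id ℂ E) p := fun j => by
    have h1 : HasFDerivAt (fun z => (F ^ (j : ℤ)) z - p) (jac F p j) p :=
      (((h.zpow j).holo.differentiableAt (hD.mem_nhds hp)).hasFDerivAt).sub_const p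
    have h2 := (jac F p (-j)).hasFDerivAt.comp p h1
    have h3 : (jac F p (-j)).comp (jac F p j) = ContinuousLinearMap.id ℂ E := by
      change jac F p (-j) * jac F p j = _
      rw [← jac_add hD h hp hF, neg_add_cancel, jac_zero]; rfl
    rwa [h3] at h2
  have hastep : ∀ j, ∀ z, a j (F z) = fderiv ℂ F p (a (j + 1) z) := fun j z => by
    simp only [ha]
    rw [← jac_one, ← ContinuousLinearMap.comp_apply]
    change _ = (jac F p 1 * jac F p (-((j + 1 : ℕ) : ℤ))) _
    rw [← jac_add hD h hp hF]
    have e1 : (1 : ℤ) + -((j + 1 : ℕ) : ℤ) = -j := by push_cast; ring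
    have e2 : (F ^ ((j + 1 : ℕ) : ℤ)) z = (F ^ (j : ℤ)) (F z) := by
      rw [Nat.cast_succ, zpow_add_one, Equiv.Perm.mul_apply]
    rw [e1, e2]
  set A : ℕ → E → E := fun n z => ((n + 1 : ℝ)⁻¹ : ℂ) • ∑ j ∈ Finset.range (n + 1), a j z with hA
  have hcoef : ∀ n : ℕ, ‖((n + 1 : ℝ)⁻¹ : ℂ)‖ * (n + 1) = 1 := fun n => by
    have : (0 : ℝ) < n + 1 := by positivity
    rw [norm_inv, Complex.norm_real, Real.norm_of_nonneg this.le, inv_mul_cancel₀ this.ne']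
  have hAd : ∀ n, DifferentiableOn ℂ (A n) D := fun n =>
    (DifferentiableOn.fun_sum fun j _ => had j).const_smul _
  have hAb : ∀ n, ∀ z ∈ D, ‖A n z‖ ≤ M * (R + R) := fun n z hz => by
    simp only [hA]
    rw [norm_smul]
    have h1 : ‖∑ j ∈ Finset.range (n + 1), a j z‖ ≤ (n + 1) * (M * (R + R)) := by
      refine (norm_sum_le_of_le _ fun j _ => hab j z hz).trans (le_of_eq ?_)
      simp
    calc _ ≤ ‖((n + 1 : ℝ)⁻¹ : ℂ)‖ * ((n + 1) * (M * (R + R))) := by gcongr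
      _ = M * (R + R) := by rw [← mul_assoc, hcoef, one_mul]
  obtain ⟨φ, hφd, hφ⟩ := Holo.exists_ultralimit (hyperfilter ℕ) hD hAd hAb
  have hAp : ∀ n, A n p = 0 := fun n => by
    simp only [hA, ha, zpow_fix hF, sub_self, map_zero, Finset.sum_const_zero, smul_zero]
  have hAfd : ∀ n, fderiv ℂ (A n) p = ContinuousLinearMap.id ℂ E := fun n => by
    have h1 : HasFDerivAt (A n) (((n + 1 : ℝ)⁻¹ : ℂ) •
        ∑ j ∈ Finset.range (n + 1), ContinuousLinearMap.id ℂ E) p :=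
      (HasFDerivAt.fun_sum fun j _ => hafd j).const_smul _
    rw [h1.fderiv, Finset.sum_const, Finset.card_range, ← Nat.cast_smul_eq_nsmul ℂ, smul_smul]
    have : (((n + 1 : ℝ) : ℂ)⁻¹ * ((n + 1 : ℕ) : ℂ)) = 1 := by
      have : ((n : ℂ) + 1) ≠ 0 := Nat.cast_add_one_ne_zero n
      push_cast
      exact inv_mul_cancel₀ this
    rw [this, one_smul]
  have hAF : ∀ n, ∀ z ∈ D, ‖A n (F z) - fderiv ℂ F p (A n z)‖ ≤
      1 / (n + 1 : ℝ) * (M * (M * (R + R) + M * (R + R))) := fun n z hz => by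
    have e : A n (F z) - fderiv ℂ F p (A n z) =
        ((n + 1 : ℝ)⁻¹ : ℂ) • fderiv ℂ F p (a (n + 1) z - a 0 z) := by
      simp only [hA, map_smul, map_sum, hastep, ← smul_sub]
      rw [Finset.sum_range_succ, Finset.sum_range_succ', map_sub]
      congr 1
      abel
    rw [e, norm_smul, norm_inv, Complex.norm_real, Real.norm_of_nonneg (by positivity), one_div,
      ← jac_one]
    gcongr
    refine ((jac F p 1).le_of_opNorm_le (hM _) _).trans ?_
    gcongr
    exact (norm_sub_le _ _).trans (add_le_add (hab _ z hz) (hab _ z hz))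
  refine ⟨φ, hφd, ?_, ?_, fun z hz => ?_⟩
  · have := (hφ p hp).1
    simp only [hAp] at this
    exact (tendsto_nhds_unique this tendsto_const_nhds)
  · have := (hφ p hp).2
    simp only [hAfd] at this
    exact (tendsto_nhds_unique this tendsto_const_nhds)
  · have h1 := (hφ _ ((h.mem_iff z).2 hz)).1.sub
      (((fderiv ℂ F p).continuous.tendsto _).comp (hφ z hz).1)
    have h2 : Tendsto (fun n : ℕ => 1 / (n + 1 : ℝ) * (M * (M * (R + R) + M * (R + R))))
        (hyperfilter ℕ : Filter ℕ) (𝓝 0) := by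
      have := (tendsto_one_div_add_atTop_nhds_zero_nat (𝕜 := ℝ)).mul_const
        (M * (M * (R + R) + M * (R + R)))
      rw [zero_mul] at this
      exact this.mono_left Nat.hyperfilter_le_atTop
    have h3 := squeeze_zero_norm (fun n => hAF n z hz) h2
    exact sub_eq_zero.1 (tendsto_nhds_unique h1 h3)

/-- Near the base point a linearization is injective. -/
theorem exists_injOn {φ : E → E} (hD : IsOpen D) (hp : p ∈ D) (hφ : DifferentiableOn ℂ φ D)
    (hφp : fderiv ℂ φ p = ContinuousLinearMap.id ℂ E) :
    ∃ r > 0, closedBall p r ⊆ D ∧ InjOn φ (closedBall p r) := by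
  have : CompleteSpace E := FiniteDimensional.complete ℂ E
  have hs := Holo.hasStrictFDerivAt hD hφ hp
  rw [hφp, ← ContinuousLinearEquiv.coe_refl] at hs
  set e := hs.toOpenPartialHomeomorph φ
  have h1 : e.source ∩ D ∈ 𝓝 p :=
    inter_mem (e.open_source.mem_nhds hs.mem_toOpenPartialHomeomorph_source) (hD.mem_nhds hp)
  obtain ⟨r, hr, hsub⟩ := Metric.nhds_basis_closedBall.mem_iff.1 h1
  exact ⟨r, hr, hsub.trans inter_subset_right, fun x hx y hy hxy =>
    e.injOn (hsub hx).1 (hsub hy).1 hxy⟩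

theorem tendsto_id (hD : IsOpen D) (hc : IsPreconnected D) (hR : ∀ x ∈ D, ‖x‖ ≤ R)
    (h : IsAut D F) (hp : p ∈ D) (hF : F p = p) {ι : Type*} {l : Filter ι} {n : ι → ℤ}
    (hn : Tendsto (fun i => jac F p (n i)) l (𝓝 1)) {z : E} (hz : z ∈ D) :
    Tendsto (fun i => (F ^ n i) z) l (𝓝 z) := by
  have : CompleteSpace E := FiniteDimensional.complete ℂ E
  rw [tendsto_iff_ultrafilter]
  intro U hU
  obtain ⟨H, hHd, hH⟩ := Holo.exists_ultralimit U hD (fun i => (h.zpow (n i)).holo)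
    (fun i z hz => hR _ (((h.zpow (n i)).mem_iff z).2 hz))
  obtain ⟨φ, hφd, hφ0, hφ1, hφF⟩ := exists_linearization hD hR h hp hF
  have hφit : ∀ k : ℤ, ∀ z ∈ D, φ ((F ^ k) z) = jac F p k (φ z) := by
    have hnat : ∀ k : ℕ, ∀ z ∈ D, φ ((F ^ (k : ℤ)) z) = jac F p k (φ z) := fun k => by
      induction k with
      | zero => intro z _; simp [jac_zero]
      | succ k ih =>
        intro z hz
        rw [Nat.cast_succ, zpow_add_one, Equiv.Perm.mul_apply, ih _ ((h.mem_iff z).2 hz), hφF z hz,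
          jac_add hD h hp hF, jac_one]
        rfl
    intro k z hz
    obtain ⟨m, rfl | rfl⟩ := k.eq_nat_or_neg
    · exact hnat m z hz
    · have h1 := hnat m _ (((h.zpow (-m)).mem_iff z).2 hz)
      rw [← Equiv.Perm.mul_apply, ← zpow_add, add_neg_cancel, zpow_zero, Equiv.Perm.one_apply] at h1
      rw [h1]
      change _ = (jac F p (-m) * jac F p m) _
      rw [← jac_add hD h hp hF, neg_add_cancel, jac_zero]; rfl
  obtain ⟨r, hr, hrD, hinj⟩ := exists_injOn hD hp hφd hφ1
  obtain ⟨r', hr', L, hL, hrD', hlip⟩ := lipschitz hD hR hp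
  have hnear : H =ᶠ[𝓝 p] id := by
    have hs : 0 < min (min r r') (r / L) := lt_min (lt_min hr hr') (by positivity)
    filter_upwards [closedBall_mem_nhds p hs] with w hw
    have hwr : w ∈ closedBall p r :=
      closedBall_subset_closedBall ((min_le_left _ _).trans (min_le_left _ _)) hw
    have hwr' : w ∈ closedBall p r' :=
      closedBall_subset_closedBall ((min_le_left _ _).trans (min_le_right _ _)) hw
    have hwD := hrD hwr
    have hstay : ∀ i, (F ^ n i) w ∈ closedBall p r := fun i => by
      have h1 := hlip _ (h.zpow (n i)) w hwr' p (mem_closedBall_self hr'.le)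
      rw [zpow_fix hF] at h1
      have h2 : ‖w - p‖ ≤ r / L := by
        rw [← dist_eq_norm]; exact (mem_closedBall.1 hw).trans (min_le_right _ _)
      rw [le_div_iff₀ hL] at h2
      rw [mem_closedBall, dist_eq_norm]
      linarith
    have hlim := (hH w hwD).1
    have hHr : H w ∈ closedBall p r :=
      isClosed_closedBall.mem_of_tendsto hlim (Eventually.of_forall hstay)
    refine hinj hHr hwr ?_
    have h1 : Tendsto (fun i => φ ((F ^ n i) w)) U (𝓝 (φ (H w))) :=
      ((hφd.differentiableAt (hD.mem_nhds (hrD hHr))).continuousAt.tendsto).comp hlim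
    have h2 : Tendsto (fun i => jac F p (n i) (φ w)) U (𝓝 ((1 : E →L[ℂ] E) (φ w))) :=
      ((ContinuousLinearMap.apply ℂ E (φ w)).continuous.tendsto (1 : E →L[ℂ] E)).comp
        (hn.mono_left hU)
    simp only [hφit _ w hwD] at h1
    exact tendsto_nhds_unique h1 h2
  have he := Holo.eqOn_of_eventuallyEq hD hc hHd differentiableOn_id hp hnear hz
  have := (hH z hz).1
  rwa [he] at this

theorem fderiv_sub_one_injective (hD : IsOpen D) (hR : ∀ x ∈ D, ‖x‖ ≤ R) (h : IsAut D F)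
    (hp : p ∈ D) (hF : F p = p) (hiso : ∀ᶠ z in 𝓝[≠] p, F z ≠ z) {v : E}
    (hv : fderiv ℂ F p v = v) : v = 0 := by
  have : CompleteSpace E := FiniteDimensional.complete ℂ E
  by_contra hv0
  obtain ⟨φ, hφd, hφ0, hφ1, hφF⟩ := exists_linearization hD hR h hp hF
  obtain ⟨r, hr, hrD, hinj⟩ := exists_injOn hD hp hφd hφ1
  have hs := Holo.hasStrictFDerivAt hD hφd hp
  rw [hφ1, ← ContinuousLinearEquiv.coe_refl] at hs
  have hFc : ContinuousAt F p := (h.holo.differentiableAt (hD.mem_nhds hp)).continuousAt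
  rw [ContinuousAt, hF] at hFc
  have hb : ∀ᶠ z in 𝓝 p, z ∈ closedBall p r := closedBall_mem_nhds p hr
  have hev : ∀ᶠ z in 𝓝 p, F z ∈ closedBall p r ∧ z ∈ closedBall p r ∧ (z ≠ p → F z ≠ z) :=
    (hFc.eventually (closedBall_mem_nhds p hr)).and (hb.and (eventually_nhdsWithin_iff.1 hiso))
  have hinv : Tendsto (hs.localInverse φ _ p) (𝓝 0) (𝓝 p) := by
    have := hs.localInverse_tendsto
    rwa [hφ0] at this
  have hright : ∀ᶠ y in 𝓝 (0 : E), φ (hs.localInverse φ _ p y) = y := by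
    have := hs.eventually_right_inverse
    rwa [hφ0] at this
  have hline : Tendsto (fun t : ℂ => t • v) (𝓝[≠] 0) (𝓝 0) := by
    have : Continuous fun t : ℂ => t • v := by fun_prop
    simpa using (this.tendsto 0).mono_left nhdsWithin_le_nhds
  obtain ⟨t, ⟨h1, h2⟩, ht⟩ := ((hline.eventually ((hinv.eventually hev).and hright)).and
    (self_mem_nhdsWithin : ∀ᶠ t : ℂ in 𝓝[≠] 0, t ∈ ({0}ᶜ : Set ℂ))).exists
  set z := hs.localInverse φ _ p (t • v)
  have hzp : z ≠ p := by
    intro hz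
    rw [hz, hφ0] at h2
    exact (smul_ne_zero ht hv0) h2.symm
  refine h1.2.2 hzp (hinj h1.1 h1.2.1 ?_)
  rw [hφF z (hrD h1.2.1), h2, map_smul, hv]

end IsAut

end

section

namespace IsAut

variable {E : Type*} [NormedAddCommGroup E] [NormedSpace ℂ E] [FiniteDimensional ℂ E]
  {D : Set E} {F : Equiv.Perm E} {R : ℝ} {p : E}

theorem tendsto_jac (hD : IsOpen D) (hc : IsPreconnected D) (hR : ∀ x ∈ D, ‖x‖ ≤ R)
    (h : IsAut D F) (hp : p ∈ D) (hF : F p = p) {y : E} (hy : y ∈ D) (hFy : F y = y) :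
    Tendsto (jac F y) (comap (jac F p) (𝓝 (jac F p 1))) (𝓝 (jac F y 1)) := by
  have : CompleteSpace E := FiniteDimensional.complete ℂ E
  set l := comap (jac F p) (𝓝 (jac F p 1)) with hl
  have : l.NeBot := by
    refine comap_neBot fun t ht => ⟨1, mem_of_mem_nhds ht⟩
  have h1 : Tendsto (fun k => jac F p (k - 1)) l (𝓝 1) := by
    have h2 : Tendsto (fun k => jac F p k * jac F p (-1)) l (𝓝 (jac F p 1 * jac F p (-1))) :=
      (tendsto_comap).mul tendsto_const_nhds
    rw [← jac_add hD h hp hF, add_neg_cancel, jac_zero] at h2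
    refine h2.congr fun k => ?_
    rw [← jac_add hD h hp hF, sub_eq_add_neg]
  have h2 := (Holo.limit_holomorphic (H := id) hD (fun k : ℤ => (h.zpow (k - 1)).holo)
    (fun k z hz => hR _ (((h.zpow (k - 1)).mem_iff z).2 hz))
    (fun z hz => tendsto_id hD hc hR h hp hF h1 hz)).2 y hy
  rw [fderiv_id] at h2
  have h3 : Tendsto (fun k => jac F y (k - 1) * jac F y 1) l (𝓝 (1 * jac F y 1)) :=
    h2.mul tendsto_const_nhds
  rw [one_mul] at h3
  refine h3.congr fun k => ?_
  rw [← jac_add hD h hy hFy, sub_add_cancel]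

theorem isOpen_injective_sub_one :
    IsOpen {A : E →L[ℂ] E | ∀ v, A v = v → v = 0} := by
  have : CompleteSpace E := FiniteDimensional.complete ℂ E
  have h : {A : E →L[ℂ] E | ∀ v, A v = v → v = 0} = {A | IsUnit (A - 1)} := by
    ext A
    rw [mem_ofPred_eq, mem_ofPred_eq, ContinuousLinearMap.isUnit_iff_bijective]
    have h1 : (∀ v, A v = v → v = 0) ↔ Function.Injective ((A - 1 : E →L[ℂ] E) : E →ₗ[ℂ] E) := by
      rw [← LinearMap.ker_eq_bot, LinearMap.ker_eq_bot']
      refine forall_congr' fun v => ?_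
      simp [sub_eq_zero]
    rw [h1]
    exact ⟨fun hi => ⟨hi, LinearMap.injective_iff_surjective.1 hi⟩, fun hb => hb.1⟩
  rw [h]
  exact Units.isOpen.preimage (continuous_id.sub continuous_const)

theorem of_iterate {H : E → E} (hm : MapsTo H D D) (hd : DifferentiableOn ℂ H D) {m : ℕ}
    (hm0 : 0 < m) (hH : ∀ z ∈ D, H^[m] z = z) :
    ∃ G : Equiv.Perm E, IsAut D G ∧ G ^ m = 1 ∧ EqOn G H D := by
  classical
  obtain ⟨n, rfl⟩ : ∃ n, m = n + 1 := ⟨m - 1, by omega⟩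
  set g : E → E := fun x => if x ∈ D then H x else x with hg
  have hgD : EqOn g H D := fun x hx => if_pos hx
  have hoff : ∀ x, x ∉ D → g x = x := fun x hx => if_neg hx
  have hiD : ∀ k, EqOn g^[k] H^[k] D ∧ MapsTo H^[k] D D := fun k => by
    induction k with
    | zero => exact ⟨fun _ _ => rfl, fun _ h => h⟩
    | succ k ih =>
      refine ⟨fun x hx => ?_, ?_⟩
      · rw [Function.iterate_succ_apply', Function.iterate_succ_apply', ih.1 hx]
        exact hgD (ih.2 hx)
      · rw [Function.iterate_succ']
        exact hm.comp ih.2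
  have hid : ∀ k, DifferentiableOn ℂ H^[k] D := fun k => by
    induction k with
    | zero => exact differentiableOn_id
    | succ k ih =>
      rw [Function.iterate_succ']
      exact hd.comp ih (hiD k).2
  have hone : ∀ x, g^[n + 1] x = x := fun x => by
    by_cases hx : x ∈ D
    · rw [(hiD _).1 hx, hH x hx]
    · exact Function.iterate_fixed (hoff x hx) _
  let G : Equiv.Perm E := ⟨g, g^[n], fun x => hone x, fun x => by
    exact (Function.iterate_succ_apply' g n x).symm.trans (hone x)⟩
  refine ⟨G, ⟨fun x => ⟨fun hx => ?_, fun hx => ?_⟩, hd.congr hgD, ?_, hoff⟩, ?_, hgD⟩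
  · by_contra hx'
    rw [show G x = x from hoff x hx'] at hx
    exact hx' hx
  · rw [show G x = H x from hgD hx]
    exact hm hx
  · exact (hid n).congr (hiD n).1
  · ext x
    rw [← Equiv.Perm.iterate_eq_pow]
    exact hone x

theorem exists_finite_order (hD : IsOpen D) (hc : IsPreconnected D) (hR : ∀ x ∈ D, ‖x‖ ≤ R)
    (h : IsAut D F) (T : Finset E)
    (hT : ∀ y ∈ T, y ∈ D ∧ F y = y ∧ ∀ v, fderiv ℂ F y v = v → v = 0) :
    ∃ G : Equiv.Perm E, IsAut D G ∧ (∃ m, 0 < m ∧ G ^ m = 1) ∧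
      ∀ y ∈ T, y ∈ D ∧ G y = y ∧ ∀ v, fderiv ℂ G y v = v → v = 0 := by
  have : CompleteSpace E := FiniteDimensional.complete ℂ E
  rcases T.eq_empty_or_nonempty with rfl | ⟨p, hpT⟩
  · exact ⟨1, one, ⟨1, one_pos, one_pow 1⟩, by simp⟩
  obtain ⟨hp, hF, -⟩ := hT p hpT
  have hball : ∀ y ∈ T, ∃ ε > 0, closedBall (jac F y 1) ε ⊆
      {A : E →L[ℂ] E | ∀ v, A v = v → v = 0} := fun y hy =>
    nhds_basis_closedBall.mem_iff.1 (isOpen_injective_sub_one.mem_nhds (by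
      rw [jac_one]; exact (hT y hy).2.2))
  choose! ε hε hεs using hball
  have hev : ∀ᶠ k in comap (jac F p) (𝓝 (jac F p 1)),
      ∀ y ∈ T, jac F y k ∈ closedBall (jac F y 1) (ε y) := by
    rw [Finset.eventually_all]
    exact fun y hy => (tendsto_jac hD hc hR h hp hF (hT y hy).1 (hT y hy).2.1).eventually_mem
      (closedBall_mem_nhds _ (hε y hy))
  obtain ⟨η, hη, hηs⟩ := (nhds_basis_ball.comap (jac F p)).mem_iff.1 hev
  obtain ⟨M, hM⟩ := jac_bounded hD hR h hp
  obtain ⟨B, hB, hB1, m, hm, hBm⟩ :=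
    Torsion.exists_torsion (jac_zero p) (jac_add hD h hp hF) hM hη
  have hne : (comap (jac F p) (𝓝 B)).NeBot := by
    refine comap_neBot fun t ht => ?_
    obtain ⟨_, hat, k, rfl⟩ := mem_closure_iff_nhds.1 hB t ht
    exact ⟨k, hat⟩
  set U := Ultrafilter.of (comap (jac F p) (𝓝 B)) with hU
  have hUl : Tendsto (jac F p) U (𝓝 B) := tendsto_comap.mono_left (Ultrafilter.of_le _)
  obtain ⟨H, hHd, hH⟩ := Holo.exists_ultralimit U hD (fun k : ℤ => (h.zpow k).holo)
    (fun k z hz => hR _ (((h.zpow k).mem_iff z).2 hz))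
  have hHm : MapsTo H D D := fun z hz => by
    obtain ⟨K, hK, hKD, hzK⟩ := orbit_compact hD hc hR h hp hF hz
    exact hKD (hK.isClosed.mem_of_tendsto (hH z hz).1 (Eventually.of_forall hzK))
  have hiter : ∀ j : ℕ, MapsTo H^[j] D D ∧ ∀ z ∈ D,
      Tendsto (fun k : ℤ => (F ^ (j * k)) z) U (𝓝 (H^[j] z)) := fun j => by
    induction j with
    | zero => exact ⟨fun _ h => h, fun z _ => by simp⟩
    | succ j ih =>
      refine ⟨by rw [Function.iterate_succ']; exact hHm.comp ih.1, fun z hz => ?_⟩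
      have hw := ih.1 hz
      obtain ⟨r, hr, L, hL, hrD, hlip⟩ := lipschitz hD hR hw
      rw [Function.iterate_succ_apply']
      have h1 := (hH _ hw).1
      have h2 : Tendsto (fun k : ℤ => (F ^ k) ((F ^ (j * k)) z) - (F ^ k) (H^[j] z)) U (𝓝 0) := by
        have h3 := (tendsto_iff_norm_sub_tendsto_zero.1 (ih.2 z hz)).const_mul L
        rw [mul_zero] at h3
        refine squeeze_zero_norm' ?_ h3
        filter_upwards [(ih.2 z hz).eventually_mem (closedBall_mem_nhds _ hr)] with k hk
        exact hlip _ (h.zpow k) _ hk _ (mem_closedBall_self hr.le)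
      have h3 := h2.add h1
      rw [zero_add] at h3
      refine h3.congr fun k => ?_
      rw [sub_add_cancel, ← Equiv.Perm.mul_apply, ← zpow_add]
      congr 2
      push_cast; ring
  have hmid : ∀ z ∈ D, H^[m] z = z := fun z hz => by
    refine tendsto_nhds_unique ((hiter m).2 z hz) (tendsto_id hD hc hR h hp hF ?_ hz)
    have h1 := hUl.pow m
    rw [hBm] at h1
    refine h1.congr fun k => ?_
    rw [Torsion.hom_pow (jac_zero p) (jac_add hD h hp hF), mul_comm]
  obtain ⟨G, hG, hGm, hGH⟩ := of_iterate hHm hHd hm hmid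
  refine ⟨G, hG, ⟨m, hm, hGm⟩, fun y hy => ⟨(hT y hy).1, ?_, ?_⟩⟩
  · rw [hGH (hT y hy).1]
    refine tendsto_nhds_unique (hH y (hT y hy).1).1 ?_
    simp only [zpow_fix (hT y hy).2.1]
    exact tendsto_const_nhds
  · have hfd : fderiv ℂ G y = fderiv ℂ H y :=
      (hGH.eventuallyEq_of_mem (hD.mem_nhds (hT y hy).1)).fderiv_eq
    rw [hfd]
    refine hεs y hy (isClosed_closedBall.mem_of_tendsto (hH y (hT y hy).1).2 ?_)
    have hnear : ∀ᶠ k in (U : Filter ℤ), jac F p k ∈ ball (jac F p 1) η :=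
      hUl.eventually_mem (isOpen_ball.mem_nhds (by rwa [mem_ball, dist_eq_norm]))
    filter_upwards [hnear] with k hk
    exact hηs hk y hy

end IsAut

end

section

variable {E : Type*} [NormedAddCommGroup E] [NormedSpace ℂ E]

/-- `θ` and `χ` are mutually inverse holomorphic parametrizations of `X ∩ U` by a disc. -/
structure CurveChart (D X : Set E) (θ : E → ℂ) (χ : ℂ → E) (r : ℝ) (U : Set E) : Prop where
  isOpen : IsOpen U
  subset : U ⊆ D
  holo : DifferentiableOn ℂ θ D
  holo_inv : DifferentiableOn ℂ χ (ball 0 r)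
  mem : ∀ w ∈ ball (0 : ℂ) r, χ w ∈ X ∩ U
  right : ∀ w ∈ ball (0 : ℂ) r, θ (χ w) = w
  mem_ball : ∀ z ∈ X ∩ U, θ z ∈ ball (0 : ℂ) r
  left : ∀ z ∈ X ∩ U, χ (θ z) = z

namespace Linearized

variable [FiniteDimensional ℂ E] {D : Set E} {g φ : E → E} {x : E} {A : E →L[ℂ] E}

theorem eventually_injOn (hD : IsOpen D) (hx : x ∈ D) (hφ : DifferentiableOn ℂ φ D)
    (hφx : fderiv ℂ φ x = ContinuousLinearMap.id ℂ E) (hg : ContinuousAt g x) (hgx : g x = x) :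
    ∃ e : OpenPartialHomeomorph E E, (e : E → E) = φ ∧ x ∈ e.source ∧
      ∀ᶠ z in 𝓝 x, z ∈ D ∧ z ∈ e.source ∧ g z ∈ e.source ∧ IsUnit (fderiv ℂ φ z) := by
  have : CompleteSpace E := FiniteDimensional.complete ℂ E
  have hs := Holo.hasStrictFDerivAt hD hφ hx
  rw [hφx, ← ContinuousLinearEquiv.coe_refl] at hs
  refine ⟨hs.toOpenPartialHomeomorph φ, hs.toOpenPartialHomeomorph_coe,
    hs.mem_toOpenPartialHomeomorph_source, ?_⟩
  have h1 : (hs.toOpenPartialHomeomorph φ).source ∈ 𝓝 x :=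
    (hs.toOpenPartialHomeomorph φ).open_source.mem_nhds hs.mem_toOpenPartialHomeomorph_source
  have h2 : ∀ᶠ z in 𝓝 x, g z ∈ (hs.toOpenPartialHomeomorph φ).source :=
    hg.eventually_mem (by rwa [hgx])
  have h3 : ∀ᶠ z in 𝓝 x, IsUnit (fderiv ℂ φ z) :=
    (Holo.continuousAt_fderiv hD hφ hx).eventually_mem
      (Units.isOpen.mem_nhds (by rw [hφx]; exact isUnit_one))
  filter_upwards [hD.mem_nhds hx, h1, h2, h3] with z a b c d using ⟨a, b, c, d⟩

theorem isolated (hD : IsOpen D) (hx : x ∈ D) (hφ : DifferentiableOn ℂ φ D) (hφ0 : φ x = 0)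
    (hφx : fderiv ℂ φ x = ContinuousLinearMap.id ℂ E) (hg : ContinuousAt g x) (hgx : g x = x)
    (hφg : ∀ z ∈ D, φ (g z) = A (φ z)) (hA : ∀ v, A v = v → v = 0) :
    ∀ᶠ z in 𝓝 x, g z = z → z = x := by
  obtain ⟨e, he, hxe, hev⟩ := eventually_injOn hD hx hφ hφx hg hgx
  filter_upwards [hev] with z hz hgz
  refine e.injOn hz.2.1 hxe ?_
  rw [he, hφ0]
  exact hA _ (by rw [← hφg z hz.1, hgz])

theorem eventually_id (hD : IsOpen D) (hx : x ∈ D) (hφ : DifferentiableOn ℂ φ D)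
    (hφx : fderiv ℂ φ x = ContinuousLinearMap.id ℂ E) (hg : ContinuousAt g x) (hgx : g x = x)
    (hφg : ∀ z ∈ D, φ (g z) = A (φ z)) (hA : ∀ v, A v = v) :
    ∀ᶠ z in 𝓝 x, g z = z := by
  obtain ⟨e, he, hxe, hev⟩ := eventually_injOn hD hx hφ hφx hg hgx
  filter_upwards [hev] with z hz
  refine e.injOn hz.2.2.1 hz.2.1 ?_
  rw [he, hφg z hz.1, hA]

theorem exists_chart (hD : IsOpen D) (hx : x ∈ D) (hφ : DifferentiableOn ℂ φ D) (hφ0 : φ x = 0)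
    (hφx : fderiv ℂ φ x = ContinuousLinearMap.id ℂ E) (hg : ContinuousAt g x) (hgx : g x = x)
    (hφg : ∀ z ∈ D, φ (g z) = A (φ z)) {v : E} (hv : v ≠ 0) (hAv : A v = v)
    (hA : ∀ u, A u = u → ∃ c : ℂ, u = c • v) :
    ∃ θ χ r U, CurveChart D {z | z ∈ D ∧ g z = z} θ χ r U ∧ x ∈ U ∧ θ x = 0 ∧
      (∃ ℓ : E →L[ℂ] ℂ, ℓ v = 1 ∧ ∀ z, θ z = ℓ (φ z)) ∧
      ∀ z ∈ U, g z = z → φ z = θ z • v := by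
  obtain ⟨e, he, hxe, hev⟩ := eventually_injOn hD hx hφ hφx hg hgx
  obtain ⟨ℓ, hℓ⟩ := SeparatingDual.exists_eq_one (R := ℂ) hv
  have h0t : (0 : E) ∈ e.target := by rw [← hφ0, ← he]; exact e.map_source hxe
  have hsx : e.symm 0 = x := by rw [← hφ0, ← he]; exact e.left_inv hxe
  have hc : Tendsto e.symm (𝓝 0) (𝓝 x) := by
    have := e.symm.continuousAt (x := 0) h0t
    rwa [ContinuousAt, hsx] at this
  obtain ⟨s, hs, hsub⟩ := Metric.mem_nhds_iff.1
    (inter_mem (hc.eventually hev) (e.open_target.mem_nhds h0t))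
  have hv' : 0 < ‖v‖ := norm_pos_iff.2 hv
  have hball : ∀ w ∈ ball (0 : ℂ) (s / ‖v‖), w • v ∈ ball (0 : E) s := fun w hw => by
    rw [mem_ball_zero_iff] at hw ⊢
    rwa [norm_smul, ← lt_div_iff₀ hv']
  have hO : IsOpen (e.source ∩ D) := e.open_source.inter hD
  have hkey : ∀ z ∈ D, g z = z → φ z = ℓ (φ z) • v := fun z hz hgz => by
    obtain ⟨c, hcv⟩ := hA (φ z) (by rw [← hφg z hz, hgz])
    rw [hcv, map_smul, hℓ, smul_eq_mul, mul_one]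
  have hmem : ∀ w ∈ ball (0 : ℂ) (s / ‖v‖), φ (e.symm (w • v)) = w • v ∧
      e.symm (w • v) ∈ D ∧ e.symm (w • v) ∈ e.source ∧ g (e.symm (w • v)) = e.symm (w • v) ∧
      IsUnit (fderiv ℂ φ (e.symm (w • v))) := fun w hw => by
    obtain ⟨⟨h1, h2, h3, h4⟩, h5⟩ := hsub (hball w hw)
    have h6 : φ (e.symm (w • v)) = w • v := by rw [← he]; exact e.right_inv h5
    refine ⟨h6, h1, h2, e.injOn h3 h2 ?_, h4⟩
    rw [he, hφg _ h1, h6, map_smul, hAv]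
  refine ⟨fun z => ℓ (φ z), fun w => e.symm (w • v), s / ‖v‖, (e.source ∩ D) ∩ φ ⁻¹' ball 0 s,
    ⟨(hφ.continuousOn.mono inter_subset_right).isOpen_inter_preimage hO isOpen_ball,
      fun z hz => hz.1.2, ℓ.differentiable.comp_differentiableOn hφ, ?_, ?_, ?_, ?_, ?_⟩, ?_, ?_,
    ⟨ℓ, hℓ, fun _ => rfl⟩, ?_⟩
  · intro w hw
    obtain ⟨h1, h2, h3, h4, u, hu⟩ := hmem w hw
    have hd : HasFDerivAt e ((ContinuousLinearEquiv.unitsEquiv ℂ E u : E ≃L[ℂ] E) : E →L[ℂ] E)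
        (e.symm (w • v)) := by
      rw [he]
      have : ((ContinuousLinearEquiv.unitsEquiv ℂ E u : E ≃L[ℂ] E) : E →L[ℂ] E) =
          fderiv ℂ φ (e.symm (w • v)) := by rw [← hu]; rfl
      rw [this]
      exact (hφ.differentiableAt (hD.mem_nhds h2)).hasFDerivAt
    have hd2 := (e.hasFDerivAt_symm (hsub (hball w hw)).2 hd).differentiableAt
    have h5 : DifferentiableAt ℂ (fun w : ℂ => w • v) w := by fun_prop
    exact (hd2.comp w h5).differentiableWithinAt
  · intro w hw
    obtain ⟨h1, h2, h3, h4, -⟩ := hmem w hw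
    refine ⟨⟨h2, h4⟩, ⟨h3, h2⟩, ?_⟩
    rw [mem_preimage, h1]
    exact hball w hw
  · intro w hw
    simp only [(hmem w hw).1]
    rw [map_smul, hℓ, smul_eq_mul, mul_one]
  · rintro z ⟨⟨hzD, hgz⟩, ⟨-, hzs⟩⟩
    rw [mem_preimage, hkey z hzD hgz, mem_ball_zero_iff, norm_smul] at hzs
    rw [mem_ball_zero_iff, lt_div_iff₀ hv']
    exact hzs
  · rintro z ⟨⟨hzD, hgz⟩, ⟨⟨hze, -⟩, hzs⟩⟩
    simp only [← hkey z hzD hgz]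
    rw [← he]
    exact e.left_inv hze
  · refine ⟨⟨hxe, hx⟩, ?_⟩
    rw [mem_preimage, hφ0]
    exact mem_ball_self hs
  · change ℓ (φ x) = 0
    rw [hφ0, map_zero]
  · exact fun z hz hgz => hkey z hz.1.2 hgz

theorem trichotomy (hE : Module.finrank ℂ E = 2) (A : E →L[ℂ] E) :
    (∀ v, A v = v → v = 0) ∨ (∀ v, A v = v) ∨
      ∃ v, v ≠ 0 ∧ A v = v ∧ ∀ u, A u = u → ∃ c : ℂ, u = c • v := by
  set N : Submodule ℂ E := LinearMap.ker ((A - 1 : E →L[ℂ] E) : E →ₗ[ℂ] E) with hN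
  have hmem : ∀ v, v ∈ N ↔ A v = v := fun v => by simp [hN, sub_eq_zero]
  have hle : Module.finrank ℂ N ≤ 2 := hE ▸ N.finrank_le
  interval_cases hf : Module.finrank ℂ N
  · left
    intro v hv
    rw [Submodule.finrank_eq_zero] at hf
    have := (hmem v).2 hv
    rwa [hf, Submodule.mem_bot] at this
  · right; right
    obtain ⟨v, hv0, hv⟩ := finrank_eq_one_iff'.1 hf
    refine ⟨v, fun h => hv0 (Subtype.ext h), (hmem v).1 v.2, fun u hu => ?_⟩
    obtain ⟨c, hc⟩ := hv ⟨u, (hmem u).2 hu⟩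
    exact ⟨c, by rw [← Submodule.coe_smul, hc]⟩
  · right; left
    intro v
    have : N = ⊤ := Submodule.eq_top_of_finrank_eq (hf.trans hE.symm)
    exact (hmem v).1 (this ▸ Submodule.mem_top)

end Linearized

end

section

variable {E : Type*} [NormedAddCommGroup E] [NormedSpace ℂ E]

namespace CurveChart

variable {D X : Set E} {θ : E → ℂ} {χ : ℂ → E} {r : ℝ} {U : Set E}

theorem image_eq (h : CurveChart D X θ χ r U) : χ '' ball 0 r = X ∩ U := by
  refine Subset.antisymm ?_ fun z hz => ⟨θ z, h.mem_ball z hz, h.left z hz⟩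
  rintro _ ⟨w, hw, rfl⟩
  exact h.mem w hw

theorem isPathConnected (h : CurveChart D X θ χ r U) (hne : (X ∩ U).Nonempty) :
    IsPathConnected (X ∩ U) := by
  rw [← h.image_eq]
  obtain ⟨z, hz⟩ := hne
  have h1 : IsPathConnected (ball (0 : ℂ) r) :=
    (convex_ball 0 r).isPathConnected ⟨θ z, h.mem_ball z hz⟩
  exact h1.image' h.holo_inv.continuousOn

theorem subset_pathComponent (h : CurveChart D X θ χ r U) {x z : E} (hz : z ∈ U)
    (hzC : z ∈ pathComponentIn X x) : X ∩ U ⊆ pathComponentIn X x := fun w hw => by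
  have hzX : z ∈ X := pathComponentIn_subset hzC
  have h1 := ((h.isPathConnected ⟨z, hzX, hz⟩).joinedIn z ⟨hzX, hz⟩ w hw).mono inter_subset_left
  exact JoinedIn.trans hzC h1

theorem pathComponent (h : CurveChart D X θ χ r U) {x z : E} (hz : z ∈ U)
    (hzC : z ∈ pathComponentIn X x) : CurveChart D (pathComponentIn X x) θ χ r U where
  isOpen := h.isOpen
  subset := h.subset
  holo := h.holo
  holo_inv := h.holo_inv
  mem w hw := ⟨h.subset_pathComponent hz hzC (h.mem w hw), (h.mem w hw).2⟩
  right := h.right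
  mem_ball z hz := h.mem_ball z ⟨pathComponentIn_subset hz.1, hz.2⟩
  left z hz := h.left z ⟨pathComponentIn_subset hz.1, hz.2⟩

end CurveChart

namespace IsAut

variable [FiniteDimensional ℂ E] {D : Set E} {F g : Equiv.Perm E} {R : ℝ} {x y : E}

theorem isolated_or_chart (hE : Module.finrank ℂ E = 2) (hD : IsOpen D) (hc : IsPreconnected D)
    (hR : ∀ x ∈ D, ‖x‖ ≤ R) (h : IsAut D g) (hg1 : g ≠ 1) (hx : x ∈ D) (hgx : g x = x) :
    (∀ᶠ z in 𝓝 x, g z = z → z = x) ∨ ∃ θ χ r U,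
      CurveChart D {z | z ∈ D ∧ g z = z} θ χ r U ∧ x ∈ U ∧ θ x = 0 := by
  have : CompleteSpace E := FiniteDimensional.complete ℂ E
  have hgc : ContinuousAt g x := (h.holo.differentiableAt (hD.mem_nhds hx)).continuousAt
  obtain ⟨φ, hφ, hφ0, hφx, hφg⟩ := exists_linearization hD hR h hx hgx
  rcases Linearized.trichotomy hE (fderiv ℂ g x) with hA | hA | ⟨v, hv, hAv, hA⟩
  · exact Or.inl (Linearized.isolated hD hx hφ hφ0 hφx hgc hgx hφg hA)
  · refine absurd ?_ hg1
    refine ext_on h one fun z hz => ?_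
    exact Holo.eqOn_of_eventuallyEq hD hc h.holo differentiableOn_id hx
      (Linearized.eventually_id hD hx hφ hφx hgc hgx hφg hA) hz
  · obtain ⟨θ, χ, r, U, h1, h2, h3, -⟩ :=
      Linearized.exists_chart hD hx hφ hφ0 hφx hgc hgx hφg hv hAv hA
    exact Or.inr ⟨θ, χ, r, U, h1, h2, h3⟩

theorem isolated_or_multiplier (hE : Module.finrank ℂ E = 2) (hD : IsOpen D)
    (hc : IsPreconnected D) (hR : ∀ x ∈ D, ‖x‖ ≤ R) (h : IsAut D F) {j : ℕ} (hg1 : F ^ j ≠ 1)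
    (hy : y ∈ D) (hFy : F y = y) (hA1 : ∀ v, fderiv ℂ F y v = v → v = 0) :
    (∀ᶠ z in 𝓝 y, (F ^ j) z = z → z = y) ∨ ∃ θ χ r U,
      CurveChart D {z | z ∈ D ∧ (F ^ j) z = z} θ χ r U ∧ y ∈ U ∧ θ y = 0 ∧
      ∃ l : ℂ, l ≠ 1 ∧ ∀ z ∈ U, (F ^ j) z = z → θ (F z) = l * θ z := by
  have : CompleteSpace E := FiniteDimensional.complete ℂ E
  have hg := h.pow j
  have hgy : (F ^ j) y = y := by
    have := zpow_fix hFy (j : ℤ)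
    rwa [zpow_natCast] at this
  have hgc : ContinuousAt (F ^ j : Equiv.Perm E) y :=
    (hg.holo.differentiableAt (hD.mem_nhds hy)).continuousAt
  obtain ⟨φ, hφ, hφ0, hφx, hφF⟩ := exists_linearization hD hR h hy hFy
  have hφg : ∀ z ∈ D, φ ((F ^ j) z) = (fderiv ℂ F y ^ j) (φ z) := by
    clear hg hgy hgc hg1
    induction j with
    | zero => intro z _; rfl
    | succ j ih =>
      intro z hz
      rw [pow_succ, Equiv.Perm.mul_apply, ih _ ((h.mem_iff z).2 hz), hφF z hz, pow_succ]
      rfl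
  rcases Linearized.trichotomy hE (fderiv ℂ F y ^ j) with hA | hA | ⟨v, hv, hAv, hA⟩
  · exact Or.inl (Linearized.isolated hD hy hφ hφ0 hφx hgc hgy hφg hA)
  · refine absurd ?_ hg1
    refine ext_on hg one fun z hz => ?_
    exact Holo.eqOn_of_eventuallyEq hD hc hg.holo differentiableOn_id hy
      (Linearized.eventually_id hD hy hφ hφx hgc hgy hφg hA) hz
  · obtain ⟨θ, χ, r, U, h1, h2, h3, ⟨ℓ, hℓ, hθ⟩, h5⟩ :=
      Linearized.exists_chart hD hy hφ hφ0 hφx hgc hgy hφg hv hAv hA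
    obtain ⟨l, hl⟩ := hA (fderiv ℂ F y v) (by
      have : (fderiv ℂ F y ^ j * fderiv ℂ F y) v = (fderiv ℂ F y * fderiv ℂ F y ^ j) v := by
        rw [← pow_succ, ← pow_succ']
      change (fderiv ℂ F y ^ j) (fderiv ℂ F y v) = fderiv ℂ F y ((fderiv ℂ F y ^ j) v) at this
      rw [this, hAv])
    refine Or.inr ⟨θ, χ, r, U, h1, h2, h3, l, ?_, fun z hz hgz => ?_⟩
    · rintro rfl
      exact hv (hA1 v (by rw [hl, one_smul]))
    · rw [hθ (F z), hφF z (h1.subset hz), h5 z hz hgz, map_smul, hl, map_smul, map_smul, hℓ]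
      simp [mul_comm]

/-- A path component with two points of the fixed point set is a holomorphic curve. -/
theorem chart_of_nontrivial (hE : Module.finrank ℂ E = 2) (hD : IsOpen D)
    (hc : IsPreconnected D) (hR : ∀ x ∈ D, ‖x‖ ≤ R) (h : IsAut D g) (hg1 : g ≠ 1) {X : Set E}
    (hX : X = {z | z ∈ D ∧ g z = z})
    (hC : (pathComponentIn X x).Nontrivial) {z : E} (hz : z ∈ pathComponentIn X x) :
    ∃ θ χ r U, CurveChart D (pathComponentIn X x) θ χ r U ∧ z ∈ U ∧ θ z = 0 := by
  subst hX
  have hzX := pathComponentIn_subset hz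
  rcases isolated_or_chart hE hD hc hR h hg1 hzX.1 hzX.2 with hi | ⟨θ, χ, r, U, h1, h2, h3⟩
  · exfalso
    obtain ⟨u, hu, hne⟩ := hC.exists_ne z
    have hx : x ∈ {z | z ∈ D ∧ g z = z} := JoinedIn.source_mem hz
    have hac := (isPathConnected_pathComponentIn hx).isConnected.isPreconnected.preperfect_of_nontrivial hC z hz
    rw [accPt_iff_frequently] at hac
    refine hac ?_
    filter_upwards [hi] with w hw hw2
    exact hw2.1 (hw (pathComponentIn_subset hw2.2).2)
  · exact ⟨θ, χ, r, U, h1.pathComponent h2 hz, h2, h3⟩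

end IsAut

end

section

variable {E : Type*} [NormedAddCommGroup E] [NormedSpace ℂ E]

namespace CurveChart

variable {D X C : Set E} {θ : E → ℂ} {χ : ℂ → E} {r : ℝ} {U : Set E}

theorem continuousAt (h : CurveChart D X θ χ r U) (hD : IsOpen D) {z : E} (hz : z ∈ U) :
    ContinuousAt θ z :=
  (h.holo.differentiableAt (hD.mem_nhds (h.subset hz))).continuousAt

theorem isOpen_preimage (h : CurveChart D X θ χ r U) {s : Set ℂ} (hs : IsOpen s) :
    IsOpen (U ∩ θ ⁻¹' s) :=
  (h.holo.continuousOn.mono h.subset).isOpen_inter_preimage h.isOpen hs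

/-- Small connected neighbourhoods of a point of the curve. -/
theorem exists_joined (h : CurveChart D X θ χ r U) {x : E} (hx : x ∈ X ∩ U) {O : Set E}
    (hO : O ∈ 𝓝 x) : ∃ V, IsOpen V ∧ x ∈ V ∧ ∀ u ∈ X ∩ V, ∀ v ∈ X ∩ V, JoinedIn (X ∩ O) u v := by
  have hb := h.mem_ball x hx
  have hc : ContinuousAt χ (θ x) :=
    (h.holo_inv.differentiableAt (isOpen_ball.mem_nhds hb)).continuousAt
  rw [ContinuousAt, h.left x hx] at hc
  obtain ⟨s, hs, hsub⟩ := Metric.mem_nhds_iff.1 (inter_mem (hc hO) (isOpen_ball.mem_nhds hb))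
  refine ⟨U ∩ θ ⁻¹' ball (θ x) s, h.isOpen_preimage isOpen_ball, ⟨hx.2, mem_ball_self hs⟩, ?_⟩
  have hp : IsPathConnected (χ '' ball (θ x) s) :=
    ((convex_ball (θ x) s).isPathConnected ⟨θ x, mem_ball_self hs⟩).image'
      (h.holo_inv.continuousOn.mono fun w hw => (hsub hw).2)
  rintro u ⟨huX, huU, hus⟩ v ⟨hvX, hvU, hvs⟩
  refine (hp.joinedIn u ⟨θ u, hus, h.left u ⟨huX, huU⟩⟩ v
    ⟨θ v, hvs, h.left v ⟨hvX, hvU⟩⟩).mono ?_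
  rintro _ ⟨w, hw, rfl⟩
  exact ⟨(h.mem w (hsub hw).2).1, (hsub hw).1⟩

end CurveChart

/-- Every point of `X` is isolated or has a chart. -/
def LocallyCurve (D X : Set E) : Prop :=
  ∀ x ∈ X, (∀ᶠ z in 𝓝 x, z ∈ X → z = x) ∨
    ∃ θ χ r U, CurveChart D X θ χ r U ∧ x ∈ U ∧ θ x = 0

/-- Every point has a chart. -/
def IsCurve (D C : Set E) : Prop :=
  ∀ x ∈ C, ∃ θ χ r U, CurveChart D C θ χ r U ∧ x ∈ U ∧ θ x = 0

namespace LocallyCurve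

variable {D X : Set E}

theorem exists_joined (h : LocallyCurve D X) {x : E} (hx : x ∈ X) {O : Set E} (hO : O ∈ 𝓝 x) :
    ∃ V, IsOpen V ∧ x ∈ V ∧ ∀ u ∈ X ∩ V, ∀ v ∈ X ∩ V, JoinedIn (X ∩ O) u v := by
  rcases h x hx with hi | ⟨θ, χ, r, U, h1, h2, -⟩
  · obtain ⟨V, hV, hVo, hxV⟩ := _root_.mem_nhds_iff.1 hi
    refine ⟨V, hVo, hxV, fun u hu v hv => ?_⟩
    rw [hV hu.2 hu.1, hV hv.2 hv.1]
    exact JoinedIn.refl ⟨hx, mem_of_mem_nhds hO⟩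
  · exact h1.exists_joined ⟨hx, h2⟩ hO

theorem uniform (h : LocallyCurve D X) {K : Set E} (hK : IsCompact K) (hKX : K ⊆ X) {x₀ : E}
    {Q : E → E → Prop} (hQ : ∀ x ∈ pathComponentIn X x₀,
      ∃ O ∈ 𝓝 x, ∀ u ∈ pathComponentIn X x₀ ∩ O, ∀ q ∈ pathComponentIn X x₀ ∩ O, Q u q) :
    ∃ ε > 0, ∀ u ∈ K, ∀ v ∈ K, dist u v ≤ ε → JoinedIn X u v ∧
      (u ∈ pathComponentIn X x₀ → JoinedIn (pathComponentIn X x₀ ∩ {q | Q u q}) u v) := by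
  have hloc : ∀ x ∈ K, ∃ V, IsOpen V ∧ x ∈ V ∧ ∀ u ∈ X ∩ V, ∀ v ∈ X ∩ V, JoinedIn X u v ∧
      (u ∈ pathComponentIn X x₀ → JoinedIn (pathComponentIn X x₀ ∩ {q | Q u q}) u v) :=
    fun x hxK => by
    by_cases hx : x ∈ pathComponentIn X x₀
    · obtain ⟨O, hO, hOQ⟩ := hQ x hx
      obtain ⟨V, hVo, hxV, hV⟩ := h.exists_joined (hKX hxK) hO
      refine ⟨V, hVo, hxV, fun u hu v hv => ?_⟩
      have hj := hV u hu v hv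
      refine ⟨hj.mono inter_subset_left, fun huC => ?_⟩
      obtain ⟨γ, hγ⟩ := hj
      have hγC : ∀ t, γ t ∈ pathComponentIn X x₀ := fun t => by
        have : PathConnectedSpace unitInterval := isPathConnected_iff_pathConnectedSpace.1
          ((convex_Icc (0 : ℝ) 1).isPathConnected ⟨0, by simp⟩)
        have hj := (isPathConnected_range γ.continuous).joinedIn u ⟨0, γ.source⟩ (γ t) ⟨t, rfl⟩
        refine JoinedIn.trans huC (hj.mono ?_)
        rintro _ ⟨s, rfl⟩
        exact (hγ s).1
      exact ⟨γ, fun t => ⟨hγC t, hOQ u ⟨huC, by simpa using (hγ 0).2⟩ (γ t) ⟨hγC t, (hγ t).2⟩⟩⟩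
    · obtain ⟨V, hVo, hxV, hV⟩ := h.exists_joined (hKX hxK) univ_mem
      simp only [inter_univ] at hV
      refine ⟨V, hVo, hxV, fun u hu v hv => ⟨hV u hu v hv, fun huC => ?_⟩⟩
      exact absurd (JoinedIn.trans huC (hV u hu x ⟨hKX hxK, hxV⟩)) hx
  choose! V hVo hxV hV using hloc
  obtain ⟨δ, hδ, hδV⟩ := lebesgue_number_lemma_of_metric (c := fun x : K => V x) hK
    (fun x => hVo x x.2) (fun x hx => mem_iUnion.2 ⟨⟨x, hx⟩, hxV x hx⟩)
  refine ⟨δ / 2, by positivity, fun u hu v hv huv => ?_⟩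
  obtain ⟨⟨x, hx⟩, hsub⟩ := hδV u hu
  exact hV x hx u ⟨hKX hu, hsub (mem_ball_self hδ)⟩ v
    ⟨hKX hv, hsub (by rw [mem_ball, dist_comm]; linarith)⟩

end LocallyCurve

namespace IsCurve

variable {D C : Set E}

theorem eqOn_id [CompleteSpace E] (h : IsCurve D C) (hC : IsPreconnected C) {G : E → E}
    (hG : DifferentiableOn ℂ G D) {y : E} (hy : y ∈ C) (hid : ∀ᶠ z in 𝓝[C] y, G z = z) {z : E}
    (hz : z ∈ C) : G z = z := by
  have key : (∀ᶠ u in 𝓝[C] y, G u = u) ↔ ∀ᶠ u in 𝓝[C] z, G u = u := by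
    refine hC.induction₂ (fun a b => (∀ᶠ u in 𝓝[C] a, G u = u) ↔ ∀ᶠ u in 𝓝[C] b, G u = u)
      ?_ (fun _ _ _ _ _ _ h1 h2 => h1.trans h2) (fun _ _ _ _ h1 => h1.symm) hy hz
    intro x hx
    obtain ⟨θ, χ, r, U, h1, h2, -⟩ := h x hx
    have key : ∀ a ∈ C ∩ U, (∀ᶠ u in 𝓝[C] a, G u = u) → ∀ u ∈ C ∩ U, G u = u := by
      intro a ha hev u hu
      have hχC : ∀ w ∈ ball (0 : ℂ) r, χ w ∈ D := fun w hw => h1.subset (h1.mem w hw).2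
      have hd : DifferentiableOn ℂ (fun w => G (χ w)) (ball 0 r) := hG.comp h1.holo_inv hχC
      have hb := h1.mem_ball a ha
      have ht : Tendsto χ (𝓝 (θ a)) (𝓝[C] a) := by
        have hc := (h1.holo_inv.differentiableAt (isOpen_ball.mem_nhds hb)).continuousAt
        rw [ContinuousAt, h1.left a ha] at hc
        refine tendsto_nhdsWithin_iff.2 ⟨hc, ?_⟩
        filter_upwards [isOpen_ball.mem_nhds hb] with w hw using (h1.mem w hw).1
      have := Holo.eqOn_of_eventuallyEq isOpen_ball (convex_ball (0 : ℂ) r).isPreconnected hd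
        h1.holo_inv hb (ht.eventually hev) (h1.mem_ball u hu)
      simpa only [h1.left u hu] using this
    have hnear : ∀ a ∈ C ∩ U, ∀ b ∈ C ∩ U, (∀ᶠ u in 𝓝[C] a, G u = u) →
        ∀ᶠ u in 𝓝[C] b, G u = u := fun a ha b hb hev => by
      filter_upwards [inter_mem_nhdsWithin C (h1.isOpen.mem_nhds hb.2)] with u hu
      exact key a ha hev u hu
    filter_upwards [inter_mem_nhdsWithin C (h1.isOpen.mem_nhds h2)] with b hb
    exact ⟨hnear x ⟨hx, h2⟩ b hb, hnear b hb x ⟨hx, h2⟩⟩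
  exact (key.1 hid).self_of_nhdsWithin hz

end IsCurve

end

section

variable {E : Type*} [NormedAddCommGroup E] [NormedSpace ℂ E]

namespace CurveChart

variable {D C : Set E} {θ θ' : E → ℂ} {χ χ' : ℂ → E} {r r' : ℝ} {U U' : Set E} {a : E}

theorem tendsto_punctured (h : CurveChart D C θ χ r U) (hD : IsOpen D) (ha : a ∈ C ∩ U) :
    Tendsto θ (𝓝[C \ {a}] a) (𝓝[≠] (θ a)) := by
  refine tendsto_nhdsWithin_iff.2 ⟨(h.continuousAt hD ha.2).tendsto.mono_left
    nhdsWithin_le_nhds, ?_⟩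
  filter_upwards [inter_mem_nhdsWithin _ (h.isOpen.mem_nhds ha.2)] with z hz hzθ
  refine hz.1.2 ?_
  rw [mem_singleton_iff, ← h.left z ⟨hz.1.1, hz.2⟩, ← h.left a ha]
  exact congrArg χ hzθ

theorem tendsto_inv (h : CurveChart D C θ χ r U) (ha : a ∈ C ∩ U) :
    Tendsto χ (𝓝 (θ a)) (𝓝[C] a) := by
  have hb := h.mem_ball a ha
  have hc := (h.holo_inv.differentiableAt (isOpen_ball.mem_nhds hb)).continuousAt
  rw [ContinuousAt, h.left a ha] at hc
  refine tendsto_nhdsWithin_iff.2 ⟨hc, ?_⟩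
  filter_upwards [isOpen_ball.mem_nhds hb] with w hw using (h.mem w hw).1

theorem neBot (h : CurveChart D C θ χ r U) (ha : a ∈ C ∩ U) : (𝓝[C \ {a}] a).NeBot := by
  have hb := h.mem_ball a ha
  have : Tendsto χ (𝓝[≠] (θ a)) (𝓝[C \ {a}] a) := by
    refine tendsto_nhdsWithin_iff.2 ⟨((h.tendsto_inv ha).mono_left nhdsWithin_le_nhds).mono_right
      nhdsWithin_le_nhds, ?_⟩
    filter_upwards [inter_mem_nhdsWithin _ (isOpen_ball.mem_nhds hb)] with w hw
    refine ⟨(h.mem w hw.2).1, fun he => hw.1 ?_⟩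
    rw [mem_singleton_iff] at he ⊢
    rw [← h.right w hw.2, he]
  exact this.neBot

theorem transition (h : CurveChart D C θ χ r U) (h' : CurveChart D C θ' χ' r' U') (hD : IsOpen D)
    {F G : E → E} (hF : DifferentiableOn ℂ F D) (hG : DifferentiableOn ℂ G D) (hFC : MapsTo F C C)
    (hGF : ∀ z ∈ C, G (F z) = z) (ha : a ∈ C ∩ U) (hFa : F a ∈ U') :
    ∃ μ ≠ 0, Tendsto (fun z => (θ' (F z) - θ' (F a)) / (θ z - θ a)) (𝓝[C \ {a}] a) (𝓝 μ) := by
  have hb := h.mem_ball a ha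
  have hb' := h'.mem_ball (F a) ⟨hFC ha.1, hFa⟩
  have hτ : DifferentiableAt ℂ (fun w => θ' (F (χ w))) (θ a) := by
    have h1 : DifferentiableAt ℂ χ (θ a) := h.holo_inv.differentiableAt (isOpen_ball.mem_nhds hb)
    have h2 : DifferentiableAt ℂ F (χ (θ a)) := by
      rw [h.left a ha]; exact hF.differentiableAt (hD.mem_nhds (h.subset ha.2))
    have h3 : DifferentiableAt ℂ θ' (F (χ (θ a))) := by
      rw [h.left a ha]; exact h'.holo.differentiableAt (hD.mem_nhds (h'.subset hFa))
    exact h3.comp (θ a) (h2.comp (θ a) h1)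
  have hτa : θ' (F (χ (θ a))) = θ' (F a) := by rw [h.left a ha]
  have hσ : DifferentiableAt ℂ (fun w => θ (G (χ' w))) (θ' (F (χ (θ a)))) := by
    rw [hτa]
    have hl := h'.left (F a) ⟨hFC ha.1, hFa⟩
    have h1 : DifferentiableAt ℂ χ' (θ' (F a)) :=
      h'.holo_inv.differentiableAt (isOpen_ball.mem_nhds hb')
    have h2 : DifferentiableAt ℂ G (χ' (θ' (F a))) := by
      rw [hl]; exact hG.differentiableAt (hD.mem_nhds (h'.subset hFa))
    have h3 : DifferentiableAt ℂ θ (G (χ' (θ' (F a)))) := by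
      rw [hl, hGF a ha.1]; exact h.holo.differentiableAt (hD.mem_nhds (h.subset ha.2))
    exact h3.comp (θ' (F a)) (h2.comp (θ' (F a)) h1)
  have hFc : Tendsto F (𝓝[C] a) (𝓝 (F a)) :=
    ((hF.differentiableAt (hD.mem_nhds (h.subset ha.2))).continuousAt.tendsto).mono_left
      nhdsWithin_le_nhds
  have hid : (fun w => θ (G (χ' (θ' (F (χ w)))))) =ᶠ[𝓝 (θ a)] id := by
    filter_upwards [isOpen_ball.mem_nhds hb,
      (hFc.comp (h.tendsto_inv ha)).eventually_mem (h'.isOpen.mem_nhds hFa)] with w hw hw'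
    have hwC := (h.mem w hw).1
    simp only [id]
    rw [h'.left _ ⟨hFC hwC, hw'⟩, hGF _ hwC, h.right w hw]
  have hcomp := (hσ.hasDerivAt.comp (θ a) hτ.hasDerivAt).congr_of_eventuallyEq hid.symm
  have hone := hcomp.unique (hasDerivAt_id (θ a))
  refine ⟨deriv (fun w => θ' (F (χ w))) (θ a), fun h0 => by simp [h0] at hone, ?_⟩
  refine ((hasDerivAt_iff_tendsto_slope.1 hτ.hasDerivAt).comp (h.tendsto_punctured hD ha)).congr' ?_
  filter_upwards [inter_mem_nhdsWithin _ (h.isOpen.mem_nhds ha.2)] with z hz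
  simp only [Function.comp, slope_def_field]
  rw [h.left z ⟨hz.1.1, hz.2⟩, h.left a ha]

end CurveChart

/-- A choice of a centred chart at every point. -/
structure CurveAtlas (D C : Set E) where
  /-- The coordinate. -/
  θ : E → E → ℂ
  /-- The parametrization. -/
  χ : E → ℂ → E
  /-- The radius. -/
  r : E → ℝ
  /-- The domain. -/
  U : E → Set E
  chart : ∀ x ∈ C, CurveChart D C (θ x) (χ x) (r x) (U x)
  mem : ∀ x ∈ C, x ∈ U x
  zero : ∀ x ∈ C, θ x x = 0

namespace CurveAtlas

variable {D C : Set E} (𝔞 : CurveAtlas D C)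

/-- `s` has order `k` at `x` with leading coefficient `L`. -/
def HasOrder (s : E → ℂ) (k : ℤ) (x : E) (L : ℂ) : Prop :=
  L ≠ 0 ∧ Tendsto (fun z => s z / 𝔞.θ x z ^ k) (𝓝[C \ {x}] x) (𝓝 L)

variable {𝔞}

theorem ne_zero {x : E} (hD : IsOpen D) (hx : x ∈ C) : ∀ᶠ z in 𝓝[C \ {x}] x, 𝔞.θ x z ≠ 0 := by
  have h := (𝔞.chart x hx).tendsto_punctured hD ⟨hx, 𝔞.mem x hx⟩
  rw [𝔞.zero x hx] at h
  exact h.eventually_mem self_mem_nhdsWithin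

theorem HasOrder.mul (hD : IsOpen D) {s s' : E → ℂ} {k k' : ℤ} {x : E} {L L' : ℂ} (hx : x ∈ C)
    (h : 𝔞.HasOrder s k x L) (h' : 𝔞.HasOrder s' k' x L') :
    𝔞.HasOrder (fun z => s z * s' z) (k + k') x (L * L') := by
  refine ⟨mul_ne_zero h.1 h'.1, (h.2.mul h'.2).congr' ?_⟩
  filter_upwards [ne_zero hD hx] with z hz
  rw [zpow_add₀ hz, div_mul_div_comm]

theorem HasOrder.inv {s : E → ℂ} {k : ℤ} {x : E} {L : ℂ} (h : 𝔞.HasOrder s k x L) :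
    𝔞.HasOrder (fun z => (s z)⁻¹) (-k) x L⁻¹ := by
  refine ⟨inv_ne_zero h.1, (h.2.inv₀ h.1).congr fun z => ?_⟩
  rw [zpow_neg, inv_div_inv, inv_div]

/-- The divisor `a - b`. -/
def dipole (a b x : E) : ℤ := by
  classical exact (if x = a then 1 else 0) - (if x = b then 1 else 0)

variable (𝔞) in
/-- There is a nowhere vanishing continuous function with divisor `a - b`. -/
def HasDipole (a b : E) : Prop :=
  ∃ (s : E → ℂ) (L : E → ℂ), ∀ x ∈ C, 𝔞.HasOrder s (dipole a b x) x (L x)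

theorem HasDipole.symm {a b : E} (h : 𝔞.HasDipole a b) : 𝔞.HasDipole b a := by
  obtain ⟨s, L, h⟩ := h
  refine ⟨fun z => (s z)⁻¹, fun z => (L z)⁻¹, fun x hx => ?_⟩
  have : dipole b a x = -dipole a b x := by simp only [dipole]; ring
  rw [this]
  exact (h x hx).inv

theorem HasDipole.trans (hD : IsOpen D) {a b c : E} (h : 𝔞.HasDipole a b)
    (h' : 𝔞.HasDipole b c) : 𝔞.HasDipole a c := by
  obtain ⟨s, L, h⟩ := h
  obtain ⟨s', L', h'⟩ := h'
  refine ⟨fun z => s z * s' z, fun z => L z * L' z, fun x hx => ?_⟩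
  have : dipole a c x = dipole a b x + dipole b c x := by simp only [dipole]; ring
  rw [this]
  exact (h x hx).mul hD hx (h' x hx)

theorem HasDipole.refl (a : E) : 𝔞.HasDipole a a := by
  refine ⟨fun _ => 1, fun _ => 1, fun x _ => ?_⟩
  have : dipole a a x = 0 := by simp [dipole]
  rw [this]
  exact ⟨one_ne_zero, by simpa using tendsto_const_nhds⟩

/-- The model dipole in the plane: zero at the origin, pole at `β`, equal to one far away. -/
def model (β w : ℂ) : ℂ := 1 + ((max 0 (min 1 (4 - ‖w‖ / ‖β‖)) : ℝ) : ℂ) * (β / (w - β))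

theorem model_far {β w : ℂ} (hβ : β ≠ 0) (hw : 4 * ‖β‖ ≤ ‖w‖) : model β w = 1 := by
  have : 4 ≤ ‖w‖ / ‖β‖ := by rwa [le_div_iff₀ (norm_pos_iff.2 hβ)]
  have h : max 0 (min 1 (4 - ‖w‖ / ‖β‖)) = 0 := by
    rw [max_eq_left]; exact (min_le_right _ _).trans (by linarith)
  simp [model, h]

theorem model_near {β w : ℂ} (hβ : β ≠ 0) (hw : ‖w‖ ≤ 3 * ‖β‖) (hwβ : w ≠ β) :
    model β w = w / (w - β) := by
  have : ‖w‖ / ‖β‖ ≤ 3 := by rwa [div_le_iff₀ (norm_pos_iff.2 hβ)]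
  have h : max 0 (min 1 (4 - ‖w‖ / ‖β‖)) = 1 := by
    rw [min_eq_left (by linarith), max_eq_right zero_le_one]
  have h2 := sub_ne_zero.2 hwβ
  rw [model, h]
  field_simp
  push_cast
  ring

theorem model_ne_zero {β w : ℂ} (hβ : β ≠ 0) (hw : w ≠ 0) (hwβ : w ≠ β) : model β w ≠ 0 := by
  have hβ' := norm_pos_iff.2 hβ
  rcases le_total ‖w‖ (3 * ‖β‖) with h | h
  · rw [model_near hβ h hwβ]
    exact div_ne_zero hw (sub_ne_zero.2 hwβ)
  · intro h0
    have h1 : ((max 0 (min 1 (4 - ‖w‖ / ‖β‖)) : ℝ) : ℂ) * (β / (w - β)) = -1 := by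
      rw [model] at h0
      linear_combination h0
    have h2 := congrArg norm h1
    rw [norm_mul, norm_neg, norm_one, norm_div, Complex.norm_real] at h2
    have h3 : ‖max 0 (min 1 (4 - ‖w‖ / ‖β‖))‖ ≤ 1 := by
      rw [Real.norm_eq_abs, abs_of_nonneg (le_max_left _ _)]
      exact max_le zero_le_one (min_le_left _ _)
    have h4 : 2 * ‖β‖ ≤ ‖w - β‖ := by linarith [norm_sub_norm_le w β]
    have h5 : ‖β‖ / ‖w - β‖ ≤ 1 / 2 := by
      rw [div_le_div_iff₀ (by linarith) two_pos]; linarith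
    nlinarith [norm_nonneg (max 0 (min 1 (4 - ‖w‖ / ‖β‖))), div_nonneg hβ'.le (norm_nonneg (w - β))]

theorem continuousAt_model {β w : ℂ} (hwβ : w ≠ β) : ContinuousAt (model β) w := by
  have h2 := sub_ne_zero.2 hwβ
  unfold model
  refine continuousAt_const.add (ContinuousAt.mul ?_ ?_)
  · exact Continuous.continuousAt (by fun_prop)
  · exact continuousAt_const.div (by fun_prop) h2

end CurveAtlas

end

section

variable {E : Type*} [NormedAddCommGroup E] [NormedSpace ℂ E]

namespace CurveAtlas

variable {D C : Set E} {𝔞 : CurveAtlas D C}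

theorem eventually_hasDipole (hD : IsOpen D) {x : E} (hx : x ∈ C) :
    ∀ᶠ b in 𝓝[C] x, 𝔞.HasDipole x b := by
  classical
  have hch := 𝔞.chart x hx
  have hxU := 𝔞.mem x hx
  have hx0 := 𝔞.zero x hx
  have hr : 0 < 𝔞.r x := by
    have := hch.mem_ball x ⟨hx, hxU⟩
    exact pos_of_mem_ball this
  have hθ := hch.continuousAt hD hxU
  have hsm : ∀ᶠ b in 𝓝 x, 4 * ‖𝔞.θ x b‖ < 𝔞.r x := by
    have h1 : Tendsto (fun b => 4 * ‖𝔞.θ x b‖) (𝓝 x) (𝓝 (4 * ‖𝔞.θ x x‖)) :=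
      (hθ.tendsto.norm).const_mul 4
    exact h1.eventually_lt_const (by rw [hx0]; simpa using hr)
  filter_upwards [self_mem_nhdsWithin, nhdsWithin_le_nhds hsm,
    nhdsWithin_le_nhds (hch.isOpen.mem_nhds hxU)] with b hbC hbr hbU
  by_cases hbx : b = x
  · rw [hbx]; exact HasDipole.refl x
  set β := 𝔞.θ x b with hβdef
  have hβ : β ≠ 0 := by
    intro h0
    apply hbx
    calc b = 𝔞.χ x (𝔞.θ x b) := (hch.left b ⟨hbC, hbU⟩).symm
      _ = 𝔞.χ x (𝔞.θ x x) := by rw [← hβdef, h0, hx0]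
      _ = x := hch.left x ⟨hx, hxU⟩
  have hβ' := norm_pos_iff.2 hβ
  set s : E → ℂ := fun z => if z ∈ 𝔞.U x then model β (𝔞.θ x z) else 1 with hs
  have key : ∀ z₀ ∈ C, ∃ L, 𝔞.HasOrder s (dipole x b z₀) z₀ L := by
    intro z₀ hz₀
    by_cases hzU : z₀ ∈ 𝔞.U x
    · have htp := hch.tendsto_punctured hD ⟨hz₀, hzU⟩
      have hnU : ∀ᶠ z in 𝓝[C \ {z₀}] z₀, z ∈ 𝔞.U x :=
        nhdsWithin_le_nhds (hch.isOpen.mem_nhds hzU)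
      by_cases hzx : z₀ = x
      · subst hzx
        have hd : dipole z₀ b z₀ = 1 := by simp [dipole, Ne.symm hbx]
        refine ⟨1 / (0 - β), by simpa using hβ, ?_⟩
        rw [hd]
        rw [hx0] at htp
        have h1 : ∀ᶠ w in 𝓝[≠] (0 : ℂ), w ≠ 0 ∧ ‖w‖ < ‖β‖ := by
          filter_upwards [self_mem_nhdsWithin, nhdsWithin_le_nhds (ball_mem_nhds (0 : ℂ) hβ')]
            with w h h'
          exact ⟨h, by simpa using h'⟩
        have h2 : Tendsto (fun z => 1 / (𝔞.θ z₀ z - β)) (𝓝[C \ {z₀}] z₀) (𝓝 (1 / (0 - β))) :=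
          tendsto_const_nhds.div ((htp.mono_right nhdsWithin_le_nhds).sub_const β)
            (by simpa using hβ)
        refine h2.congr' ?_
        filter_upwards [htp.eventually h1, hnU] with z hz hzU'
        have hne : 𝔞.θ z₀ z ≠ β := fun h => by rw [h] at hz; exact lt_irrefl _ hz.2
        simp only [hs, if_pos hzU']
        rw [model_near hβ (by linarith [hz.2]) hne, zpow_one]
        have := hz.1
        field_simp
      by_cases hzb : z₀ = b
      · subst hzb
        have hd : dipole x z₀ z₀ = -1 := by simp [dipole, hbx]
        obtain ⟨μ, hμ, hμt⟩ := hch.transition (𝔞.chart z₀ hz₀) hD (F := id) (G := id)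
          differentiableOn_id differentiableOn_id (mapsTo_id C) (fun _ _ => rfl) ⟨hz₀, hzU⟩
          (𝔞.mem z₀ hz₀)
        refine ⟨β * μ, mul_ne_zero hβ hμ, ?_⟩
        rw [hd]
        have h1 : ∀ᶠ w in 𝓝[≠] β, w ≠ β ∧ ‖w‖ < 3 * ‖β‖ := by
          have : ∀ᶠ w in 𝓝 β, ‖w‖ < 3 * ‖β‖ :=
            (continuous_norm.tendsto β).eventually_lt_const (by linarith)
          filter_upwards [self_mem_nhdsWithin, nhdsWithin_le_nhds this] with w h h'
          exact ⟨h, h'⟩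
        refine ((htp.mono_right nhdsWithin_le_nhds).mul hμt).congr' ?_
        filter_upwards [htp.eventually h1, hnU] with z hz hzU'
        simp only [hs, if_pos hzU']
        rw [model_near hβ hz.2.le hz.1, zpow_neg_one, id, id, 𝔞.zero z₀ hz₀]
        simp only [sub_zero, div_inv_eq_mul]
        ring
      · have hd : dipole x b z₀ = 0 := by simp [dipole, hzx, hzb]
        have hne : 𝔞.θ x z₀ ≠ β := fun h => hzb (by
          rw [← hch.left b ⟨hbC, hbU⟩, ← hch.left z₀ ⟨hz₀, hzU⟩, h])
        have hne0 : 𝔞.θ x z₀ ≠ 0 := fun h => hzx (by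
          rw [← hch.left x ⟨hx, hxU⟩, ← hch.left z₀ ⟨hz₀, hzU⟩, h, hx0])
        refine ⟨model β (𝔞.θ x z₀), model_ne_zero hβ hne0 hne, ?_⟩
        rw [hd]
        refine ((continuousAt_model hne).tendsto.comp
          (htp.mono_right nhdsWithin_le_nhds)).congr' ?_
        filter_upwards [hnU] with z hz
        simp [hs, hz]
    · have hzx : z₀ ≠ x := fun h => hzU (h ▸ hxU)
      have hzb : z₀ ≠ b := fun h => hzU (h ▸ hbU)
      have hd : dipole x b z₀ = 0 := by simp [dipole, hzx, hzb]
      refine ⟨1, one_ne_zero, ?_⟩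
      rw [hd]
      have hsub : closedBall (0 : ℂ) (4 * ‖β‖) ⊆ ball 0 (𝔞.r x) := closedBall_subset_ball hbr
      have hK : IsCompact (𝔞.χ x '' closedBall 0 (4 * ‖β‖)) :=
        (isCompact_closedBall _ _).image_of_continuousOn (hch.holo_inv.continuousOn.mono hsub)
      have hzK : z₀ ∉ 𝔞.χ x '' closedBall 0 (4 * ‖β‖) := by
        rintro ⟨w, hw, rfl⟩
        exact hzU (hch.mem w (hsub hw)).2
      refine tendsto_const_nhds.congr' ?_
      filter_upwards [self_mem_nhdsWithin,
        nhdsWithin_le_nhds (hK.isClosed.isOpen_compl.mem_nhds hzK)] with z hzC hzK'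
      simp only [hs, zpow_zero, div_one]
      split_ifs with hzU'
      · rw [model_far hβ]
        by_contra! hlt
        refine hzK' ⟨𝔞.θ x z, ?_, hch.left z ⟨hzC.1, hzU'⟩⟩
        simpa using hlt.le
      · rfl
  choose! L hL using key
  exact ⟨s, L, hL⟩

theorem hasDipole (hD : IsOpen D) (hC : IsPreconnected C) {a b : E} (ha : a ∈ C) (hb : b ∈ C) :
    𝔞.HasDipole a b := by
  refine hC.induction₂ (fun u v => 𝔞.HasDipole u v) (fun x hx => eventually_hasDipole hD hx)
    (fun x y z _ _ _ h h' => h.trans hD h') (fun x y _ _ h => h.symm) ha hb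

theorem neBot (𝔞 : CurveAtlas D C) {x : E} (hx : x ∈ C) : (𝓝[C \ {x}] x).NeBot :=
  (𝔞.chart x hx).neBot ⟨hx, 𝔞.mem x hx⟩

/-- Punctured limits of a function are continuous. -/
theorem continuousOn_limits {h c : E → ℂ}
    (ht : ∀ x ∈ C, Tendsto h (𝓝[C \ {x}] x) (𝓝 (c x)))
    (hne : ∀ x ∈ C, (𝓝[C \ {x}] x).NeBot) : ContinuousOn c C := by
  intro x hx
  refine (closed_nhds_basis (c x)).tendsto_right_iff.2 fun s hs => ?_
  obtain ⟨V, hV, hVo, hxV⟩ : ∃ V, V ∩ (C \ {x}) ⊆ h ⁻¹' s ∧ IsOpen V ∧ x ∈ V := by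
    have := (ht x hx) hs.1
    rw [Filter.mem_map, mem_nhdsWithin] at this
    obtain ⟨V, h1, h2, h3⟩ := this
    exact ⟨V, h3, h1, h2⟩
  filter_upwards [self_mem_nhdsWithin, nhdsWithin_le_nhds (hVo.mem_nhds hxV)] with y hyC hyV
  by_cases hyx : y = x
  · rw [hyx]; exact mem_of_mem_nhds hs.1
  have := hne y hyC
  refine hs.2.mem_of_tendsto (ht y hyC) ?_
  filter_upwards [self_mem_nhdsWithin, nhdsWithin_le_nhds (hVo.mem_nhds hyV),
    nhdsWithin_le_nhds (isOpen_ne.mem_nhds hyx)] with z hz hzV hzx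
  exact hV ⟨hzV, hz.1, hzx⟩

end CurveAtlas

end

section

variable {E : Type*} [NormedAddCommGroup E] [NormedSpace ℂ E]

namespace CurveAtlas

variable {D C : Set E} {𝔞 : CurveAtlas D C}

theorem tendsto_map (𝔞 : CurveAtlas D C) (hD : IsOpen D) {F G : E → E}
    (hF : DifferentiableOn ℂ F D)
    (hFC : MapsTo F C C) (hGF : ∀ z ∈ C, G (F z) = z) {x : E} (hx : x ∈ C) :
    Tendsto F (𝓝[C \ {x}] x) (𝓝[C \ {F x}] (F x)) := by
  have hxD := (𝔞.chart x hx).subset (𝔞.mem x hx)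
  refine tendsto_nhdsWithin_iff.2
    ⟨((hF.differentiableAt (hD.mem_nhds hxD)).continuousAt.tendsto).mono_left
      nhdsWithin_le_nhds, ?_⟩
  filter_upwards [self_mem_nhdsWithin] with z hz
  refine ⟨hFC hz.1, fun h => hz.2 ?_⟩
  rw [mem_singleton_iff] at h ⊢
  rw [← hGF z hz.1, h, hGF x hx]

theorem dipole_map {F G : E → E} (hGF : ∀ z ∈ C, G (F z) = z) {y y' x : E} (hy : y ∈ C)
    (hy' : y' ∈ C) (hFy : F y = y) (hFy' : F y' = y') (hx : x ∈ C) :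
    dipole y y' (F x) = dipole y y' x := by
  have key : ∀ u ∈ C, F u = u → (F x = u ↔ x = u) := fun u hu hFu =>
    ⟨fun h => by rw [← hGF x hx, ← hGF u hu, h, hFu], fun h => by rw [h, hFu]⟩
  classical
  unfold dipole
  congr 1
  · exact if_congr (key y hy hFy) rfl rfl
  · exact if_congr (key y' hy' hFy') rfl rfl

/-- The quotient of a section by its pullback has continuous values. -/
theorem HasOrder.quotient (hD : IsOpen D) {F G : E → E} (hF : DifferentiableOn ℂ F D)
    (hFC : MapsTo F C C) (hGF : ∀ z ∈ C, G (F z) = z) {s : E → ℂ} {k : ℤ} {x : E} {L L' μ : ℂ}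
    (hx : x ∈ C) (h : 𝔞.HasOrder s k x L) (h' : 𝔞.HasOrder s k (F x) L')
    (hμ : μ ≠ 0)
    (hμt : Tendsto (fun z => 𝔞.θ (F x) (F z) / 𝔞.θ x z) (𝓝[C \ {x}] x) (𝓝 μ)) :
    Tendsto (fun z => s (F z) / s z) (𝓝[C \ {x}] x) (𝓝 (L' * μ ^ k / L)) := by
  have hm := tendsto_map 𝔞 hD hF hFC hGF hx
  refine (((h'.2.comp hm).mul (hμt.zpow₀ k (Or.inl hμ))).div h.2 h.1).congr' ?_
  filter_upwards [ne_zero (𝔞 := 𝔞) hD hx, hm.eventually (ne_zero (𝔞 := 𝔞) hD (hFC hx))] with z hz hz'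
  have h1 := zpow_ne_zero k hz
  have h2 := zpow_ne_zero k hz'
  simp only [Function.comp, div_zpow, Pi.div_apply]
  field_simp

theorem exists_multiplier (hD : IsOpen D) (hC : IsPreconnected C) {F G : E → E}
    (hF : DifferentiableOn ℂ F D) (hG : DifferentiableOn ℂ G D) (hFC : MapsTo F C C)
    (hGF : ∀ z ∈ C, G (F z) = z) {y y' : E} (hy : y ∈ C) (hy' : y' ∈ C)
    (hne : y ≠ y') (hFy : F y = y) (hFy' : F y' = y') {l l' : ℂ}
    (hl : ∀ z ∈ C, z ∈ 𝔞.U y → 𝔞.θ y (F z) = l * 𝔞.θ y z)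
    (hl' : ∀ z ∈ C, z ∈ 𝔞.U y' → 𝔞.θ y' (F z) = l' * 𝔞.θ y' z) :
    ∃ c : E → ℂ, ContinuousOn c C ∧ (∀ x ∈ C, c x ≠ 0) ∧ c y = l ∧ c y' = l'⁻¹ ∧
      (∀ x ∈ C, F x = x → x ≠ y → x ≠ y' → c x = 1) ∧
      ∀ m : ℕ, l ^ m = 1 → l' ^ m = 1 → ∀ x ∈ C, F^[m] x = x →
        ∏ j ∈ Finset.range m, c (F^[j] x) = 1 := by
  obtain ⟨s, L, hs⟩ := hasDipole (𝔞 := 𝔞) hD hC hy hy'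
  have hμ : ∀ x ∈ C, ∃ μ ≠ 0,
      Tendsto (fun z => 𝔞.θ (F x) (F z) / 𝔞.θ x z) (𝓝[C \ {x}] x) (𝓝 μ) := by
    intro x hx
    obtain ⟨μ, h1, h2⟩ := (𝔞.chart x hx).transition (𝔞.chart (F x) (hFC hx)) hD hF hG hFC hGF
      ⟨hx, 𝔞.mem x hx⟩ (𝔞.mem _ (hFC hx))
    refine ⟨μ, h1, ?_⟩
    simpa only [𝔞.zero x hx, 𝔞.zero _ (hFC hx), sub_zero] using h2
  choose! μ hμ0 hμt using hμ
  have hval : ∀ u ∈ C, F u = u → ∀ {a : ℂ}, (∀ z ∈ C, z ∈ 𝔞.U u → 𝔞.θ u (F z) = a * 𝔞.θ u z) →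
      μ u = a := by
    intro u hu hFu a ha
    have := neBot 𝔞 hu
    have h1 := hμt u hu
    rw [hFu] at h1
    refine tendsto_nhds_unique h1 (tendsto_const_nhds.congr' ?_)
    filter_upwards [self_mem_nhdsWithin, ne_zero hD hu,
      nhdsWithin_le_nhds ((𝔞.chart u hu).isOpen.mem_nhds (𝔞.mem u hu))] with z hz hz0 hzU
    rw [ha z hz.1 hzU, mul_div_cancel_right₀ _ hz0]
  have hL : ∀ x ∈ C, L x ≠ 0 := fun x hx => (hs x hx).1
  set c : E → ℂ := fun x => L (F x) * μ x ^ dipole y y' x / L x with hc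
  have hfix : ∀ x ∈ C, F x = x → c x = μ x ^ dipole y y' x := fun x hx hFx => by
    simp only [hc, hFx]
    field_simp [hL x hx]
  have hcy : c y = l := by
    rw [hfix y hy hFy, hval y hy hFy hl]
    simp [dipole, hne]
  have hcy' : c y' = l'⁻¹ := by
    rw [hfix y' hy' hFy', hval y' hy' hFy' hl']
    simp [dipole, hne.symm]
  refine ⟨c, ?_, ?_, hcy, hcy', ?_, ?_⟩
  · refine continuousOn_limits (h := fun z => s (F z) / s z) (fun x hx => ?_)
      (fun x hx => neBot 𝔞 hx)
    refine (hs x hx).quotient hD hF hFC hGF hx ?_ (hμ0 x hx) (hμt x hx)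
    rw [← dipole_map hGF hy hy' hFy hFy' hx]
    exact hs _ (hFC hx)
  · exact fun x hx => div_ne_zero (mul_ne_zero (hL _ (hFC hx)) (zpow_ne_zero _ (hμ0 x hx))) (hL x hx)
  · intro x hx hFx h1 h2
    rw [hfix x hx hFx]
    simp [dipole, h1, h2]
  · intro m hm hm' x hx hmx
    have hit : ∀ u, F u = u → ∀ j, F^[j] u = u := fun u hu j => Function.iterate_fixed hu j
    by_cases hxy : x = y
    · subst hxy
      simp only [hit x hFy, hcy, Finset.prod_const, Finset.card_range, hm]
    by_cases hxy' : x = y'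
    · subst hxy'
      simp only [hit x hFy', hcy', Finset.prod_const, Finset.card_range, inv_pow, hm', inv_one]
    have hC' : ∀ j, F^[j] x ∈ C := fun j => hFC.iterate j hx
    have hd : ∀ j, dipole y y' (F^[j] x) = 0 := by
      intro j
      induction j with
      | zero => simp [dipole, hxy, hxy']
      | succ j ih =>
        rw [Function.iterate_succ_apply', dipole_map hGF hy hy' hFy hFy' (hC' j), ih]
    have : ∀ j ∈ Finset.range m, c (F^[j] x) = L (F^[j + 1] x) / L (F^[j] x) := fun j _ => by
      simp only [hc, hd, zpow_zero, mul_one, Function.iterate_succ_apply']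
    rw [Finset.prod_congr rfl this]
    have htel : ∀ j, ∏ i ∈ Finset.range j, L (F^[i + 1] x) / L (F^[i] x) = L (F^[j] x) / L x := by
      intro j
      induction j with
      | zero => simp [hL x hx]
      | succ j ih => rw [Finset.prod_range_succ, ih, mul_comm, div_mul_div_cancel₀ (hL _ (hC' j))]
    rw [htel, hmx, div_self (hL x hx)]

end CurveAtlas

end

section

/-- The `k`-th point of the subdivision of the unit interval in `n` parts. -/
def gridPoint (n k : ℕ) : unitInterval := projIcc 0 1 zero_le_one ((k : ℝ) / n)

theorem gridPoint_zero (n : ℕ) : gridPoint n 0 = 0 := by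
  simp [gridPoint, projIcc_left]

theorem gridPoint_self {n : ℕ} (hn : n ≠ 0) : gridPoint n n = 1 := by
  have : (n : ℝ) / n = 1 := div_self (Nat.cast_ne_zero.2 hn)
  simp [gridPoint, this, projIcc_right]

theorem eventually_grid {M : Type*} [PseudoMetricSpace M] {h : unitInterval → M}
    (hh : Continuous h) {δ : ℝ} (hδ : 0 < δ) :
    ∀ᶠ n in atTop, ∀ k, dist (h (gridPoint n k)) (h (gridPoint n (k + 1))) < δ := by
  obtain ⟨η, hη, hu⟩ := Metric.uniformContinuous_iff.1
    (CompactSpace.uniformContinuous_of_continuous hh) δ hδ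
  have h1 : ∀ᶠ n : ℕ in atTop, 1 / (n : ℝ) < η :=
    (tendsto_one_div_atTop_nhds_zero_nat).eventually_lt_const hη
  filter_upwards [h1, eventually_gt_atTop 0] with n hn hn0 k
  refine hu (lt_of_le_of_lt ?_ hn)
  have h2 := (LipschitzWith.projIcc (zero_le_one : (0 : ℝ) ≤ 1)).dist_le_mul
    ((k : ℝ) / n) (((k + 1 : ℕ) : ℝ) / n)
  refine h2.trans (le_of_eq ?_)
  rw [Real.dist_eq, ← sub_div]
  push_cast
  rw [show (k : ℝ) - (k + 1) = -1 by ring, abs_div, abs_neg, abs_one, Nat.abs_cast]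
  simp

/-- The variation of a continuous lift is the sum of logarithms along a fine subdivision. -/
theorem eventually_sum_log {g : unitInterval → ℂ} (hg : Continuous g) :
    ∀ᶠ n in atTop, ∑ k ∈ Finset.range n,
      Complex.log (Complex.exp (g (gridPoint n (k + 1))) / Complex.exp (g (gridPoint n k))) =
        g 1 - g 0 := by
  filter_upwards [eventually_grid hg one_pos, eventually_ne_atTop 0] with n hn hn0
  have h1 : ∀ k, Complex.log (Complex.exp (g (gridPoint n (k + 1))) /
      Complex.exp (g (gridPoint n k))) = g (gridPoint n (k + 1)) - g (gridPoint n k) := by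
    intro k
    have h2 : ‖g (gridPoint n (k + 1)) - g (gridPoint n k)‖ < 1 := by
      rw [← dist_eq_norm, dist_comm]; exact hn k
    have h3 := abs_le.1 ((Complex.abs_im_le_norm _).trans h2.le)
    rw [← Complex.exp_sub, Complex.log_exp] <;> linarith [Real.pi_gt_three, h3.1, h3.2]
  rw [Finset.sum_congr rfl fun k _ => h1 k, Finset.sum_range_sub (fun k => g (gridPoint n k)),
    gridPoint_self hn0, gridPoint_zero]

theorem sub_eq_of_exp_eq {g g' : unitInterval → ℂ} (hg : Continuous g) (hg' : Continuous g')
    (h : ∀ t, Complex.exp (g t) = Complex.exp (g' t)) : g 1 - g 0 = g' 1 - g' 0 := by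
  obtain ⟨n, h1, h2⟩ := ((eventually_sum_log hg).and (eventually_sum_log hg')).exists
  rw [← h1, ← h2]
  exact Finset.sum_congr rfl fun k _ => by rw [h, h]

section

variable {E : Type*} [TopologicalSpace E] {u v w : E}

/-- The logarithm of `c` varies by `a` along `γ`. -/
def HasVar (c : E → ℂ) (γ : Path u v) (a : ℂ) : Prop :=
  ∃ g : unitInterval → ℂ, Continuous g ∧ (∀ t, Complex.exp (g t) = c (γ t)) ∧ g 1 - g 0 = a

namespace HasVar

variable {c : E → ℂ} {γ : Path u v} {γ' : Path v w} {a b : ℂ}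

theorem exp_eq (h : HasVar c γ a) : Complex.exp a = c v / c u := by
  obtain ⟨g, -, h1, rfl⟩ := h
  rw [Complex.exp_sub, h1, h1, γ.target, γ.source]

theorem exists_of_continuous (hc : Continuous fun t => c (γ t)) (h0 : ∀ t, c (γ t) ≠ 0) :
    ∃ a, HasVar c γ a := by
  have hs : IsSimplyConnected (univ : Set ℝ) := by
    have : ContractibleSpace (univ : Set ℝ) :=
      convex_univ.contractibleSpace ⟨0, mem_univ 0⟩
    exact SimplyConnectedSpace.ofContractible _
  obtain ⟨f, hf, hfe⟩ := Complex.exists_continuousOn_eqOn_exp_comp hs isOpen_univ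
    (g := fun t : ℝ => c (γ (projIcc 0 1 zero_le_one t)))
    (hc.comp continuous_projIcc).continuousOn (by rintro ⟨t, -, ht⟩; exact h0 _ ht)
  refine ⟨_, fun t => f t, ?_, fun t => ?_, rfl⟩
  · exact (continuousOn_univ.1 hf).comp continuous_subtype_val
  · have := hfe (mem_univ (t : ℝ))
    simpa using this

theorem symm (h : HasVar c γ a) : HasVar c γ.symm (-a) := by
  obtain ⟨g, h0, h1, rfl⟩ := h
  refine ⟨fun t => g (unitInterval.symm t), h0.comp unitInterval.continuous_symm,
    fun t => h1 _, by simp⟩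

theorem refl (hu : c u ≠ 0) : HasVar c (Path.refl u) 0 :=
  ⟨fun _ => Complex.log (c u), continuous_const, fun t => by simp [Complex.exp_log hu], by simp⟩

theorem trans (h : HasVar c γ a) (h' : HasVar c γ' b) : HasVar c (γ.trans γ') (a + b) := by
  obtain ⟨g, h0, h1, rfl⟩ := h
  obtain ⟨g', h0', h1', rfl⟩ := h'
  have hcv : Complex.exp (g 1 - g' 0) = 1 := by
    have hne := Complex.exp_ne_zero (g' 0)
    rw [h1'] at hne
    rw [Complex.exp_sub, h1, h1', γ.target, γ'.source, div_self (by simpa using hne)]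
  let Γ : Path (g 0) (g 1) := ⟨⟨g, h0⟩, rfl, rfl⟩
  let Γ' : Path (g 1) (g' 1 + (g 1 - g' 0)) :=
    ⟨⟨fun t => g' t + (g 1 - g' 0), by fun_prop⟩, by simp, rfl⟩
  refine ⟨Γ.trans Γ', (Γ.trans Γ').continuous, fun t => ?_, ?_⟩
  · rw [Path.trans_apply, Path.trans_apply]
    split_ifs
    · exact h1 _
    · change Complex.exp (g' _ + (g 1 - g' 0)) = _
      rw [Complex.exp_add, hcv, mul_one, h1']
  · rw [(Γ.trans Γ').target, (Γ.trans Γ').source]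
    ring

/-- Along a path where `c` changes little, the variation is a logarithm. -/
theorem of_close (hu : c u ≠ 0) (hc : Continuous fun t => c (γ t))
    (h : ∀ t, ‖c (γ t) / c u - 1‖ < 1) : HasVar c γ (Complex.log (c v / c u)) := by
  have hne : ∀ t, c (γ t) / c u ∈ Complex.slitPlane := fun t => by
    have h2 := (abs_lt.1 ((Complex.abs_re_le_norm _).trans_lt (h t))).1
    refine Or.inl ?_
    simp only [Complex.sub_re, Complex.one_re] at h2
    linarith
  refine ⟨fun t => Complex.log (c (γ t) / c u) + Complex.log (c u), ?_, fun t => ?_, ?_⟩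
  · exact (Continuous.clog (hc.div_const _) hne).add continuous_const
  · rw [Complex.exp_add, Complex.exp_log (Complex.slitPlane_ne_zero (hne t)), Complex.exp_log hu,
      div_mul_cancel₀ _ hu]
  · simp [div_self hu]

theorem unique (h : HasVar c γ a) (h' : HasVar c γ b) : a = b := by
  obtain ⟨g, h0, h1, rfl⟩ := h
  obtain ⟨g', h0', h1', rfl⟩ := h'
  exact sub_eq_of_exp_eq h0 h0' fun t => by rw [h1, h1']

theorem eventually_sum (h : HasVar c γ a) : ∀ᶠ n in atTop, ∑ k ∈ Finset.range n,
    Complex.log (c (γ (gridPoint n (k + 1))) / c (γ (gridPoint n k))) = a := by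
  obtain ⟨g, h0, h1, rfl⟩ := h
  filter_upwards [eventually_sum_log h0] with n hn
  rw [← hn]
  exact Finset.sum_congr rfl fun k _ => by rw [h1, h1]

/-- If a product of functions is one, the variations add up to zero. -/
theorem sum_eq_zero {ι : Type*} {s : Finset ι} {p q : ι → E} {δ : ∀ j, Path (p j) (q j)}
    {d : ι → ℂ} (h : ∀ j ∈ s, HasVar c (δ j) (d j)) (hprod : ∀ t, ∏ j ∈ s, c (δ j t) = 1) :
    ∑ j ∈ s, d j = 0 := by
  choose! g h0 h1 h2 using h
  have := sub_eq_of_exp_eq (g := fun t => ∑ j ∈ s, g j t) (g' := fun _ => 0)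
    (continuous_finsetSum _ fun j hj => h0 j hj) continuous_const fun t => by
      rw [Complex.exp_sum, Complex.exp_zero, ← hprod t]
      exact Finset.prod_congr rfl fun j hj => h1 j hj t
  rw [← Finset.sum_sub_distrib, sub_self] at this
  rw [← this]
  exact Finset.sum_congr rfl fun j hj => (h2 j hj).symm

end HasVar

end

end

section

namespace ListChain

variable {X : Type*} {p : ℕ}

/-- Reduction of integral chains. -/
def reduce (p : ℕ) : ListChain ℤ X →+ ListChain (ZMod p) X :=
  Finsupp.mapRange.addMonoidHom (Int.castAddHom (ZMod p))

theorem reduce_apply (c : ListChain ℤ X) (σ : List X) : reduce p c σ = ((c σ : ℤ) : ZMod p) := rfl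

theorem reduce_simplex (σ : List X) : reduce p (simplex ℤ σ) = simplex (ZMod p) σ := by
  simp [reduce, simplex]

theorem reduce_smul (n : ℤ) (c : ListChain ℤ X) : reduce p (n • c) = (n : ZMod p) • reduce p c := by
  ext σ
  simp [reduce_apply]

theorem addHom_ext' {M : Type*} [AddCommGroup M] {S T : ListChain ℤ X →+ M}
    (h : ∀ σ, S (simplex ℤ σ) = T (simplex ℤ σ)) (c : ListChain ℤ X) : S c = T c := by
  have : S.toIntLinearMap = T.toIntLinearMap := hom_ext h
  exact LinearMap.congr_fun this c

theorem reduce_cone (x : X) (c : ListChain ℤ X) : reduce p (cone x c) = cone x (reduce p c) :=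
  addHom_ext' (S := (reduce p).comp (cone x).toAddMonoidHom)
    (T := (cone x).toAddMonoidHom.comp (reduce p)) (fun σ => by simp [reduce_simplex]) c

theorem reduce_bd (c : ListChain ℤ X) : reduce p (bd c) = bd (reduce p c) := by
  refine addHom_ext' (S := (reduce p).comp bd.toAddMonoidHom)
    (T := bd.toAddMonoidHom.comp (reduce p)) (fun σ => ?_) c
  simp only [AddMonoidHom.comp_apply, LinearMap.toAddMonoidHom_coe, reduce_simplex]
  induction σ with
  | nil => simp
  | cons x σ ih => rw [bd_cons, bd_cons, map_sub, reduce_simplex, reduce_cone, ih]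

theorem reduce_mem {S : Set (List X)} {c : ListChain ℤ X} (hc : c ∈ on ℤ S) :
    reduce p c ∈ on (ZMod p) S := by
  rw [Finsupp.mem_supported] at hc ⊢
  refine Set.Subset.trans (Finset.coe_subset.2 ?_) hc
  exact Finsupp.support_mapRange (hf := map_zero (Int.castAddHom (ZMod p)))

theorem exists_reduce_eq [NeZero p] {S : Set (List X)} {c : ListChain (ZMod p) X}
    (hc : c ∈ on (ZMod p) S) : ∃ c' ∈ on ℤ S, reduce p c' = c := by
  refine ⟨c.mapRange (fun a => (a.val : ℤ)) (by simp), ?_, ?_⟩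
  · rw [Finsupp.mem_supported] at hc ⊢
    exact (Finset.coe_subset.2 Finsupp.support_mapRange).trans hc
  · ext σ
    simp [reduce_apply]

theorem exists_smul_eq {S : Set (List X)} {c : ListChain ℤ X} (hc : c ∈ on ℤ S)
    (h : reduce p c = 0) : ∃ c' ∈ on ℤ S, c = (p : ℤ) • c' := by
  refine ⟨c.mapRange (fun a => a / (p : ℤ)) (by simp), ?_, ?_⟩
  · rw [Finsupp.mem_supported] at hc ⊢
    exact (Finset.coe_subset.2 Finsupp.support_mapRange).trans hc
  · ext σ
    have h1 : ((c σ : ℤ) : ZMod p) = 0 := by rw [← reduce_apply, h]; rfl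
    have h2 := (ZMod.intCast_zmod_eq_zero_iff_dvd _ _).1 h1
    simp [Int.mul_ediv_cancel' h2]

section Edge

variable {M : Type*} [AddCommGroup M] {E : Type*} [PseudoMetricSpace E]

/-- The cochain of a function on edges. -/
def edgeSum (w : E → E → M) : ListChain ℤ E →ₗ[ℤ] M :=
  extend fun σ => match σ with
    | [u, v] => w u v
    | _ => 0

/-- The cochain of a function on vertices. -/
def vertexSum (P : E → M) : ListChain ℤ E →ₗ[ℤ] M :=
  extend fun σ => match σ with
    | [u] => P u
    | _ => 0

theorem edgeSum_pair (w : E → E → M) (u v : E) : edgeSum w (simplex ℤ [u, v]) = w u v := by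
  simp [edgeSum]

theorem vertexSum_single (P : E → M) (u : E) : vertexSum P (simplex ℤ [u]) = P u := by
  simp [vertexSum]

theorem bd_pair (u v : E) : bd (simplex ℤ [u, v]) = simplex ℤ [v] - simplex ℤ [u] := by
  simp [bd_cons]

theorem bd_triple (u v t : E) :
    bd (simplex ℤ [u, v, t]) = simplex ℤ [v, t] - (simplex ℤ [u, t] - simplex ℤ [u, v]) := by
  simp [bd_cons]

theorem exists_sum_eq_smul [NeZero p] {K : Set E} {ε : ℝ} {Λ : Submodule ℤ M} {w : E → E → M}
    {P : E → M}
    (hw : ∀ u ∈ K, ∀ v ∈ K, ∀ t ∈ K, dist u v ≤ ε → dist v t ≤ ε → dist u t ≤ ε →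
      w u v + w v t = w u t)
    (hP : ∀ u ∈ K, ∀ v ∈ K, dist u v ≤ ε → w u v - (P v - P u) ∈ Λ) {n : ℕ}
    {a : Fin n → ListChain ℤ E} (ha : ∀ i, a i ∈ on ℤ (nearLists K ε 2))
    (hbd : ∀ i, bd (a i) = 0) {x : Fin n → ZMod p} {e : ListChain (ZMod p) E}
    (he : e ∈ on (ZMod p) (nearLists K ε 3)) (hbe : bd e = ∑ i, x i • reduce p (a i)) :
    ∃ l ∈ Λ, ∑ i, ((x i).val : ℤ) • edgeSum w (a i) = (p : ℤ) • l := by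
  obtain ⟨e', he', rfl⟩ := exists_reduce_eq he
  have hbde' : bd e' ∈ on ℤ (nearLists K ε 2) := by
    refine bd_mem (S := nearLists K ε 3) (fun σ hσ τ hτ hl => ?_) he'
    have := hσ.1
    exact ⟨by omega, fun y hy => hσ.2.1 y (hτ.subset hy),
      fun y hy z hz => hσ.2.2 y (hτ.subset hy) z (hτ.subset hz)⟩
  have hwe : edgeSum w (bd e') = 0 := by
    refine eq_of_simplex (edgeSum w ∘ₗ bd) 0 (fun σ hσ => ?_) he'
    obtain ⟨u, v, t, rfl⟩ := List.length_eq_three.1 hσ.1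
    have h1 := hw u (hσ.2.1 u (by simp)) v (hσ.2.1 v (by simp)) t (hσ.2.1 t (by simp))
      (hσ.2.2 u (by simp) v (by simp)) (hσ.2.2 v (by simp) t (by simp))
      (hσ.2.2 u (by simp) t (by simp))
    rw [LinearMap.comp_apply, bd_triple, map_sub, map_sub, edgeSum_pair, edgeSum_pair,
      edgeSum_pair, ← h1]
    simp
  set z : ListChain ℤ E := ∑ i, ((x i).val : ℤ) • a i - bd e' with hz
  have hzS : z ∈ on ℤ (nearLists K ε 2) :=
    Submodule.sub_mem _ (Submodule.sum_mem _ fun i _ => Submodule.smul_mem _ _ (ha i)) hbde'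
  have hzr : reduce p z = 0 := by
    rw [hz, map_sub, map_sum, reduce_bd, hbe]
    simp [reduce_smul]
  obtain ⟨z', hz', hzz'⟩ := exists_smul_eq hzS hzr
  have hbz : bd z = 0 := by
    rw [hz, map_sub, map_sum, bd_bd]
    simp [hbd]
  have hbz' : bd z' = 0 := by
    rw [hzz', map_smul] at hbz
    exact (smul_eq_zero.1 hbz).resolve_left (by exact_mod_cast NeZero.ne p)
  have hl : (edgeSum w - vertexSum P ∘ₗ bd) z' ∈ Λ := by
    refine map_mem_of_simplex _ (fun σ hσ => ?_) hz'
    obtain ⟨u, v, rfl⟩ := List.length_eq_two.1 hσ.1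
    rw [LinearMap.sub_apply, LinearMap.comp_apply, bd_pair, map_sub, edgeSum_pair,
      vertexSum_single, vertexSum_single]
    exact hP u (hσ.2.1 u (by simp)) v (hσ.2.1 v (by simp)) (hσ.2.2 u (by simp) v (by simp))
  rw [LinearMap.sub_apply, LinearMap.comp_apply, hbz', map_zero, sub_zero] at hl
  refine ⟨_, hl, ?_⟩
  rw [← map_smul, ← hzz', hz, map_sub, hwe, sub_zero, map_sum]
  simp

end Edge

end ListChain

end

section

section Vars

variable {E : Type*} [TopologicalSpace E] {ι : Type*} {C : Set E} {c : ι → E → ℂ} {u v w : E}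
  {a b : ι → ℂ}

/-- `a` is the variation of the family `c` along some path in `C`. -/
def Vars (C : Set E) (c : ι → E → ℂ) (u v : E) (a : ι → ℂ) : Prop :=
  ∃ γ : Path u v, (∀ t, γ t ∈ C) ∧ ∀ i, HasVar (c i) γ (a i)

namespace Vars

theorem symm (h : Vars C c u v a) : Vars C c v u (-a) := by
  obtain ⟨γ, h1, h2⟩ := h
  exact ⟨γ.symm, fun t => h1 _, fun i => (h2 i).symm⟩

theorem trans (h : Vars C c u v a) (h' : Vars C c v w b) : Vars C c u w (a + b) := by
  obtain ⟨γ, h1, h2⟩ := h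
  obtain ⟨γ', h1', h2'⟩ := h'
  refine ⟨γ.trans γ', fun t => ?_, fun i => (h2 i).trans (h2' i)⟩
  rw [Path.trans_apply]
  split_ifs
  · exact h1 _
  · exact h1' _

theorem refl (hu : u ∈ C) (h0 : ∀ i, c i u ≠ 0) : Vars C c u u 0 :=
  ⟨Path.refl u, fun _ => hu, fun i => HasVar.refl (h0 i)⟩

theorem exp_eq (h : Vars C c u v a) (i : ι) : Complex.exp (a i) = c i v / c i u := by
  obtain ⟨γ, -, h2⟩ := h
  exact (h2 i).exp_eq

theorem exists_of_joined (hc : ∀ i, ContinuousOn (c i) C) (h0 : ∀ i, ∀ x ∈ C, c i x ≠ 0)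
    (h : JoinedIn C u v) : ∃ a, Vars C c u v a := by
  obtain ⟨γ, hγ⟩ := h
  have : ∀ i, ∃ a, HasVar (c i) γ a := fun i => HasVar.exists_of_continuous
    ((hc i).comp_continuous γ.continuous hγ) fun t => h0 i _ (hγ t)
  choose a ha using this
  exact ⟨a, γ, hγ, ha⟩

theorem of_close (hc : ∀ i, ContinuousOn (c i) C) (h0 : ∀ i, c i u ≠ 0)
    (h : JoinedIn (C ∩ {q | ∀ i, ‖c i q / c i u - 1‖ < 1 / 4}) u v) :
    Vars C c u v fun i => Complex.log (c i v / c i u) := by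
  obtain ⟨γ, hγ⟩ := h
  exact ⟨γ, fun t => (hγ t).1, fun i => HasVar.of_close (h0 i)
    ((hc i).comp_continuous γ.continuous fun t => (hγ t).1)
    fun t => ((hγ t).2 i).trans (by norm_num)⟩

end Vars

/-- The variations along loops. -/
def periods {y : E} (hy : y ∈ C) (h0 : ∀ i, c i y ≠ 0) : Submodule ℤ (ι → ℂ) :=
  AddSubgroup.toIntSubmodule
    { carrier := {a | Vars C c y y a}
      add_mem' := fun h h' => Vars.trans h h'
      zero_mem' := Vars.refl hy h0
      neg_mem' := fun h => Vars.symm h }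

theorem mem_periods {y : E} {hy : y ∈ C} {h0 : ∀ i, c i y ≠ 0} :
    a ∈ periods hy h0 ↔ Vars C c y y a := Iff.rfl

end Vars

theorem log_add_log {a b : ℂ} (ha : ‖a - 1‖ < 1 / 4) (hb : ‖b - 1‖ < 1 / 4) :
    Complex.log a + Complex.log b = Complex.log (a * b) := by
  have key : ∀ {z : ℂ}, ‖z - 1‖ < 1 / 4 → z ≠ 0 ∧ |z.arg| < Real.pi / 2 := fun {z} hz => by
    have h2 := (abs_lt.1 ((Complex.abs_re_le_norm _).trans_lt hz)).1
    simp only [Complex.sub_re, Complex.one_re] at h2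
    have h3 : 0 < z.re := by linarith
    exact ⟨fun h => by simp [h] at h3, Complex.abs_arg_lt_pi_div_two_iff.2 (Or.inl h3)⟩
  obtain ⟨ha0, ha1⟩ := key ha
  obtain ⟨hb0, hb1⟩ := key hb
  rw [abs_lt] at ha1 hb1
  exact (Complex.log_mul ha0 hb0 ⟨by linarith [ha1.1, hb1.1], by linarith [ha1.2, hb1.2]⟩).symm

section

variable {E : Type*} [NormedAddCommGroup E] [NormedSpace ℂ E] {D X : Set E} {y : E} {ι : Type*}
  [Finite ι] {c : ι → E → ℂ} {p : ℕ}

open ListChain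

theorem exists_nhds_ratio (hc : ∀ i, ContinuousOn (c i) (pathComponentIn X y))
    (h0 : ∀ i, ∀ x ∈ pathComponentIn X y, c i x ≠ 0) {x : E} (hx : x ∈ pathComponentIn X y) :
    ∃ O ∈ 𝓝 x, ∀ u ∈ pathComponentIn X y ∩ O, ∀ q ∈ pathComponentIn X y ∩ O,
      ∀ i, ‖c i q / c i u - 1‖ < 1 / 4 := by
  have h1 : ∀ᶠ z : E × E in 𝓝[pathComponentIn X y] x ×ˢ 𝓝[pathComponentIn X y] x,
      ∀ i, ‖c i z.2 / c i z.1 - 1‖ < 1 / 4 := by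
    refine eventually_all.2 fun i => ?_
    have h2 : Tendsto (fun z : E × E => ‖c i z.2 / c i z.1 - 1‖)
        (𝓝[pathComponentIn X y] x ×ˢ 𝓝[pathComponentIn X y] x)
        (𝓝 ‖c i x / c i x - 1‖) :=
      ((((hc i x hx).tendsto.comp tendsto_snd).div
        ((hc i x hx).tendsto.comp tendsto_fst) (h0 i x hx)).sub_const 1).norm
    exact h2.eventually_lt_const (by rw [div_self (h0 i x hx)]; norm_num)
  obtain ⟨t, ht, h⟩ := (eventually_prod_self_iff
    (r := fun u q => ∀ i, ‖c i q / c i u - 1‖ < 1 / 4)).1 h1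
  obtain ⟨O, hO, hOt⟩ := mem_nhdsWithin_iff_exists_mem_nhds_inter.1 ht
  exact ⟨O, hO, fun u hu q hq => h u (hOt hu.symm) q (hOt hq.symm)⟩

/-- A loop as an integral cycle with prescribed edge sums. -/
theorem exists_cycle {C : Set E} {a : ι → ℂ} {γ : Path y y} (hv : ∀ i, HasVar (c i) γ (a i))
    {w : E → E → ι → ℂ} (hw : ∀ u ∈ C, ∀ v, w u v = fun i => Complex.log (c i v / c i u))
    (hγ : ∀ t, γ t ∈ C) {δ : ℝ} (hδ : 0 < δ) :
    ∃ z ∈ on ℤ (nearLists (range γ) δ 2), bd z = 0 ∧ edgeSum w z = a := by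
  obtain ⟨n, h1, h2, hn⟩ := ((eventually_grid γ.continuous hδ).and
    ((eventually_all.2 fun i => (hv i).eventually_sum).and (eventually_ne_atTop 0))).exists
  refine ⟨∑ k ∈ Finset.range n, simplex ℤ [γ (gridPoint n k), γ (gridPoint n (k + 1))],
    Submodule.sum_mem _ fun k _ => simplex_mem ⟨rfl, ?_, ?_⟩, ?_, ?_⟩
  · simp only [List.mem_cons, List.not_mem_nil, or_false]
    rintro x (rfl | rfl) <;> exact mem_range_self _
  · have := (h1 k).le
    have h3 := this
    rw [dist_comm] at h3
    simp [this, h3, hδ.le]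
  · rw [map_sum]
    simp only [bd_pair]
    rw [Finset.sum_range_sub (fun k => simplex ℤ [γ (gridPoint n k)]), gridPoint_self hn,
      gridPoint_zero, γ.source, γ.target, sub_self]
  · rw [map_sum]
    ext i
    rw [Finset.sum_apply, ← h2 i]
    exact Finset.sum_congr rfl fun k _ => by rw [edgeSum_pair, hw _ (hγ _)]

theorem LocallyCurve.periods_dependent (h : LocallyCurve D X) (hp : p.Prime) {B : ℕ}
    (hb : ∀ L₀ : Set E, IsCompact L₀ → L₀ ⊆ X → ∃ K : Set E, IsCompact K ∧ K ⊆ X ∧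
      ∀ ε > 0, ∃ δ > 0, ∀ n > B, ∀ a : Fin n → ListChain (ZMod p) E,
        (∀ i, a i ∈ on (ZMod p) (nearLists L₀ δ 2)) → (∀ i, bd (a i) = 0) →
        ∃ x : Fin n → ZMod p, x ≠ 0 ∧ ∃ e ∈ on (ZMod p) (nearLists K ε 3),
          bd e = ∑ i, x i • a i)
    (hy : y ∈ pathComponentIn X y)
    (hc : ∀ i, ContinuousOn (c i) (pathComponentIn X y))
    (h0 : ∀ i, ∀ x ∈ pathComponentIn X y, c i x ≠ 0) {n : ℕ} (hn : B < n)
    {v : Fin n → ι → ℂ} (hv : ∀ k, v k ∈ periods hy fun i => h0 i y hy) :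
    ∃ x : Fin n → ZMod p, x ≠ 0 ∧ ∃ l ∈ periods hy fun i => h0 i y hy,
      ∑ k, ((x k).val : ℤ) • v k = (p : ℤ) • l := by
  classical
  have : Fact p.Prime := ⟨hp⟩
  set C := pathComponentIn X y with hC
  have hCX : C ⊆ X := pathComponentIn_subset
  choose γ hγ hγv using hv
  have hL : IsCompact (⋃ k, range (γ k)) := isCompact_iUnion fun k => isCompact_range (γ k).continuous
  have hLC : (⋃ k, range (γ k)) ⊆ C := iUnion_subset fun k => range_subset_iff.2 (hγ k)
  obtain ⟨K, hK, hKX, hb⟩ := hb _ hL (hLC.trans hCX)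
  obtain ⟨ε, hε, hu⟩ := h.uniform (hK.union hL) (union_subset hKX (hLC.trans hCX)) (x₀ := y)
    (Q := fun u q => ∀ i, ‖c i q / c i u - 1‖ < 1 / 4) fun x hx => exists_nhds_ratio hc h0 hx
  obtain ⟨δ, hδ, hb⟩ := hb ε hε
  set w : E → E → ι → ℂ := fun u v => if u ∈ C then fun i => Complex.log (c i v / c i u) else 0
    with hw
  have hwC : ∀ u ∈ C, ∀ v, w u v = fun i => Complex.log (c i v / c i u) := fun u hu v => by
    simp only [hw, if_pos hu]
  have hδε : 0 < min δ ε := lt_min hδ hε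
  choose z hz hzb hzw using fun k => exists_cycle (hγv k) hwC (hγ k) hδε
  have hsub : ∀ k, range (γ k) ⊆ ⋃ k, range (γ k) := fun k => subset_iUnion (fun k => range (γ k)) k
  obtain ⟨x, hx, e, he, hbe⟩ := hb n hn (fun k => reduce p (z k))
    (fun k => reduce_mem (on_mono (nearLists_mono (hsub k) (min_le_left _ _)) (hz k)))
    (fun k => by rw [← reduce_bd, hzb, map_zero])
  have hjC : ∀ {u v}, JoinedIn X u v → (u ∈ C ↔ v ∈ C) := fun {u v} hj =>
    ⟨fun hu => hu.trans hj, fun hv => hv.trans hj.symm⟩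
  have hpath : ∀ u, ∃ a, u ∈ C → Vars C c y u a := fun u => by
    by_cases huC : u ∈ C
    · have hj : JoinedIn C y u := by
        have h1 : IsPathConnected C := isPathConnected_pathComponentIn (hCX hy)
        exact h1.joinedIn y hy u huC
      obtain ⟨a, ha⟩ := Vars.exists_of_joined hc h0 hj
      exact ⟨a, fun _ => ha⟩
    · exact ⟨0, fun h => absurd h huC⟩
  choose P hP using hpath
  refine ⟨x, hx, ?_⟩
  simp only [← hzw]
  refine exists_sum_eq_smul (K := K ∪ ⋃ k, range (γ k)) (ε := ε)
    (Λ := periods hy fun i => h0 i y hy) (w := w) (P := fun u => if u ∈ C then P u else 0)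
    ?_ ?_ (fun k => on_mono (nearLists_mono ((hsub k).trans subset_union_right)
      (min_le_right _ _)) (hz k)) hzb (on_mono (nearLists_mono subset_union_left le_rfl) he) hbe
  · intro u hu' v hv' t ht' huv hvt hut
    by_cases huC : u ∈ C
    · have hvC := (hjC (hu u hu' v hv' huv).1).1 huC
      have htC := (hjC (hu u hu' t ht' hut).1).1 huC
      have h1 := ((hu u hu' v hv' huv).2 huC).mem.2.2
      have h2 := ((hu v hv' t ht' hvt).2 hvC).mem.2.2
      rw [hwC u huC, hwC v hvC, hwC u huC]
      ext i
      simp only [Pi.add_apply]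
      rw [log_add_log (h1 i) (h2 i)]
      congr 1
      have := h0 i u huC
      have := h0 i v hvC
      field_simp
    · have hvC : v ∉ C := fun hvC => huC ((hjC (hu u hu' v hv' huv).1).2 hvC)
      simp [hw, huC, hvC]
  · intro u hu' v hv' huv
    by_cases huC : u ∈ C
    · have hvC := (hjC (hu u hu' v hv' huv).1).1 huC
      have h1 := Vars.of_close hc (fun i => h0 i u huC) ((hu u hu' v hv' huv).2 huC)
      have h2 := ((hP u huC).trans h1).trans (hP v hvC).symm
      rw [mem_periods]
      convert h2 using 1
      rw [hwC u huC, if_pos huC, if_pos hvC]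
      abel
    · have hvC : v ∉ C := fun hvC => huC ((hjC (hu u hu' v hv' huv).1).2 hvC)
      simp [hw, huC, hvC]

end

end

section

theorem exists_primitive_orthogonal {N B p : ℕ} (hp : p.Prime) (Λ : Submodule ℤ (Fin N → ℤ))
    (h : ∀ n > B, ∀ v : Fin n → Fin N → ℤ, (∀ k, v k ∈ Λ) →
      ∃ x : Fin n → ZMod p, x ≠ 0 ∧ ∃ l ∈ Λ, ∑ k, ((x k).val : ℤ) • v k = (p : ℤ) • l)
    (hN : B + 1 < N) :
    ∃ x : Fin N → ℤ, (∀ v ∈ Λ, ∑ i, x i * v i = 0) ∧ ∑ i, x i = 0 ∧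
      ∀ d : ℤ, (∀ i, d ∣ x i) → IsUnit d := by
  have : Fact p.Prime := ⟨hp⟩
  obtain ⟨r, ⟨b⟩⟩ := Submodule.nonempty_basis_of_pid (Pi.basisFun ℤ (Fin N)) Λ
  have hr : r ≤ B := by
    by_contra! hr
    obtain ⟨x, hx, l, hl, hxl⟩ := h r hr (fun k => b k) fun k => (b k).2
    refine hx (funext fun k => ?_)
    have h1 : ∑ k, ((x k).val : ℤ) • b k = (p : ℤ) • (⟨l, hl⟩ : Λ) := by
      ext1
      push_cast
      exact hxl
    have h2 := congrArg (fun v => b.repr v k) h1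
    simp only [map_sum, map_smul, b.repr_self, Finsupp.finsetSum_apply, Finsupp.smul_apply,
      smul_eq_mul] at h2
    simp only [Finsupp.single_apply, mul_ite, mul_one, mul_zero, Finset.sum_ite_eq',
      Finset.mem_univ, if_true] at h2
    have h3 : (((x k).val : ℤ) : ZMod p) = 0 := by rw [h2]; simp
    simpa using h3
  have hninj : ∃ x : Fin N → ℤ, x ≠ 0 ∧ (∀ j, ∑ i, x i * (b j : Fin N → ℤ) i = 0) ∧
      ∑ i, x i = 0 := by
    let φ : (Fin N → ℤ) →ₗ[ℤ] (Fin (r + 1) → ℤ) := LinearMap.pi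
      (Fin.cons (∑ i, LinearMap.proj i)
        fun j => ∑ i, (b j : Fin N → ℤ) i • LinearMap.proj i)
    have hφ : ¬ Function.Injective φ := fun hi => by
      have := le_of_fin_injective ℤ φ hi
      omega
    have hker : LinearMap.ker φ ≠ ⊥ := fun hk => hφ (LinearMap.ker_eq_bot.1 hk)
    obtain ⟨x, hx, hx0⟩ := Submodule.exists_mem_ne_zero_of_ne_bot hker
    have hx' : φ x = 0 := hx
    refine ⟨x, hx0, fun j => ?_, ?_⟩
    · have := congrFun hx' j.succ
      simp only [φ, LinearMap.pi_apply, Fin.cons_succ, LinearMap.sum_apply, LinearMap.smul_apply,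
        LinearMap.proj_apply, smul_eq_mul, Pi.zero_apply] at this
      rw [← this]
      exact Finset.sum_congr rfl fun i _ => mul_comm _ _
    · have := congrFun hx' 0
      simpa [φ] using this
  obtain ⟨x, hx0, hxb, hxs⟩ := hninj
  have hne : (Finset.univ : Finset (Fin N)).Nonempty := ⟨⟨0, by omega⟩, Finset.mem_univ _⟩
  obtain ⟨g, hg, hg1⟩ := Finset.extract_gcd x hne
  set e := Finset.univ.gcd x with he
  have hxe : ∀ i, x i = e * g i := fun i => hg i (Finset.mem_univ i)
  have he0 : e ≠ 0 := fun h0 => hx0 (funext fun i => by rw [hxe, h0, zero_mul]; rfl)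
  refine ⟨g, fun v hv => ?_, ?_, fun d hd => ?_⟩
  · have h1 : ∀ j, ∑ i, g i * (b j : Fin N → ℤ) i = 0 := fun j => by
      have := hxb j
      simp only [hxe, mul_assoc] at this
      rw [← Finset.mul_sum] at this
      exact (mul_eq_zero.1 this).resolve_left he0
    have h2 : (⟨v, hv⟩ : Λ) = ∑ j, b.repr ⟨v, hv⟩ j • b j := (b.sum_repr _).symm
    have h3 : v = ∑ j, b.repr ⟨v, hv⟩ j • (b j : Fin N → ℤ) := by
      have := congrArg (Subtype.val) h2
      push_cast at this
      exact this
    rw [h3]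
    simp only [Finset.sum_apply, Pi.smul_apply, smul_eq_mul, Finset.mul_sum]
    rw [Finset.sum_comm]
    refine Finset.sum_eq_zero fun j _ => ?_
    calc _ = b.repr ⟨v, hv⟩ j * ∑ i, g i * (b j : Fin N → ℤ) i := by
          rw [Finset.mul_sum]
          exact Finset.sum_congr rfl fun i _ => by ring
      _ = 0 := by rw [h1, mul_zero]
  · simp only [hxe] at hxs
    rw [← Finset.mul_sum] at hxs
    exact (mul_eq_zero.1 hxs).resolve_left he0
  · exact isUnit_of_dvd_one (hg1 ▸ Finset.dvd_gcd fun i _ => hd i)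

theorem exists_primitive_orthogonal_periods {N B p : ℕ} (hp : p.Prime)
    (Λ : Submodule ℤ (Fin N → ℂ)) (hΛ : ∀ a ∈ Λ, ∀ i, Complex.exp (a i) = 1)
    (h : ∀ n > B, ∀ v : Fin n → Fin N → ℂ, (∀ k, v k ∈ Λ) →
      ∃ x : Fin n → ZMod p, x ≠ 0 ∧ ∃ l ∈ Λ, ∑ k, ((x k).val : ℤ) • v k = (p : ℤ) • l)
    (hN : B + 1 < N) :
    ∃ x : Fin N → ℤ, (∀ a ∈ Λ, ∑ i, (x i : ℂ) * a i = 0) ∧ ∑ i, x i = 0 ∧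
      ∀ d : ℤ, (∀ i, d ∣ x i) → IsUnit d := by
  let φ : (Fin N → ℤ) →ₗ[ℤ] (Fin N → ℂ) := AddMonoidHom.toIntLinearMap
    { toFun := fun v i => (v i : ℂ) * (2 * Real.pi * Complex.I)
      map_zero' := by ext; simp
      map_add' := fun v w => by ext; simp [add_mul] }
  have hφ : ∀ v i, φ v i = (v i : ℂ) * (2 * Real.pi * Complex.I) := fun v i => rfl
  have hφi : Function.Injective φ := fun v w hvw => by
    ext i
    have := congrFun hvw i
    rw [hφ, hφ] at this
    exact_mod_cast mul_right_cancel₀ Complex.two_pi_I_ne_zero this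
  have hsurj : ∀ a ∈ Λ, ∃ v, φ v = a := fun a ha => by
    choose v hv using fun i => Complex.exp_eq_one_iff.1 (hΛ a ha i)
    exact ⟨v, funext fun i => by rw [hφ, hv]⟩
  obtain ⟨x, hx, hxs, hxp⟩ := exists_primitive_orthogonal hp (Λ.comap φ) (B := B)
    (fun n hn v hv => by
      obtain ⟨x, hx, l, hl, hxl⟩ := h n hn (fun k => φ (v k)) hv
      obtain ⟨l, rfl⟩ := hsurj l hl
      refine ⟨x, hx, l, hl, hφi ?_⟩
      simpa only [map_sum, map_smul] using hxl) hN
  refine ⟨x, fun a ha => ?_, hxs, hxp⟩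
  obtain ⟨v, rfl⟩ := hsurj a ha
  have := hx v ha
  have h1 : ∀ i, (x i : ℂ) * φ v i = (x i : ℂ) * (v i : ℂ) * (2 * Real.pi * Complex.I) :=
    fun i => by rw [hφ]; ring
  simp only [h1]
  rw [← Finset.sum_mul]
  rw [show ∑ i, (x i : ℂ) * (v i : ℂ) = ((∑ i, x i * v i : ℤ) : ℂ) by push_cast; rfl, this]
  simp

section

variable {E : Type*} [NormedAddCommGroup E] [NormedSpace ℂ E] {D X : Set E}

open ListChain

theorem LocallyCurve.card_le (h : LocallyCurve D X) {p : ℕ} (hp : p.Prime) {B : ℕ}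
    (hb : ∀ L₀ : Set E, IsCompact L₀ → L₀ ⊆ X → ∃ K : Set E, IsCompact K ∧ K ⊆ X ∧
      ∀ ε > 0, ∃ δ > 0, ∀ n > B, ∀ a : Fin n → ListChain (ZMod p) E,
        (∀ i, a i ∈ on (ZMod p) (nearLists L₀ δ 2)) → (∀ i, bd (a i) = 0) →
        ∃ x : Fin n → ZMod p, x ≠ 0 ∧ ∃ e ∈ on (ZMod p) (nearLists K ε 3),
          bd e = ∑ i, x i • a i)
    (hD : IsOpen D) {N : ℕ} {y₀ : E} {y : Fin N → E} (hy₀ : y₀ ∈ pathComponentIn X y₀)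
    (hy : ∀ k, y k ∈ pathComponentIn X y₀) (hne : ∀ k, y k ≠ y₀) (hinj : Function.Injective y)
    (𝔞 : CurveAtlas D (pathComponentIn X y₀)) {F G : E → E} (hF : DifferentiableOn ℂ F D)
    (hG : DifferentiableOn ℂ G D) (hXD : X ⊆ D)
    (hFC : MapsTo F (pathComponentIn X y₀) (pathComponentIn X y₀))
    (hGF : ∀ z ∈ pathComponentIn X y₀, G (F z) = z) (hF₀ : F y₀ = y₀) (hFy : ∀ k, F (y k) = y k)
    {l₀ : ℂ} {l : Fin N → ℂ}
    (hl₀ : ∀ z ∈ pathComponentIn X y₀, z ∈ 𝔞.U y₀ → 𝔞.θ y₀ (F z) = l₀ * 𝔞.θ y₀ z)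
    (hl : ∀ k, ∀ z ∈ pathComponentIn X y₀, z ∈ 𝔞.U (y k) →
      𝔞.θ (y k) (F z) = l k * 𝔞.θ (y k) z)
    {m d : ℕ} (hm : m ≠ 0) (hmF : ∀ z ∈ pathComponentIn X y₀, F^[m] z = z) (hd : d ≠ 1)
    (hl₀m : l₀ ^ m = 1) (hlm : ∀ k, l k ^ m = 1) (hld : ∀ k, ∀ e : ℕ, l k ^ e = 1 → d ∣ e) :
    N ≤ B + 1 := by
  by_contra! hN
  have hCX : (pathComponentIn X y₀) ⊆ X := pathComponentIn_subset
  have hCpc : IsPathConnected (pathComponentIn X y₀) := isPathConnected_pathComponentIn (hCX hy₀)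
  choose c hc h0 hcy hcy₀ hc1 hprod using fun k => 𝔞.exists_multiplier hD
    hCpc.isConnected.isPreconnected hF hG hFC hGF (hy k) hy₀ (hne k) (hFy k) hF₀ (hl k) hl₀
  have hl0 : ∀ k, l k ≠ 0 := fun k => hcy k ▸ h0 k _ (hy k)
  have hl₀0 : l₀ ≠ 0 := fun h => by
    rw [h, zero_pow hm] at hl₀m
    exact zero_ne_one hl₀m
  obtain ⟨x, hx, hxs, hxp⟩ := exists_primitive_orthogonal_periods hp
    (periods hy₀ fun i => h0 i _ hy₀)
    (fun a ha i => by
      rw [Vars.exp_eq (mem_periods.1 ha) i, div_self (h0 i _ hy₀)])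
    (fun n hn v hv => h.periods_dependent hp hb hy₀ hc h0 hn hv) hN
  have hFc : ∀ j : ℕ, MapsTo F^[j] (pathComponentIn X y₀) (pathComponentIn X y₀) ∧ ContinuousOn F^[j] (pathComponentIn X y₀) := fun j => by
    induction j with
    | zero => exact ⟨mapsTo_id (pathComponentIn X y₀), continuousOn_id⟩
    | succ j ih =>
      rw [Function.iterate_succ']
      exact ⟨hFC.comp ih.1, (hF.continuousOn.mono (hCX.trans hXD)).comp ih.2 ih.1⟩
  have hxk : ∀ k, l k ^ x k = 1 := fun k => by
    obtain ⟨γ, hγ⟩ := hCpc.joinedIn y₀ hy₀ (y k) (hy k)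
    let δ : ℕ → Path y₀ (y k) := fun j =>
      { toFun := fun t => F^[j] (γ t)
        continuous_toFun := (hFc j).2.comp_continuous γ.continuous hγ
        source' := by
          simp only [γ.source]
          exact Function.iterate_fixed hF₀ j
        target' := by
          simp only [γ.target]
          exact Function.iterate_fixed (hFy k) j }
    have hδ : ∀ j t, δ j t = F^[j] (γ t) := fun j t => rfl
    have hδC : ∀ j t, δ j t ∈ (pathComponentIn X y₀) := fun j t => (hFc j).1 (hγ t)
    choose a ha using fun j i => HasVar.exists_of_continuous
      ((hc i).comp_continuous (δ j).continuous (hδC j)) fun t => h0 i _ (hδC j t)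
    have hV : ∀ j, Vars (pathComponentIn X y₀) c y₀ (y k) (a j) := fun j => ⟨δ j, hδC j, ha j⟩
    have hsum : ∀ i, ∑ j ∈ Finset.range m, a j i = 0 := fun i =>
      HasVar.sum_eq_zero (c := c i) (δ := δ) (fun j _ => ha j i)
        fun t => hprod i m (hlm i) hl₀m (γ t) (hγ t) (hmF _ (hγ t))
    have hdiff : ∀ j, ∑ i, (x i : ℂ) * a j i = ∑ i, (x i : ℂ) * a 0 i := fun j => by
      have := hx _ (mem_periods.2 ((hV j).trans (hV 0).symm))
      simp only [Pi.add_apply, Pi.neg_apply, mul_add, mul_neg, Finset.sum_add_distrib,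
        Finset.sum_neg_distrib] at this
      linear_combination this
    have hzero : ∑ i, (x i : ℂ) * a 0 i = 0 := by
      have h1 : ∑ j ∈ Finset.range m, ∑ i, (x i : ℂ) * a j i = 0 := by
        rw [Finset.sum_comm]
        refine Finset.sum_eq_zero fun i _ => ?_
        rw [← Finset.mul_sum, hsum, mul_zero]
      rw [Finset.sum_congr rfl fun j _ => hdiff j, Finset.sum_const, Finset.card_range,
        nsmul_eq_mul] at h1
      exact (mul_eq_zero.1 h1).resolve_left (Nat.cast_ne_zero.2 hm)
    have h2 : ∀ i, Complex.exp ((x i : ℂ) * a 0 i) = (if i = k then l k ^ x k else 1) * l₀ ^ x i :=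
      fun i => by
        rw [Complex.exp_int_mul, (hV 0).exp_eq i, hcy₀, div_inv_eq_mul, mul_zpow]
        congr 1
        split_ifs with hik
        · rw [hik, hcy]
        · rw [hc1 i _ (hy k) (hFy k) (fun h => hik (hinj h).symm) (hne k), one_zpow]
    have h3 := congrArg Complex.exp hzero
    rw [Complex.exp_sum, Complex.exp_zero, Finset.prod_congr rfl fun i _ => h2 i,
      Finset.prod_mul_distrib, Finset.prod_ite_eq' Finset.univ k, if_pos (Finset.mem_univ k)] at h3
    have h4 : ∏ i, l₀ ^ x i = 1 := by
      have : ∀ s : Finset (Fin N), ∏ i ∈ s, l₀ ^ x i = l₀ ^ ∑ i ∈ s, x i := fun s => by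
        induction s using Finset.induction_on with
        | empty => simp
        | insert i s hi ih => rw [Finset.prod_insert hi, Finset.sum_insert hi, zpow_add₀ hl₀0, ih]
      rw [this, hxs, zpow_zero]
    rwa [h4, mul_one] at h3
  have hdx : ∀ k, (d : ℤ) ∣ x k := fun k => by
    rw [Int.natCast_dvd]
    refine hld k _ ?_
    rcases Int.natAbs_eq (x k) with h1 | h1
    · have := hxk k
      rwa [h1, zpow_natCast] at this
    · have := hxk k
      rwa [h1, zpow_neg, zpow_natCast, inv_eq_one] at this
  have h5 := hxp d hdx
  rw [Int.isUnit_iff_natAbs_eq] at h5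
  exact hd (by simpa using h5)

end

end

section

variable {E : Type*} [NormedAddCommGroup E] [NormedSpace ℂ E]

namespace CurveChart

variable {D C : Set E} {θ : E → ℂ} {χ : ℂ → E} {r : ℝ} {U : Set E} {F : E → E} {y : E} {l : ℂ}
  {e : ℕ}

theorem apply_iterate (hFC : MapsTo F C C)
    (hl : ∀ z ∈ C, z ∈ U → θ (F z) = l * θ z) {z : E} (hz : z ∈ C)
    (hU : ∀ i < e, F^[i] z ∈ U) : θ (F^[e] z) = l ^ e * θ z := by
  induction e with
  | zero => simp
  | succ e ih =>
    rw [Function.iterate_succ_apply', hl _ (hFC.iterate e hz) (hU e e.lt_succ_self),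
      ih fun i hi => hU i (hi.trans e.lt_succ_self), pow_succ]
    ring

theorem eventually_iterate_mem (h : CurveChart D C θ χ r U) (hFy : F y = y)
    (hFc : ContinuousAt F y) (hyU : y ∈ U) (e : ℕ) : ∀ᶠ z in 𝓝 y, ∀ i < e, F^[i] z ∈ U := by
  have h1 : ∀ i ∈ Finset.range e, ∀ᶠ z in 𝓝 y, F^[i] z ∈ U := fun i _ => by
    have h2 : ContinuousAt F^[i] y := hFc.iterate hFy i
    have h3 : F^[i] y = y := Function.iterate_fixed hFy i
    exact h2.eventually_mem (by rw [h3]; exact h.isOpen.mem_nhds hyU)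
  filter_upwards [(Finset.eventually_all _).2 h1] with z hz i hi
  exact hz i (Finset.mem_range.2 hi)

theorem iterate_eq_of_pow_eq_one (h : CurveChart D C θ χ r U) (hFC : MapsTo F C C)
    (hFy : F y = y) (hFc : ContinuousAt F y) (hyU : y ∈ U)
    (hl : ∀ z ∈ C, z ∈ U → θ (F z) = l * θ z) (hle : l ^ e = 1) :
    ∀ᶠ z in 𝓝[C] y, F^[e] z = z := by
  filter_upwards [mem_nhdsWithin_of_mem_nhds (h.eventually_iterate_mem hFy hFc hyU (e + 1)),
    self_mem_nhdsWithin, mem_nhdsWithin_of_mem_nhds (h.isOpen.mem_nhds hyU)] with z hz hzC hzU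
  have h1 := apply_iterate hFC hl hzC fun i hi => hz i (hi.trans e.lt_succ_self)
  rw [hle, one_mul] at h1
  rw [← h.left _ ⟨hFC.iterate e hzC, hz e e.lt_succ_self⟩, h1, h.left z ⟨hzC, hzU⟩]

theorem pow_eq_one_of_iterate_eq (h : CurveChart D C θ χ r U) (hFC : MapsTo F C C)
    (hFy : F y = y) (hFc : ContinuousAt F y) (hy : y ∈ C) (hyU : y ∈ U) (hy0 : θ y = 0)
    (hl : ∀ z ∈ C, z ∈ U → θ (F z) = l * θ z) (he : ∀ z ∈ C, F^[e] z = z) : l ^ e = 1 := by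
  have hb := h.mem_ball y ⟨hy, hyU⟩
  rw [hy0] at hb
  have hc : ContinuousAt χ 0 := (h.holo_inv.differentiableAt (isOpen_ball.mem_nhds hb)).continuousAt
  have h0 : χ 0 = y := by rw [← hy0, h.left y ⟨hy, hyU⟩]
  have h1 : ∀ᶠ w in 𝓝[≠] (0 : ℂ), (∀ i < e, F^[i] (χ w) ∈ U) ∧ w ∈ ball (0 : ℂ) r ∧ w ≠ 0 := by
    rw [ContinuousAt, h0] at hc
    filter_upwards [mem_nhdsWithin_of_mem_nhds (hc.eventually
      (h.eventually_iterate_mem hFy hFc hyU e)),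
      mem_nhdsWithin_of_mem_nhds (isOpen_ball.mem_nhds hb), self_mem_nhdsWithin] with w h1 h2 h3
    exact ⟨h1, h2, h3⟩
  obtain ⟨w, h2, h3, h4⟩ := h1.exists
  have h5 := apply_iterate hFC hl (h.mem w h3).1 h2
  rw [he _ (h.mem w h3).1, h.right w h3] at h5
  exact mul_right_cancel₀ h4 (by rw [one_mul, ← h5])

end CurveChart

open ListChain

namespace IsAut

variable [FiniteDimensional ℂ E] {D : Set E} {F g : Equiv.Perm E} {R : ℝ}

theorem mapsTo_fixed (h : IsAut D F) (j : ℕ) :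
    MapsTo F {z | z ∈ D ∧ (F ^ j) z = z} {z | z ∈ D ∧ (F ^ j) z = z} := fun z hz => by
  refine ⟨(h.mem_iff z).2 hz.1, ?_⟩
  rw [← Equiv.Perm.mul_apply, ← pow_succ, pow_succ', Equiv.Perm.mul_apply, hz.2]

theorem mapsTo_component (h : IsAut D F) (j : ℕ) {y : E} (hFy : F y = y) :
    MapsTo F (pathComponentIn {z | z ∈ D ∧ (F ^ j) z = z} y)
      (pathComponentIn {z | z ∈ D ∧ (F ^ j) z = z} y) := fun z hz => by
  have h1 : JoinedIn {z | z ∈ D ∧ (F ^ j) z = z} y z := hz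
  have h2 := h1.map_continuousOn (f := F) (h.holo.continuousOn.mono fun z hz => hz.1)
  rw [hFy] at h2
  exact h2.mono (h.mapsTo_fixed j).image_subset

theorem card_component_le (hE : Module.finrank ℂ E = 2) (hD : IsOpen D) (hc : IsPreconnected D)
    (hR : ∀ x ∈ D, ‖x‖ ≤ R) (h : IsAut D F) {m : ℕ} (hm : m ≠ 0) (hFm : F ^ m = 1) {j : ℕ}
    (hg1 : F ^ j ≠ 1) {X : Set E} (hX : X = {z | z ∈ D ∧ (F ^ j) z = z}) {p : ℕ} (hp : p.Prime)
    {B : ℕ}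
    (hb : ∀ L₀ : Set E, IsCompact L₀ → L₀ ⊆ X → ∃ K : Set E, IsCompact K ∧ K ⊆ X ∧
      ∀ ε > 0, ∃ δ > 0, ∀ n > B, ∀ a : Fin n → ListChain (ZMod p) E,
        (∀ i, a i ∈ on (ZMod p) (nearLists L₀ δ 2)) → (∀ i, bd (a i) = 0) →
        ∃ x : Fin n → ZMod p, x ≠ 0 ∧ ∃ e ∈ on (ZMod p) (nearLists K ε 3),
          bd e = ∑ i, x i • a i)
    {N : ℕ} {y₀ : E} {y : Fin N → E} (hy₀ : y₀ ∈ D) (hFy₀ : F y₀ = y₀)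
    (hA₀ : ∀ v, fderiv ℂ F y₀ v = v → v = 0)
    (hy : ∀ k, y k ∈ pathComponentIn X y₀) (hFy : ∀ k, F (y k) = y k)
    (hA : ∀ k v, fderiv ℂ F (y k) v = v → v = 0) (hne : ∀ k, y k ≠ y₀)
    (hinj : Function.Injective y) : N ≤ B + 1 := by
  have : CompleteSpace E := FiniteDimensional.complete ℂ E
  rcases Nat.eq_zero_or_pos N with rfl | hN
  · exact Nat.zero_le _
  have hcurve : LocallyCurve D X := fun x hx => by
    subst hX
    rcases isolated_or_chart hE hD hc hR (h.pow j) hg1 hx.1 hx.2 with hi | hch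
    · left
      filter_upwards [hi] with z hz hzX
      exact hz hzX.2
    · exact Or.inr hch
  have hXD : X ⊆ D := by rw [hX]; exact fun z hz => hz.1
  have hy₀X : y₀ ∈ X := by
    rw [hX]
    refine ⟨hy₀, ?_⟩
    have := zpow_fix hFy₀ (j : ℤ)
    rwa [zpow_natCast] at this
  have hy₀C : y₀ ∈ pathComponentIn X y₀ := mem_pathComponentIn_self hy₀X
  have hCX : pathComponentIn X y₀ ⊆ X := pathComponentIn_subset
  have hnt : (pathComponentIn X y₀).Nontrivial := ⟨_, hy ⟨0, hN⟩, y₀, hy₀C, hne _⟩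
  have hpre : IsPreconnected (pathComponentIn X y₀) :=
    (isPathConnected_pathComponentIn hy₀X).isConnected.isPreconnected
  have hFC : MapsTo F (pathComponentIn X y₀) (pathComponentIn X y₀) := by
    subst hX
    exact h.mapsTo_component j hFy₀
  have hch : ∀ x, ∃ (θ : E → ℂ) (χ : ℂ → E) (r : ℝ) (U : Set E), x ∈ pathComponentIn X y₀ →
      CurveChart D (pathComponentIn X y₀) θ χ r U ∧ x ∈ U ∧ θ x = 0 ∧
      (F x = x → (∀ v, fderiv ℂ F x v = v → v = 0) → ∃ l : ℂ, l ≠ 1 ∧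
        ∀ z ∈ pathComponentIn X y₀, z ∈ U → θ (F z) = l * θ z) := fun x => by
    by_cases hx : x ∈ pathComponentIn X y₀
    swap
    · exact ⟨0, 0, 0, ∅, fun h => absurd h hx⟩
    by_cases hgood : F x = x ∧ ∀ v, fderiv ℂ F x v = v → v = 0
    · rcases isolated_or_multiplier hE hD hc hR h hg1 (hXD (hCX hx)) hgood.1 hgood.2 with
        hi | ⟨θ, χ, r, U, h1, h2, h3, l, h4, h5⟩
      · exfalso
        have hac := hpre.preperfect_of_nontrivial hnt x hx
        rw [accPt_iff_frequently] at hac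
        refine hac ?_
        filter_upwards [hi] with w hw hw2
        have := hCX hw2.2
        rw [hX] at this
        exact hw2.1 (hw this.2)
      · refine ⟨θ, χ, r, U, fun _ => ⟨?_, h2, h3, fun _ _ => ⟨l, h4, fun z hz hzU => ?_⟩⟩⟩
        · subst hX
          exact h1.pathComponent h2 hx
        · have := hCX hz
          rw [hX] at this
          exact h5 z hzU this.2
    · obtain ⟨θ, χ, r, U, h1, h2, h3⟩ := chart_of_nontrivial hE hD hc hR (h.pow j) hg1 hX hnt hx
      exact ⟨θ, χ, r, U, fun _ => ⟨h1, h2, h3, fun h4 h5 => absurd ⟨h4, h5⟩ hgood⟩⟩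
  choose θ χ r U hch using hch
  let 𝔞 : CurveAtlas D (pathComponentIn X y₀) :=
    { θ := θ
      χ := χ
      r := r
      U := U
      chart := fun x hx => (hch x hx).1
      mem := fun x hx => (hch x hx).2.1
      zero := fun x hx => (hch x hx).2.2.1 }
  obtain ⟨l₀, hl₀1, hl₀⟩ := (hch y₀ hy₀C).2.2.2 hFy₀ hA₀
  choose l hl1 hl using fun k => (hch (y k) (hy k)).2.2.2 (hFy k) (hA k)
  have hit : ∀ (e : ℕ) z, F^[e] z = (F ^ e) z := fun e z => by rw [Equiv.Perm.iterate_eq_pow]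
  have hFcont : ∀ x ∈ pathComponentIn X y₀, ContinuousAt F x := fun x hx =>
    (h.holo.differentiableAt (hD.mem_nhds (hXD (hCX hx)))).continuousAt
  have hmF : ∀ z ∈ pathComponentIn X y₀, F^[m] z = z := fun z _ => by rw [hit, hFm]; rfl
  refine hcurve.card_le hp hb hD hy₀C hy hne hinj 𝔞 h.holo h.holo_inv hXD hFC
    (fun z _ => F.symm_apply_apply z) hFy₀ hFy hl₀ hl hm hmF (d := orderOf l₀)
    (fun h1 => hl₀1 (orderOf_eq_one_iff.1 h1))
    ((𝔞.chart _ hy₀C).pow_eq_one_of_iterate_eq hFC hFy₀ (hFcont _ hy₀C) hy₀C (𝔞.mem _ hy₀C)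
      (𝔞.zero _ hy₀C) hl₀ hmF)
    (fun k => (𝔞.chart _ (hy k)).pow_eq_one_of_iterate_eq hFC (hFy k) (hFcont _ (hy k)) (hy k)
      (𝔞.mem _ (hy k)) (𝔞.zero _ (hy k)) (hl k) hmF) fun k e hle => ?_
  rw [orderOf_dvd_iff_pow_eq_one]
  refine (𝔞.chart _ hy₀C).pow_eq_one_of_iterate_eq hFC hFy₀ (hFcont _ hy₀C) hy₀C (𝔞.mem _ hy₀C)
      (𝔞.zero _ hy₀C) hl₀ fun z hz => ?_
  have hid := (𝔞.chart _ (hy k)).iterate_eq_of_pow_eq_one hFC (hFy k) (hFcont _ (hy k))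
    (𝔞.mem _ (hy k)) (hl k) hle
  have hIs : IsCurve D (pathComponentIn X y₀) := fun x hx =>
    ⟨_, _, _, _, 𝔞.chart x hx, 𝔞.mem x hx, 𝔞.zero x hx⟩
  refine hIs.eqOn_id hpre ?_ (hy k) hid hz
  have := (h.pow e).holo
  rwa [← Equiv.Perm.iterate_eq_pow] at this

end IsAut

end

section

variable {E : Type*} [NormedAddCommGroup E] [NormedSpace ℂ E]

open ListChain

theorem LocallyCurve.card_components_le {D X : Set E} (h : LocallyCurve D X) {p : ℕ}
    {B : ℕ}
    (hb : ∀ L₀ : Set E, IsCompact L₀ → L₀ ⊆ X → ∃ K : Set E, IsCompact K ∧ K ⊆ X ∧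
      ∀ ε > 0, ∃ δ > 0, ∀ n > B, ∀ a : Fin n → ListChain (ZMod p) E,
        (∀ i, a i ∈ on (ZMod p) (nearLists L₀ δ 1)) → (∀ i, bd (a i) = 0) →
        ∃ x : Fin n → ZMod p, x ≠ 0 ∧ ∃ e ∈ on (ZMod p) (nearLists K ε 2),
          bd e = ∑ i, x i • a i)
    {N : ℕ} {y₀ : E} {y : Fin N → E} (hy₀ : y₀ ∈ X) (hy : ∀ k, y k ∈ X)
    (hne : ∀ k, ¬ JoinedIn X (y k) y₀) (hinj : ∀ i k, JoinedIn X (y k) (y i) → i = k) :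
    N ≤ B := by
  classical
  by_contra! hN
  have hL : (insert y₀ (range y)).Finite := (finite_range y).insert y₀
  obtain ⟨K, hK, hKX, hb⟩ := hb _ hL.isCompact
    (insert_subset hy₀ (range_subset_iff.2 hy))
  obtain ⟨ε, hε, hu⟩ := h.uniform hK hKX (x₀ := y₀) (Q := fun _ _ => True)
    fun x _ => ⟨univ, univ_mem, fun _ _ _ _ => trivial⟩
  obtain ⟨δ, hδ, hb⟩ := hb ε hε
  have hmem : ∀ u ∈ insert y₀ (range y), simplex (ZMod p) [u] ∈
      on (ZMod p) (nearLists (insert y₀ (range y)) δ 1) := fun u hu =>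
    simplex_mem ⟨rfl, by simpa using hu, by simp [hδ.le]⟩
  obtain ⟨x, hx, e, he, hbe⟩ := hb N hN
    (fun i => simplex (ZMod p) [y i] - simplex (ZMod p) [y₀])
    (fun i => Submodule.sub_mem _ (hmem _ (mem_insert_of_mem _ (mem_range_self i)))
      (hmem _ (mem_insert _ _)))
    (fun i => by simp [bd_cons])
  obtain ⟨k, hk⟩ := Function.ne_iff.1 hx
  let φ : ListChain (ZMod p) E →ₗ[ZMod p] ZMod p := extend fun σ => match σ with
    | [u] => if JoinedIn X (y k) u then 1 else 0
    | _ => 0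
  have hφ : ∀ u, φ (simplex _ [u]) = if JoinedIn X (y k) u then 1 else 0 := fun u => by simp [φ]
  have h1 : (φ ∘ₗ bd) e = (0 : ListChain (ZMod p) E →ₗ[ZMod p] ZMod p) e :=
    eq_of_simplex _ _ (fun σ hσ => by
      obtain ⟨hσ1, hσ2, hσ3⟩ := hσ
      obtain ⟨u, v, rfl⟩ := List.length_eq_two.1 hσ1
      have hj := (hu u (hσ2 u (by simp)) v (hσ2 v (by simp)) (hσ3 u (by simp) v (by simp))).1
      have h2 : JoinedIn X (y k) u ↔ JoinedIn X (y k) v :=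
        ⟨fun h => h.trans hj, fun h => h.trans hj.symm⟩
      simp [bd_cons, hφ, h2]) he
  rw [LinearMap.comp_apply, hbe, LinearMap.zero_apply, map_sum] at h1
  refine hk ?_
  change x k = 0
  rw [← h1, Finset.sum_eq_single k]
  · simp [hφ, hne k, JoinedIn.refl (hy k)]
  · intro i _ hik
    have : ¬ JoinedIn X (y k) (y i) := fun hj => hik (hinj i k hj)
    simp [hφ, hne k, this]
  · simp

namespace IsAut

variable [FiniteDimensional ℂ E] {D : Set E} {F : Equiv.Perm E} {R : ℝ}

theorem card_le (hE : Module.finrank ℂ E = 2) (hD : IsOpen D) (hc : IsPreconnected D)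
    (hR : ∀ x ∈ D, ‖x‖ ≤ R) (h : IsAut D F) {m : ℕ} (hm : m ≠ 0) (hFm : F ^ m = 1) {j : ℕ}
    (hg1 : F ^ j ≠ 1) {X : Set E} (hX : X = {z | z ∈ D ∧ (F ^ j) z = z}) {p : ℕ} (hp : p.Prime)
    {B : ℕ → ℕ}
    (hb : ∀ ℓ, ∀ L₀ : Set E, IsCompact L₀ → L₀ ⊆ X → ∃ K : Set E, IsCompact K ∧ K ⊆ X ∧
      ∀ ε > 0, ∃ δ > 0, ∀ n > B ℓ, ∀ a : Fin n → ListChain (ZMod p) E,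
        (∀ i, a i ∈ on (ZMod p) (nearLists L₀ δ ℓ)) → (∀ i, bd (a i) = 0) →
        ∃ x : Fin n → ZMod p, x ≠ 0 ∧ ∃ e ∈ on (ZMod p) (nearLists K ε (ℓ + 1)),
          bd e = ∑ i, x i • a i)
    (T : Finset E) (hT : ∀ y ∈ T, y ∈ D ∧ F y = y ∧ ∀ v, fderiv ℂ F y v = v → v = 0) :
    T.card ≤ (B 2 + 2) * (B 1 + 1) := by
  classical
  have hcurve : LocallyCurve D X := fun x hx => by
    subst hX
    rcases isolated_or_chart hE hD hc hR (h.pow j) hg1 hx.1 hx.2 with hi | hch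
    · left
      filter_upwards [hi] with z hz hzX
      exact hz hzX.2
    · exact Or.inr hch
  have hTX : ∀ y ∈ T, y ∈ X := fun y hy => by
    rw [hX]
    refine ⟨(hT y hy).1, ?_⟩
    have := zpow_fix (hT y hy).2.1 (j : ℤ)
    rwa [zpow_natCast] at this
  have h1 : (T.image (pathComponentIn X)).card ≤ B 1 + 1 := by
    rcases (T.image (pathComponentIn X)).eq_empty_or_nonempty with h0 | ⟨C₀, hC₀⟩
    · simp [h0]
    rw [← Finset.card_erase_add_one hC₀, Nat.add_le_add_iff_right]
    obtain ⟨y₀, hy₀, hyC₀⟩ := Finset.mem_image.1 hC₀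
    have hq : ∀ k, ∃ y ∈ T, pathComponentIn X y =
        (((T.image (pathComponentIn X)).erase C₀).equivFin.symm k).1 := fun k =>
      Finset.mem_image.1 (Finset.mem_of_mem_erase
        (((T.image (pathComponentIn X)).erase C₀).equivFin.symm k).2)
    choose y hy hyC using hq
    have hj : ∀ {u v}, JoinedIn X u v → pathComponentIn X u = pathComponentIn X v :=
      fun {u v} huv => by
        ext w
        exact ⟨fun hw => huv.symm.trans hw, fun hw => huv.trans hw⟩
    refine hcurve.card_components_le (hb 1) (hTX _ hy₀) (fun k => hTX _ (hy k))
      (fun k hk => ?_) fun i k hik => ?_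
    · refine Finset.ne_of_mem_erase
        (((T.image (pathComponentIn X)).erase C₀).equivFin.symm k).2 ?_
      rw [← hyC, ← hyC₀, hj hk]
    · have := hj hik
      rw [hyC, hyC] at this
      exact (Equiv.injective _ (Subtype.ext this)).symm
  have h2 : ∀ C ∈ T.image (pathComponentIn X),
      (T.filter fun y => pathComponentIn X y = C).card ≤ B 2 + 2 := fun C hC => by
    obtain ⟨y₀, hy₀, rfl⟩ := Finset.mem_image.1 hC
    set S := T.filter fun y => pathComponentIn X y = pathComponentIn X y₀ with hS
    have hyS : y₀ ∈ S := Finset.mem_filter.2 ⟨hy₀, rfl⟩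
    rw [← Finset.card_erase_add_one hyS]
    have hq : ∀ k, ((S.erase y₀).equivFin.symm k).1 ∈ T ∧
        pathComponentIn X ((S.erase y₀).equivFin.symm k).1 = pathComponentIn X y₀ := fun k =>
      Finset.mem_filter.1 (Finset.mem_of_mem_erase ((S.erase y₀).equivFin.symm k).2)
    have := card_component_le hE hD hc hR h hm hFm hg1 hX hp (hb 2) (y₀ := y₀)
      (y := fun k => ((S.erase y₀).equivFin.symm k).1) (hT y₀ hy₀).1 (hT y₀ hy₀).2.1
      (hT y₀ hy₀).2.2
      (fun k => by
        rw [← (hq k).2]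
        exact mem_pathComponentIn_self (hTX _ (hq k).1))
      (fun k => (hT _ (hq k).1).2.1) (fun k => (hT _ (hq k).1).2.2)
      (fun k => Finset.ne_of_mem_erase ((S.erase y₀).equivFin.symm k).2)
      (Subtype.val_injective.comp (Equiv.injective _))
    omega
  exact (Finset.card_le_mul_card_image T _ h2).trans (Nat.mul_le_mul_left _ h1)

end IsAut

end

section

open ListChain

theorem IsAut.exists_bound {E : Type*} [NormedAddCommGroup E] [NormedSpace ℂ E] [NormedSpace ℝ E]
    [IsScalarTower ℝ ℂ E] [FiniteDimensional ℂ E] (hE : Module.finrank ℂ E = 2) {D U : Set E}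
    {ρ : E → ℝ} (hD : IsOpen D) (hc : IsPreconnected D) (hbd : Bornology.IsBounded D)
    (hU : IsOpen U) (hDU : frontier D ⊆ U) (hρ : AnalyticOnNhd ℝ ρ U)
    (hneg : D ∩ U = {z ∈ U | ρ z < 0}) (hzero : frontier D = {z ∈ U | ρ z = 0})
    (hgrad : ∀ z ∈ frontier D, fderiv ℝ ρ z ≠ 0) :
    ∃ M : ℕ, ∀ F : Equiv.Perm E, IsAut D F → ∀ T : Finset E,
      (∀ y ∈ T, y ∈ D ∧ F y = y ∧ ∀ v, fderiv ℂ F y v = v → v = 0) → T.card ≤ M := by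
  have : FiniteDimensional ℝ E := FiniteDimensional.trans ℝ ℂ E
  have : ProperSpace E := FiniteDimensional.proper ℝ E
  have : CompleteSpace E := FiniteDimensional.complete ℂ E
  obtain ⟨K, W, hK, hKD, hW, hpath, hWK⟩ := exists_push hD hbd hU hDU hρ hneg hzero hgrad
  choose B hB using fun ℓ => exists_bounding hD hK hKD hW hpath hWK ℓ
  refine ⟨(B 2 + 2) * (B 1 + 1), fun F hF T hT => ?_⟩
  obtain ⟨R, hR⟩ := hbd.exists_norm_le
  obtain ⟨G, hG, ⟨m, hm, hGm⟩, hGT⟩ := hF.exists_finite_order hD hc hR T hT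
  rcases T.eq_empty_or_nonempty with rfl | ⟨y, hy⟩
  · simp
  have hord : 0 < orderOf G := orderOf_pos_iff.2 (isOfFinOrder_iff_pow_eq_one.2 ⟨m, hm, hGm⟩)
  have hnt : Nontrivial E := Module.nontrivial_of_finrank_pos (R := ℂ) (by omega)
  have hord1 : orderOf G ≠ 1 := fun h1 => by
    obtain ⟨v, hv⟩ := exists_ne (0 : E)
    rw [orderOf_eq_one_iff] at h1
    refine hv ((hGT y hy).2.2 v ?_)
    have h2 : (G : E → E) = id := by rw [h1]; rfl
    rw [h2, fderiv_id]
    rfl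
  have hp := Nat.minFac_prime hord1
  set p := (orderOf G).minFac with hpdef
  set j := orderOf G / p with hj
  have hjp : j * p = orderOf G := Nat.div_mul_cancel (Nat.minFac_dvd _)
  have hj0 : j ≠ 0 := fun h => by rw [h, zero_mul] at hjp; omega
  have hg1 : G ^ j ≠ 1 := pow_ne_one_of_lt_orderOf hj0 (by
    rw [← hjp]
    exact lt_mul_of_one_lt_right (Nat.pos_of_ne_zero hj0) hp.one_lt)
  have hgp : (G ^ j) ^ p = 1 := by rw [← pow_mul, hjp, pow_orderOf_eq_one]
  refine IsAut.card_le hE hD hc hR hG hord.ne' (pow_orderOf_eq_one G) hg1 rfl hp (B := B)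
    (fun ℓ L₀ hL₀ hL₀X => ?_) T hGT
  have hgc : ContinuousOn (G ^ j : Equiv.Perm E) D := (hG.pow j).holo.continuousOn
  obtain ⟨L, hL, hLD, hb⟩ := hB ℓ p hp (G ^ j) hgp (hG.pow j).mem_iff
    (fun i z hz => ⟨(fderiv ℂ ((G ^ j) ^ i : Equiv.Perm E) z).restrictScalars ℝ,
      (Holo.hasStrictFDerivAt hD ((hG.pow j).pow i).holo hz).restrictScalars ℝ⟩)
    L₀ hL₀ fun z hz => (hL₀X hz).1
  refine ⟨L ∩ {x | (G ^ j) x = x}, ?_, fun z hz => ⟨hLD hz.1, hz.2⟩, ?_⟩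
  · have h1 : ContinuousOn (fun x => (G ^ j) x - x) L := (hgc.mono hLD).sub continuousOn_id
    have h2 := h1.preimage_isClosed_of_isClosed hL.isClosed (isClosed_singleton (x := (0 : E)))
    refine hL.of_isClosed_subset ?_ inter_subset_left
    convert h2 using 2
    ext x
    exact sub_eq_zero.symm
  · have h1 : L₀ ∩ {x | (G ^ j) x = x} = L₀ := inter_eq_left.2 fun z hz => (hL₀X hz).2
    rwa [h1] at hb

theorem exists_isAut {E : Type*} [NormedAddCommGroup E] [NormedSpace ℂ E] {D : Set E}
    {f g : E → E} (hf : DifferentiableOn ℂ f D) (hg : DifferentiableOn ℂ g D)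
    (hfD : MapsTo f D D) (hgD : MapsTo g D D) (hgf : ∀ z ∈ D, g (f z) = z)
    (hfg : ∀ z ∈ D, f (g z) = z) : ∃ F : Equiv.Perm E, IsAut D F ∧ ∀ z ∈ D, F z = f z := by
  classical
  let F : Equiv.Perm E :=
    { toFun := fun z => if z ∈ D then f z else z
      invFun := fun z => if z ∈ D then g z else z
      left_inv := fun z => by
        by_cases hz : z ∈ D
        · simp [hz, hfD hz, hgf z hz]
        · simp [hz]
      right_inv := fun z => by
        by_cases hz : z ∈ D
        · simp [hz, hgD hz, hfg z hz]
        · simp [hz] }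
  have hF : ∀ z ∈ D, F z = f z := fun z hz => if_pos hz
  have hF' : ∀ z ∈ D, (F⁻¹ : Equiv.Perm E) z = g z := fun z hz => if_pos hz
  have hoff : ∀ z, z ∉ D → F z = z := fun z hz => if_neg hz
  refine ⟨F, ⟨fun z => ⟨fun hz => ?_, fun hz => ?_⟩, hf.congr hF, hg.congr hF', hoff⟩, hF⟩
  · by_contra hzD
    exact hzD (hoff z hzD ▸ hz)
  · rw [hF z hz]
    exact hfD hz

end

theorem uniform_bound_dimension_two
    (D W : Set (CSpace 2)) (ρ : CSpace 2 → ℝ)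
    (hDopen : IsOpen D) (hDconn : IsConnected D) (hDbdd : Bornology.IsBounded D)
    (hbdry : RealAnalyticDefiningFn D W ρ) :
    ∃ m : ℕ, 0 < m ∧ ∀ f : CSpace 2 → CSpace 2, AutOn D f → DiscreteIn (FixOn D f) →
      (FixOn D f).Finite ∧ (FixOn D f).ncard ≤ m := by
  obtain ⟨hW, hDW, hρ, hneg, hzero, hgrad⟩ := hbdry
  have hE : Module.finrank ℂ (CSpace 2) = 2 := by simp
  obtain ⟨M, hM⟩ := IsAut.exists_bound hE hDopen hDconn.isPreconnected hDbdd hW hDW hρ hneg hzero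
    hgrad
  obtain ⟨R, hR⟩ := hDbdd.exists_norm_le
  refine ⟨M + 1, M.succ_pos, fun f hf hdisc => ?_⟩
  obtain ⟨hfd, hfb, g, hgd, hgb, hgf, hfg⟩ := hf
  obtain ⟨F, hF, hFf⟩ := exists_isAut hfd hgd hfb.mapsTo hgb.mapsTo hgf hfg
  have hgood : ∀ y ∈ FixOn D f, y ∈ D ∧ F y = y ∧ ∀ v, fderiv ℂ F y v = v → v = 0 := by
    rintro y ⟨hyD, hfy⟩
    have hFy : F y = y := (hFf y hyD).trans hfy
    refine ⟨hyD, hFy, fun v hv => hF.fderiv_sub_one_injective hDopen hR hyD hFy ?_ hv⟩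
    obtain ⟨ε, hε, hsep⟩ := hdisc y ⟨hyD, hfy⟩
    filter_upwards [mem_nhdsWithin_of_mem_nhds (ball_mem_nhds y hε),
      mem_nhdsWithin_of_mem_nhds (hDopen.mem_nhds hyD), self_mem_nhdsWithin] with z hz hzD hzy hFz
    exact absurd (hsep z ⟨hzD, (hFf z hzD).symm.trans hFz⟩ hzy) (not_le.2 hz)
  have hcard : ∀ T : Finset (CSpace 2), (T : Set (CSpace 2)) ⊆ FixOn D f → T.card ≤ M :=
    fun T hT => hM F hF T fun y hy => hgood y (hT hy)
  have hfin : (FixOn D f).Finite := by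
    by_contra hinf
    obtain ⟨T, hT, hTc⟩ := Set.Infinite.exists_subset_card_eq hinf (M + 1)
    have := hcard T hT
    omega
  refine ⟨hfin, ?_⟩
  rw [Set.ncard_eq_toFinset_card _ hfin]
  have := hcard hfin.toFinset (by simp)
  omega
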